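/- Sobolev–Poincaré inequality, subquadratic case: Let max{2n/(n+2),1} < p ≤ 2 and u be a weak solution of ∂_t(|u|^{p-2}u) − div A(x,t,u,Du) = div(|F|^{p-2}F) in Ω_T. Then on any cylinder Q_ρ^{(μ)}(z_o) ⊆ Ω_T with ρ, μ > 0 that is both μ-sub-intrinsic and μ-super-intrinsic with constant K, for any ε ∈ (0,1] one has, with q := max{2n/(n+2),1} and c = c(n,p,L,K): ⨍⨍_{Q_ρ^{(μ)}(z_o)} |u^⟨p/2⟩ − ((u)_{z_o;ρ}^{(μ)})^⟨p/2⟩|^2/(μ^{p−2}ρ^p) dx dt ≤ ε [ sup_{t ∈ Λ_ρ^{(μ)}(t_o)} ⨍_{B_ρ(x_o)} |u^⟨p/2⟩(·,t) − ((u)_{z_o;ρ}^{(μ)})^⟨p/2⟩|^2/(μ^{p−2}ρ^p) dx + ⨍⨍_{Q_ρ^{(μ)}(z_o)} |Du|^p dx dt ] + (c/ε^{(2−q(p−1))/(q(p−1))}) [ (⨍⨍_{Q_ρ^{(μ)}(z_o)} |Du|^q dx dt)^{p/q} + ⨍⨍_{Q_ρ^{(μ)}(z_o)} |F|^p dx dt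 ]. -/

import Mathlib

open MeasureTheory Set Filter
open scoped ENNReal Topology BigOperators

noncomputable section

abbrev Spc (n : ℕ) := EuclideanSpace ℝ (Fin n)
abbrev Vec (N : ℕ) := EuclideanSpace ℝ (Fin N)
abbrev Mat (N n : ℕ) := EuclideanSpace ℝ (Fin N × Fin n)

variable {n N : ℕ}

/-- Spatial partial derivative in direction `j` of a scalar function on space-time. -/
def pderivS (j : Fin n) (f : Spc n × ℝ → ℝ) (z : Spc n × ℝ) : ℝ :=
  fderiv ℝ (fun y => f (y, z.2)) z.1 (EuclideanSpace.single j 1)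

/-- Time derivative of a vector-valued function on space-time. -/
def tderiv (φ : Spc n × ℝ → Vec N) (z : Spc n × ℝ) : Vec N :=
  deriv (fun s => φ (z.1, s)) z.2

/-- Pairing `M · Dφ = ∑_{i,j} M_{ij} ∂_j φ_i` of a matrix field with the spatial gradient of a
test function. -/
def gradPair (M : Spc n × ℝ → Mat N n) (φ : Spc n × ℝ → Vec N) (z : Spc n × ℝ) : ℝ :=
  ∑ i : Fin N, ∑ j : Fin n, M z (i, j) * pderivS j (fun w => φ w i) z

/-- The power `w^⟨α⟩ := |w|^{α-1} w` of a vector. -/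
def pw (α : ℝ) (w : Vec N) : Vec N := ‖w‖ ^ (α - 1) • w

/-- Weak solution of the doubly nonlinear system
`∂_t(|u|^{p-2}u) − div A(x,t,u,Du) = div(|F|^{p-2}F)` in `Ω_T = Ω × (0,T)`. -/
structure WeakSolution (p ν L T : ℝ) (Ω : Set (Spc n))
    (A : Spc n × ℝ → Vec N → Mat N n → Mat N n)
    (F : Spc n × ℝ → Mat N n)
    (u : Spc n × ℝ → Vec N) (Du : Spc n × ℝ → Mat N n) : Prop where
  hn : 1 ≤ n
  hT : 0 < T
  openΩ : IsOpen Ω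
  bddΩ : Bornology.IsBounded Ω
  connΩ : IsConnected Ω
  hν : 0 < ν
  hνL : ν ≤ L
  measA : ∀ (v : Vec N) (ξ : Mat N n), Measurable fun z => A z v ξ
  contA : ∀ᵐ z ∂(volume.restrict (Ω ×ˢ Ioo 0 T)),
    Continuous fun q : Vec N × Mat N n => A z q.1 q.2
  coercivity : ∀ᵐ z ∂(volume.restrict (Ω ×ˢ Ioo 0 T)),
    ∀ (v : Vec N) (ξ : Mat N n), ν * ‖ξ‖ ^ p ≤ (inner ℝ (A z v ξ) ξ : ℝ)
  growth : ∀ᵐ z ∂(volume.restrict (Ω ×ˢ Ioo 0 T)),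
    ∀ (v : Vec N) (ξ : Mat N n), ‖A z v ξ‖ ≤ L * ‖ξ‖ ^ (p - 1)
  measu : Measurable u
  measDu : Measurable Du
  measF : Measurable F
  memLp_u : MemLp u (ENNReal.ofReal p) (volume.restrict (Ω ×ˢ Ioo 0 T))
  memLp_Du : MemLp Du (ENNReal.ofReal p) (volume.restrict (Ω ×ˢ Ioo 0 T))
  memLp_F : MemLp F (ENNReal.ofReal p) (volume.restrict (Ω ×ˢ Ioo 0 T))
  sliceLp : ∀ t ∈ Icc (0:ℝ) T,
    MemLp (fun x => u (x, t)) (ENNReal.ofReal p) (volume.restrict Ω)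
  timeCont : ∀ t₀ ∈ Icc (0:ℝ) T,
    Tendsto (fun t => ∫ x in Ω, ‖u (x, t) - u (x, t₀)‖ ^ p) (𝓝[Icc (0:ℝ) T] t₀) (𝓝 0)
  weakGrad : ∀ ψ : Spc n × ℝ → ℝ, ContDiff ℝ (⊤ : ℕ∞) ψ → HasCompactSupport ψ →
    tsupport ψ ⊆ Ω ×ˢ Ioo 0 T → ∀ (i : Fin N) (j : Fin n),
      ∫ z in Ω ×ˢ Ioo 0 T, u z i * pderivS j ψ z
        = - ∫ z in Ω ×ˢ Ioo 0 T, Du z (i, j) * ψ z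
  weakForm : ∀ φ : Spc n × ℝ → Vec N, ContDiff ℝ (⊤ : ℕ∞) φ → HasCompactSupport φ →
    tsupport φ ⊆ Ω ×ˢ Ioo 0 T →
      ∫ z in Ω ×ˢ Ioo 0 T,
        (‖u z‖ ^ (p - 2) * (inner ℝ (u z) (tderiv φ z) : ℝ)
          - gradPair (fun w => A w (u w) (Du w)) φ z)
        = ∫ z in Ω ×ˢ Ioo 0 T, ‖F z‖ ^ (p - 2) * gradPair F φ z

/-- The scaled parabolic cylinder `Q_ρ^{(μ)}(z₀)`:
`B_ρ(x₀) × (t₀ − μ^{p−2}ρ^p, t₀ + μ^{p−2}ρ^p)` if `p < 2`, and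
`B_{μ^{(2−p)/p}ρ}(x₀) × (t₀ − ρ^p, t₀ + ρ^p)` if `p ≥ 2`. -/
def parCyl (p μ ρ : ℝ) (z₀ : Spc n × ℝ) : Set (Spc n × ℝ) :=
  if p < 2 then
    Metric.ball z₀.1 ρ ×ˢ Ioo (z₀.2 - μ ^ (p - 2) * ρ ^ p) (z₀.2 + μ ^ (p - 2) * ρ ^ p)
  else
    Metric.ball z₀.1 (μ ^ ((2 - p) / p) * ρ) ×ˢ Ioo (z₀.2 - ρ ^ p) (z₀.2 + ρ ^ p)

/-- `Q_ρ^{(μ)}(z₀)` is `μ`-sub-intrinsic with constant `K`: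
`⨍⨍ |u|^p/(μ^{2−𝔭}ρ^p) ≤ K μ^p ⨍⨍ (|Du|^p + |F|^p)`, where `𝔭 = max{p,2}`. -/
def SubIntrinsic (p K μ ρ : ℝ) (z₀ : Spc n × ℝ) (u : Spc n × ℝ → Vec N)
    (Du F : Spc n × ℝ → Mat N n) : Prop :=
  ⨍ z in parCyl p μ ρ z₀, ‖u z‖ ^ p / (μ ^ (2 - max p 2) * ρ ^ p)
    ≤ K * μ ^ p * ⨍ z in parCyl p μ ρ z₀, (‖Du z‖ ^ p + ‖F z‖ ^ p)

/-- `Q_ρ^{(μ)}(z₀)` is `μ`-super-intrinsic with constant `K`: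
either `μ^p ⨍⨍ (|Du|^p + |F|^p) ≤ K ⨍⨍ |u|^p/(μ^{2−𝔭}ρ^p)` or `μ^p ≤ K`. -/
def SuperIntrinsic (p K μ ρ : ℝ) (z₀ : Spc n × ℝ) (u : Spc n × ℝ → Vec N)
    (Du F : Spc n × ℝ → Mat N n) : Prop :=
  (μ ^ p * ⨍ z in parCyl p μ ρ z₀, (‖Du z‖ ^ p + ‖F z‖ ^ p)
      ≤ K * ⨍ z in parCyl p μ ρ z₀, ‖u z‖ ^ p / (μ ^ (2 - max p 2) * ρ ^ p))
    ∨ μ ^ p ≤ K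

/-! ### The power map `w ↦ w^⟨α⟩` -/

theorem norm_pw {α : ℝ} (hα : 0 < α) (w : Vec N) : ‖pw α w‖ = ‖w‖ ^ α := by
  rcases eq_or_ne w 0 with rfl | hw
  · simp [pw, Real.zero_rpow hα.ne']
  · have h : 0 < ‖w‖ := norm_pos_iff.2 hw
    rw [pw, norm_smul, Real.norm_of_nonneg (by positivity), Real.rpow_sub_one h.ne']
    field_simp

theorem pw_zero (α : ℝ) : pw α (0 : Vec N) = 0 := by simp [pw]

theorem pw_one (w : Vec N) : pw 1 w = w := by simp [pw]

theorem pw_pw {α β : ℝ} (hβ : 0 < β) (w : Vec N) : pw α (pw β w) = pw (β * α) w := by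
  rcases eq_or_ne w 0 with rfl | hw
  · simp [pw_zero]
  · have h : 0 < ‖w‖ := norm_pos_iff.2 hw
    conv_lhs => rw [pw, norm_pw hβ]
    rw [pw, pw, smul_smul, ← Real.rpow_mul h.le, ← Real.rpow_add h]
    congr 2
    ring

theorem pw_smul {α r : ℝ} (hr : 0 < r) (w : Vec N) : pw α (r • w) = r ^ α • pw α w := by
  rw [pw, pw, norm_smul, Real.norm_of_nonneg hr.le, Real.mul_rpow hr.le (norm_nonneg _), smul_smul,
    smul_smul, Real.rpow_sub_one hr.ne']
  congr 1
  field_simp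

theorem measurable_pw (α : ℝ) : Measurable (pw α : Vec N → Vec N) := by
  unfold pw
  fun_prop

/-- The power map of exponent `s ≥ 1` is Lipschitz with a constant that grows like `|·|^{s-1}`. -/
theorem norm_pw_sub_pw_le {s : ℝ} (hs : 1 ≤ s) (a b : Vec N) :
    ‖pw s a - pw s b‖ ≤ (1 + s) * max ‖a‖ ‖b‖ ^ (s - 1) * ‖a - b‖ := by
  wlog h : ‖b‖ ≤ ‖a‖ generalizing a b
  · rw [norm_sub_rev, max_comm, norm_sub_rev a b]
    exact this b a (le_of_not_ge h)
  rw [max_eq_left h]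
  rcases eq_or_ne a 0 with rfl | ha
  · have : b = 0 := by simpa using h
    simp [this]
  have ha : 0 < ‖a‖ := norm_pos_iff.2 ha
  have hb : 0 ≤ ‖b‖ := norm_nonneg b
  have e : pw s a - pw s b = ‖a‖ ^ (s - 1) • (a - b) + (‖a‖ ^ (s - 1) - ‖b‖ ^ (s - 1)) • b := by
    simp only [pw, smul_sub, sub_smul]; abel
  have hmono : ‖b‖ ^ (s - 1) ≤ ‖a‖ ^ (s - 1) := Real.rpow_le_rpow hb h (by linarith)
  have key : (‖a‖ ^ (s - 1) - ‖b‖ ^ (s - 1)) * ‖b‖ ≤ s * ‖a‖ ^ (s - 1) * (‖a‖ - ‖b‖) := by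
    set r := ‖b‖ / ‖a‖ with hr
    have hr0 : 0 ≤ r := by positivity
    have hr1 : r ≤ 1 := by rw [hr, div_le_one ha]; exact h
    have hbr : ‖b‖ = r * ‖a‖ := by rw [hr]; field_simp
    have hbern : 1 + s * (r - 1) ≤ r ^ s := by
      have := one_add_mul_self_le_rpow_one_add (s := r - 1) (by linarith) hs
      simpa using this
    have hbs : ‖b‖ ^ (s - 1) * ‖b‖ = r ^ s * (‖a‖ ^ (s - 1) * ‖a‖) := by
      rcases eq_or_lt_of_le hb with h0 | h0
      · have : r = 0 := by rw [hr, ← h0]; simp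
        rw [← h0, this, Real.zero_rpow (by linarith : s ≠ 0)]; simp
      · rw [← Real.rpow_add_one h0.ne', ← Real.rpow_add_one ha.ne', hbr,
          Real.mul_rpow hr0 ha.le]
        simp
    have hP : 0 < ‖a‖ ^ (s - 1) * ‖a‖ := by positivity
    have e1 : (‖a‖ ^ (s - 1) - ‖b‖ ^ (s - 1)) * ‖b‖
        = (r - r ^ s) * (‖a‖ ^ (s - 1) * ‖a‖) := by
      rw [sub_mul, hbs]
      conv_lhs => rw [hbr]
      ring
    have e2 : s * ‖a‖ ^ (s - 1) * (‖a‖ - ‖b‖) = s * (1 - r) * (‖a‖ ^ (s - 1) * ‖a‖) := by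
      conv_lhs => rw [hbr]
      ring
    rw [e1, e2]
    apply mul_le_mul_of_nonneg_right _ hP.le
    linarith
  calc ‖pw s a - pw s b‖
      ≤ ‖a‖ ^ (s - 1) * ‖a - b‖ + (‖a‖ ^ (s - 1) - ‖b‖ ^ (s - 1)) * ‖b‖ := by
        rw [e]
        refine (norm_add_le _ _).trans ?_
        rw [norm_smul, norm_smul, Real.norm_of_nonneg (by positivity),
          Real.norm_of_nonneg (sub_nonneg.2 hmono)]
    _ ≤ ‖a‖ ^ (s - 1) * ‖a - b‖ + s * ‖a‖ ^ (s - 1) * (‖a‖ - ‖b‖) := by linarith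
    _ ≤ ‖a‖ ^ (s - 1) * ‖a - b‖ + s * ‖a‖ ^ (s - 1) * ‖a - b‖ := by
        gcongr
        exact norm_sub_norm_le a b
    _ = _ := by ring

theorem le_norm_pw_sub_pw {s : ℝ} (hs : 1 ≤ s) (a b : Vec N) :
    max ‖a‖ ‖b‖ ^ (s - 1) * ‖a - b‖ ≤ 2 * ‖pw s a - pw s b‖ := by
  rcases eq_or_ne a b with rfl | hab
  · simp
  have hpos : 0 < ‖a - b‖ := norm_pos_iff.2 (sub_ne_zero.2 hab)
  have ha : 0 ≤ ‖a‖ := norm_nonneg a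
  have hb : 0 ≤ ‖b‖ := norm_nonneg b
  have hin : (inner ℝ (pw s a - pw s b) (a - b) : ℝ)
      = (‖a‖ ^ (s - 1) + ‖b‖ ^ (s - 1)) / 2 * ‖a - b‖ ^ 2
        + (‖a‖ ^ (s - 1) - ‖b‖ ^ (s - 1)) * (‖a‖ ^ 2 - ‖b‖ ^ 2) / 2 := by
    have h1 : ‖a - b‖ ^ 2 = ‖a‖ ^ 2 - 2 * inner ℝ a b + ‖b‖ ^ 2 := norm_sub_sq_real a b
    simp only [pw, inner_sub_left, inner_sub_right, real_inner_smul_left,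
      real_inner_self_eq_norm_sq, real_inner_comm a b]
    rw [h1]
    ring
  have hsgn : 0 ≤ (‖a‖ ^ (s - 1) - ‖b‖ ^ (s - 1)) * (‖a‖ ^ 2 - ‖b‖ ^ 2) := by
    rcases le_total ‖a‖ ‖b‖ with h | h
    · apply mul_nonneg_of_nonpos_of_nonpos
      · linarith [Real.rpow_le_rpow ha h (by linarith : 0 ≤ s - 1)]
      · nlinarith
    · apply mul_nonneg
      · linarith [Real.rpow_le_rpow hb h (by linarith : 0 ≤ s - 1)]
      · nlinarith
  have hmax : max ‖a‖ ‖b‖ ^ (s - 1) ≤ ‖a‖ ^ (s - 1) + ‖b‖ ^ (s - 1) := by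
    rcases le_total ‖a‖ ‖b‖ with h | h
    · rw [max_eq_right h]; linarith [Real.rpow_nonneg ha (s - 1)]
    · rw [max_eq_left h]; linarith [Real.rpow_nonneg hb (s - 1)]
  have hcs : (inner ℝ (pw s a - pw s b) (a - b) : ℝ) ≤ ‖pw s a - pw s b‖ * ‖a - b‖ :=
    real_inner_le_norm _ _
  have : max ‖a‖ ‖b‖ ^ (s - 1) * ‖a - b‖ * ‖a - b‖ ≤ 2 * ‖pw s a - pw s b‖ * ‖a - b‖ := by
    nlinarith [mul_le_mul_of_nonneg_right hmax (sq_nonneg ‖a - b‖)]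
  exact le_of_mul_le_mul_right this hpos

theorem norm_sub_rpow_le {s : ℝ} (hs : 1 ≤ s) (a b : Vec N) :
    ‖a - b‖ ^ s ≤ 2 ^ s * ‖pw s a - pw s b‖ := by
  rcases eq_or_ne a b with rfl | hab
  · simp [Real.zero_rpow (by linarith : s ≠ 0)]
  have hpos : 0 < ‖a - b‖ := norm_pos_iff.2 (sub_ne_zero.2 hab)
  have h1 : ‖a - b‖ ≤ 2 * max ‖a‖ ‖b‖ := by
    have := norm_sub_le a b
    linarith [le_max_left ‖a‖ ‖b‖, le_max_right ‖a‖ ‖b‖]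
  have hm : 0 ≤ max ‖a‖ ‖b‖ := le_max_of_le_left (norm_nonneg a)
  calc ‖a - b‖ ^ s = ‖a - b‖ ^ (s - 1) * ‖a - b‖ := by
        rw [← Real.rpow_add_one hpos.ne']; simp
    _ ≤ (2 * max ‖a‖ ‖b‖) ^ (s - 1) * ‖a - b‖ := by gcongr
    _ = 2 ^ (s - 1) * (max ‖a‖ ‖b‖ ^ (s - 1) * ‖a - b‖) := by
        rw [Real.mul_rpow (by norm_num) hm]; ring
    _ ≤ 2 ^ (s - 1) * (2 * ‖pw s a - pw s b‖) := by
        exact mul_le_mul_of_nonneg_left (le_norm_pw_sub_pw hs a b) (by positivity)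
    _ = 2 ^ s * ‖pw s a - pw s b‖ := by
        rw [Real.rpow_sub_one (by norm_num)]; ring

theorem norm_pw_sub_pw_le_add {s : ℝ} (hs : 1 ≤ s) (a b : Vec N) :
    ‖pw s a - pw s b‖
      ≤ (1 + s) * 2 ^ s * (‖a - b‖ ^ s + ‖b‖ ^ (s - 1) * ‖a - b‖) := by
  rcases eq_or_ne a b with rfl | hab
  · simp [Real.zero_rpow (by linarith : s ≠ 0)]
  have hpos : 0 < ‖a - b‖ := norm_pos_iff.2 (sub_ne_zero.2 hab)
  have hs' : 0 ≤ s - 1 := by linarith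
  have h1 : max ‖a‖ ‖b‖ ≤ 2 * max ‖a - b‖ ‖b‖ := by
    have h2 : ‖a‖ ≤ ‖a - b‖ + ‖b‖ := by simpa using norm_add_le (a - b) b
    have := le_max_left ‖a - b‖ ‖b‖
    have := le_max_right ‖a - b‖ ‖b‖
    exact max_le (by linarith) (by linarith [norm_nonneg b])
  have h3 : max ‖a‖ ‖b‖ ^ (s - 1) ≤ 2 ^ s * (‖a - b‖ ^ (s - 1) + ‖b‖ ^ (s - 1)) := by
    have hm : (0:ℝ) ≤ max ‖a‖ ‖b‖ := le_max_of_le_left (norm_nonneg a)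
    calc max ‖a‖ ‖b‖ ^ (s - 1) ≤ (2 * max ‖a - b‖ ‖b‖) ^ (s - 1) := by gcongr
      _ = 2 ^ (s - 1) * max ‖a - b‖ ‖b‖ ^ (s - 1) :=
          Real.mul_rpow (by norm_num) (le_max_of_le_left hpos.le)
      _ ≤ 2 ^ s * max ‖a - b‖ ‖b‖ ^ (s - 1) := by
          have : 0 ≤ max ‖a - b‖ ‖b‖ ^ (s - 1) :=
            Real.rpow_nonneg (le_max_of_le_left hpos.le) _
          gcongr
          · norm_num
          · linarith
      _ ≤ _ := by
          gcongr
          rcases max_choice ‖a - b‖ ‖b‖ with h | h <;> rw [h]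
          · linarith [Real.rpow_nonneg (norm_nonneg b) (s - 1)]
          · linarith [Real.rpow_nonneg hpos.le (s - 1)]
  calc ‖pw s a - pw s b‖ ≤ (1 + s) * max ‖a‖ ‖b‖ ^ (s - 1) * ‖a - b‖ := norm_pw_sub_pw_le hs a b
    _ ≤ (1 + s) * (2 ^ s * (‖a - b‖ ^ (s - 1) + ‖b‖ ^ (s - 1))) * ‖a - b‖ := by gcongr
    _ = (1 + s) * 2 ^ s * (‖a - b‖ ^ (s - 1) * ‖a - b‖ + ‖b‖ ^ (s - 1) * ‖a - b‖) := by ring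
    _ = _ := by rw [← Real.rpow_add_one hpos.ne']; simp

theorem norm_pw_half_sub_sq_le {p : ℝ} (hp : 0 < p) (hp2 : p ≤ 2) (a b : Vec N) :
    ‖pw (p / 2) a - pw (p / 2) b‖ ^ 2 ≤ 4 * ‖a - b‖ ^ p := by
  have hs : 1 ≤ 2 / p := by rw [le_div_iff₀ hp]; linarith
  have h := norm_sub_rpow_le hs (pw (p / 2) a) (pw (p / 2) b)
  rw [pw_pw (by positivity), pw_pw (by positivity),
    show p / 2 * (2 / p) = 1 by field_simp, pw_one, pw_one] at h
  have h2 := Real.rpow_le_rpow (by positivity) h hp.le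
  rw [Real.mul_rpow (by positivity) (norm_nonneg _), ← Real.rpow_mul (norm_nonneg _),
    ← Real.rpow_mul (by norm_num), show 2 / p * p = 2 by field_simp] at h2
  norm_num at h2 ⊢
  exact h2

theorem norm_rpow_mul_norm_pw_half_sub_sq_le {p : ℝ} (hp : 0 < p) (hp2 : p ≤ 2) (a b : Vec N) :
    ‖b‖ ^ (2 - p) * ‖pw (p / 2) a - pw (p / 2) b‖ ^ 2 ≤ 4 * ‖a - b‖ ^ 2 := by
  have hs : 1 ≤ 2 / p := by rw [le_div_iff₀ hp]; linarith
  have h := le_norm_pw_sub_pw hs (pw (p / 2) a) (pw (p / 2) b)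
  rw [pw_pw (by positivity), pw_pw (by positivity),
    show p / 2 * (2 / p) = 1 by field_simp, pw_one, pw_one] at h
  have h1 : ‖b‖ ^ (1 - p / 2) ≤ max ‖pw (p / 2) a‖ ‖pw (p / 2) b‖ ^ (2 / p - 1) := by
    have : ‖b‖ ^ (1 - p / 2) = ‖pw (p / 2) b‖ ^ (2 / p - 1) := by
      rw [norm_pw (by positivity), ← Real.rpow_mul (norm_nonneg _)]
      congr 1; field_simp
    rw [this]
    exact Real.rpow_le_rpow (norm_nonneg _) (le_max_right _ _) (by linarith)
  have h2 : ‖b‖ ^ (1 - p / 2) * ‖pw (p / 2) a - pw (p / 2) b‖ ≤ 2 * ‖a - b‖ :=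
    (mul_le_mul_of_nonneg_right h1 (norm_nonneg _)).trans h
  have h3 : ‖b‖ ^ (2 - p) = (‖b‖ ^ (1 - p / 2)) ^ 2 := by
    rw [← Real.rpow_natCast, ← Real.rpow_mul (norm_nonneg _)]
    congr 1; push_cast; ring
  rw [h3, ← mul_pow]
  calc _ ≤ (2 * ‖a - b‖) ^ 2 := by gcongr
    _ = _ := by ring

theorem norm_pw_half_sq {p : ℝ} (hp : 0 < p) (a : Vec N) : ‖pw (p / 2) a‖ ^ 2 = ‖a‖ ^ p := by
  rw [norm_pw (by positivity), ← Real.rpow_natCast, ← Real.rpow_mul (norm_nonneg _)]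
  congr 1; push_cast; ring

theorem norm_pw_half_sub_sq_le_add {p : ℝ} (hp : 0 < p) (a b : Vec N) :
    ‖pw (p / 2) a - pw (p / 2) b‖ ^ 2 ≤ 2 * ‖a‖ ^ p + 2 * ‖b‖ ^ p := by
  rw [← norm_pw_half_sq hp, ← norm_pw_half_sq hp]
  have := norm_sub_le (pw (p / 2) a) (pw (p / 2) b)
  nlinarith [norm_nonneg (pw (p / 2) a - pw (p / 2) b), sq_nonneg (‖pw (p / 2) a‖ - ‖pw (p / 2) b‖)]

/-! ### Jensen's inequality and quasi-minimality of means -/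

theorem add_rpow_le_two_rpow_mul {a b p : ℝ} (ha : 0 ≤ a) (hb : 0 ≤ b) (hp : 0 ≤ p) :
    (a + b) ^ p ≤ 2 ^ p * (a ^ p + b ^ p) := by
  have h : a + b ≤ 2 * max a b := by linarith [le_max_left a b, le_max_right a b]
  have hm : 0 ≤ max a b := le_max_of_le_left ha
  calc (a + b) ^ p ≤ (2 * max a b) ^ p := by gcongr
    _ = 2 ^ p * max a b ^ p := Real.mul_rpow (by norm_num) hm
    _ ≤ _ := by
      gcongr
      rcases max_choice a b with h | h <;> rw [h]
      · linarith [Real.rpow_nonneg hb p]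
      · linarith [Real.rpow_nonneg ha p]

section Means

variable {X : Type*} [MeasurableSpace X] {P : Measure X}

theorem integrable_rpow_of_le [IsFiniteMeasure P] {f : X → ℝ} (hf : AEStronglyMeasurable f P)
    (hf0 : ∀ x, 0 ≤ f x) {a b : ℝ} (ha : 0 ≤ a) (hab : a ≤ b)
    (hb : Integrable (fun x => f x ^ b) P) : Integrable (fun x => f x ^ a) P := by
  refine Integrable.mono' ((integrable_const (1 : ℝ)).add hb)
    (hf.aemeasurable.pow_const a).aestronglyMeasurable (Eventually.of_forall fun x => ?_)
  rw [Real.norm_of_nonneg (Real.rpow_nonneg (hf0 x) _)]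
  have h0 : 0 ≤ f x ^ b := Real.rpow_nonneg (hf0 x) _
  simp only [Pi.add_apply]
  rcases le_total (f x) 1 with h | h
  · linarith [Real.rpow_le_one (hf0 x) h ha]
  · linarith [Real.rpow_le_rpow_of_exponent_le h hab]

theorem rpow_integral_le [IsProbabilityMeasure P] {f : X → ℝ} (hf0 : ∀ x, 0 ≤ f x) {s : ℝ}
    (hs : 1 ≤ s) (hf : Integrable f P) (hfs : Integrable (fun x => f x ^ s) P) :
    (∫ x, f x ∂P) ^ s ≤ ∫ x, f x ^ s ∂P :=
  (convexOn_rpow hs).map_integral_le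
    (Real.continuous_rpow_const (by linarith)).continuousOn
    isClosed_Ici (Eventually.of_forall hf0) hf hfs

theorem integral_rpow_le_rpow [IsProbabilityMeasure P] {f : X → ℝ}
    (hf : AEStronglyMeasurable f P) (hf0 : ∀ x, 0 ≤ f x) {a b : ℝ} (ha : 0 ≤ a) (hb0 : 0 < b)
    (hab : a ≤ b) (hb : Integrable (fun x => f x ^ b) P) :
    ∫ x, f x ^ a ∂P ≤ (∫ x, f x ^ b ∂P) ^ (a / b) := by
  rcases eq_or_lt_of_le ha with rfl | ha
  · simp
  have hs : 1 ≤ b / a := by rwa [one_le_div ha]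
  have e : ∀ x, (f x ^ a) ^ (b / a) = f x ^ b := fun x => by
    rw [← Real.rpow_mul (hf0 x)]; congr 1; field_simp
  have h := rpow_integral_le (P := P) (f := fun x => f x ^ a)
    (fun x => Real.rpow_nonneg (hf0 x) _) hs (integrable_rpow_of_le hf hf0 ha.le hab hb)
    (by simpa only [e] using hb)
  simp only [e] at h
  have h0 : 0 ≤ ∫ x, f x ^ a ∂P := integral_nonneg fun x => Real.rpow_nonneg (hf0 x) _
  have h2 := Real.rpow_le_rpow (Real.rpow_nonneg h0 _) h (by positivity : 0 ≤ a / b)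
  rwa [← Real.rpow_mul h0, show b / a * (a / b) = 1 by field_simp, Real.rpow_one] at h2

theorem integrable_of_rpow [IsFiniteMeasure P] {p : ℝ} (hp : 1 ≤ p) {f : X → Vec N}
    (hf : AEStronglyMeasurable f P) (hfp : Integrable (fun x => ‖f x‖ ^ p) P) : Integrable f P := by
  have := integrable_rpow_of_le hf.norm (fun x => norm_nonneg _) zero_le_one hp hfp
  simp only [Real.rpow_one] at this
  exact (integrable_norm_iff hf).1 this

theorem integrable_norm_sub_rpow [IsFiniteMeasure P] {p : ℝ} (hp : 1 ≤ p) {f : X → Vec N}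
    (hf : AEStronglyMeasurable f P) (hfp : Integrable (fun x => ‖f x‖ ^ p) P) (b : Vec N) :
    Integrable (fun x => ‖f x - b‖ ^ p) P := by
  refine Integrable.mono' ((hfp.add (integrable_const (‖b‖ ^ p))).const_mul (2 ^ p))
    ((hf.sub aestronglyMeasurable_const).norm.aemeasurable.pow_const p).aestronglyMeasurable
    (Eventually.of_forall fun x => ?_)
  rw [Real.norm_of_nonneg (by positivity)]
  calc ‖f x - b‖ ^ p ≤ (‖f x‖ + ‖b‖) ^ p := by gcongr; exact norm_sub_le _ _
    _ ≤ _ := add_rpow_le_two_rpow_mul (norm_nonneg _) (norm_nonneg _) (by linarith)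

theorem aestronglyMeasurable_pw {f : X → Vec N} (hf : AEStronglyMeasurable f P) (α : ℝ) :
    AEStronglyMeasurable (fun x => pw α (f x)) P :=
  ((measurable_pw α).comp_aemeasurable hf.aemeasurable).aestronglyMeasurable

/-- A weighted mean, compared with a constant after applying the power map of exponent `s ≥ 1`. -/
theorem norm_pw_weighted_mean_sub_le [IsProbabilityMeasure P] {s C₀ : ℝ} (hs : 1 ≤ s)
    {η : X → ℝ} (hη : AEStronglyMeasurable η P) (hη0 : ∀ x, 0 ≤ η x) (hηC : ∀ x, η x ≤ C₀)
    (hη1 : ∫ x, η x ∂P = 1) {U : X → Vec N} (hU : AEStronglyMeasurable U P)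
    (hUs : Integrable (fun x => ‖U x‖ ^ s) P) (B : Vec N) :
    ‖pw s (∫ x, η x • U x ∂P) - pw s B‖
      ≤ (1 + s) * 2 ^ s * (C₀ ^ s * 2 ^ s + 2 * C₀) * ∫ x, ‖pw s (U x) - pw s B‖ ∂P := by
  have hs0 : 0 < s := by linarith
  have hC₀ : 0 ≤ C₀ := by
    obtain ⟨x⟩ : Nonempty X := P.nonempty_of_neZero
    exact (hη0 x).trans (hηC x)
  have hUi : Integrable U P := integrable_of_rpow hs hU hUs
  have hηi : Integrable η P := Integrable.mono' (integrable_const C₀) hη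
    (Eventually.of_forall fun x => by rw [Real.norm_of_nonneg (hη0 x)]; exact hηC x)
  have hηU : Integrable (fun x => η x • U x) P := hUi.bdd_smul C₀ hη
    (Eventually.of_forall fun x => by rw [Real.norm_of_nonneg (hη0 x)]; exact hηC x)
  have hUB : Integrable (fun x => ‖U x - B‖) P := (hUi.sub (integrable_const B)).norm
  have hUBs : Integrable (fun x => ‖U x - B‖ ^ s) P := integrable_norm_sub_rpow hs hU hUs B
  have hh : Integrable (fun x => ‖pw s (U x) - pw s B‖) P := by
    refine (Integrable.sub ?_ (integrable_const _)).norm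
    refine Integrable.mono' hUs (aestronglyMeasurable_pw hU s) (Eventually.of_forall fun x => ?_)
    rw [norm_pw hs0]
  set M := ∫ x, η x • U x ∂P with hM
  set H := ∫ x, ‖pw s (U x) - pw s B‖ ∂P with hH
  set J := ∫ x, ‖U x - B‖ ∂P with hJ
  have hJ0 : 0 ≤ J := integral_nonneg fun x => norm_nonneg _
  have hMB : ‖M - B‖ ≤ C₀ * J := by
    have e : M - B = ∫ x, η x • (U x - B) ∂P := by
      simp only [smul_sub]
      rw [integral_sub hηU (hηi.smul_const B), integral_smul_const, hη1, one_smul]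
    rw [e, hJ, ← integral_const_mul]
    refine norm_integral_le_of_norm_le (hUB.const_mul _) (Eventually.of_forall fun x => ?_)
    rw [norm_smul, Real.norm_of_nonneg (hη0 x)]
    exact mul_le_mul_of_nonneg_right (hηC x) (norm_nonneg _)
  have h1 : ‖M - B‖ ^ s ≤ C₀ ^ s * 2 ^ s * H := by
    calc ‖M - B‖ ^ s ≤ (C₀ * J) ^ s := by gcongr
      _ = C₀ ^ s * J ^ s := Real.mul_rpow hC₀ hJ0
      _ ≤ C₀ ^ s * ∫ x, ‖U x - B‖ ^ s ∂P := by
          gcongr; exact rpow_integral_le (fun x => norm_nonneg _) hs hUB hUBs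
      _ ≤ C₀ ^ s * (2 ^ s * H) := by
          refine mul_le_mul_of_nonneg_left ?_ (by positivity)
          rw [hH, ← integral_const_mul]
          exact integral_mono hUBs (hh.const_mul _) fun x => norm_sub_rpow_le hs _ _
      _ = _ := by ring
  have h2 : ‖B‖ ^ (s - 1) * ‖M - B‖ ≤ 2 * C₀ * H := by
    have h3 : ‖B‖ ^ (s - 1) * J ≤ 2 * H := by
      rw [hJ, hH, ← integral_const_mul, ← integral_const_mul]
      refine integral_mono (hUB.const_mul _) (hh.const_mul _) fun x => ?_
      refine le_trans ?_ (le_norm_pw_sub_pw hs _ _)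
      exact mul_le_mul_of_nonneg_right (Real.rpow_le_rpow (norm_nonneg _) (le_max_right _ _)
        (by linarith)) (norm_nonneg _)
    calc ‖B‖ ^ (s - 1) * ‖M - B‖ ≤ ‖B‖ ^ (s - 1) * (C₀ * J) := by gcongr
      _ = C₀ * (‖B‖ ^ (s - 1) * J) := by ring
      _ ≤ C₀ * (2 * H) := by gcongr
      _ = _ := by ring
  calc ‖pw s M - pw s B‖ ≤ _ := norm_pw_sub_pw_le_add hs M B
    _ ≤ (1 + s) * 2 ^ s * (C₀ ^ s * 2 ^ s * H + 2 * C₀ * H) := by gcongr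
    _ = _ := by ring

theorem integrable_pw_half_sub_sq [IsFiniteMeasure P] {p : ℝ} (hp : 0 < p) {f : X → Vec N}
    (hf : AEStronglyMeasurable f P) (hfp : Integrable (fun x => ‖f x‖ ^ p) P) (b : Vec N) :
    Integrable (fun x => ‖pw (p / 2) (f x) - pw (p / 2) b‖ ^ 2) P := by
  refine Integrable.mono' ((hfp.const_mul 2).add (integrable_const (2 * ‖b‖ ^ p)))
    (((aestronglyMeasurable_pw hf _).sub aestronglyMeasurable_const).norm.pow 2)
    (Eventually.of_forall fun x => ?_)
  rw [Real.norm_of_nonneg (by positivity)]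
  exact norm_pw_half_sub_sq_le_add hp _ _

theorem sq_integral_le [IsProbabilityMeasure P] {f : X → ℝ} (hf0 : ∀ x, 0 ≤ f x)
    (hf : AEStronglyMeasurable f P) (hf2 : Integrable (fun x => f x ^ 2) P) :
    (∫ x, f x ∂P) ^ 2 ≤ ∫ x, f x ^ 2 ∂P := by
  have h2 : Integrable (fun x => f x ^ (2 : ℝ)) P := by simpa using hf2
  have h1 := integrable_rpow_of_le hf hf0 zero_le_one one_le_two h2
  simp only [Real.rpow_one] at h1
  simpa using rpow_integral_le hf0 one_le_two h1 h2

/-- The mean value is a quasi-minimizer of `b ↦ ∫ |f^⟨p/2⟩ - b^⟨p/2⟩|²`. -/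
theorem norm_pw_half_mean_sub_sq_le [IsProbabilityMeasure P] {p : ℝ} (hp : 1 ≤ p) (hp2 : p ≤ 2)
    {f : X → Vec N} (hf : AEStronglyMeasurable f P) (hfp : Integrable (fun x => ‖f x‖ ^ p) P)
    (b : Vec N) :
    ‖pw (p / 2) (∫ x, f x ∂P) - pw (p / 2) b‖ ^ 2
      ≤ 16 * ((1 + 2 / p) * 2 ^ (2 / p)) ^ 2 * ∫ x, ‖pw (p / 2) (f x) - pw (p / 2) b‖ ^ 2 ∂P := by
  have hp0 : 0 < p := by linarith
  set s := 2 / p with hs_def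
  have hs : 1 ≤ s := by rw [hs_def, le_div_iff₀ hp0]; linarith
  have hs2 : s ≤ 2 := by rw [hs_def, div_le_iff₀ hp0]; linarith
  set c := (1 + s) * 2 ^ s with hc
  have hc1 : 1 ≤ c := by
    have : (1:ℝ) ≤ 2 ^ s := Real.one_le_rpow (by norm_num) (by linarith)
    nlinarith
  set h : X → ℝ := fun x => ‖pw (p / 2) (f x) - pw (p / 2) b‖ with hh
  have hh0 : ∀ x, 0 ≤ h x := fun x => norm_nonneg _
  have hhm : AEStronglyMeasurable h P :=
    ((aestronglyMeasurable_pw hf _).sub aestronglyMeasurable_const).norm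
  have hh2 : Integrable (fun x => h x ^ 2) P := integrable_pw_half_sub_sq hp0 hf hfp b
  have hh2' : Integrable (fun x => h x ^ (2 : ℝ)) P := by simpa using hh2
  have hhs : Integrable (fun x => h x ^ s) P :=
    integrable_rpow_of_le hhm hh0 (by linarith) hs2 hh2'
  have hh1 : Integrable h P := by
    simpa using integrable_rpow_of_le hhm hh0 zero_le_one one_le_two hh2'
  have hfi : Integrable f P := integrable_of_rpow hp hf hfp
  set E1 := ∫ x, h x ^ s ∂P
  set E2 := ∫ x, h x ∂P
  have hE10 : 0 ≤ E1 := integral_nonneg fun x => Real.rpow_nonneg (hh0 x) _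
  have hE20 : 0 ≤ E2 := integral_nonneg hh0
  set β := ‖b‖ ^ (1 - p / 2) with hβ
  have hβ0 : 0 ≤ β := by positivity
  have hβ' : ‖pw (p / 2) b‖ ^ (s - 1) = β := by
    rw [norm_pw (by positivity), ← Real.rpow_mul (norm_nonneg _), hβ, hs_def]
    congr 1; field_simp
  have hpt : ∀ x, ‖f x - b‖ ≤ c * (h x ^ s + β * h x) := fun x => by
    have := norm_pw_sub_pw_le_add hs (pw (p / 2) (f x)) (pw (p / 2) b)
    rwa [pw_pw (by positivity), pw_pw (by positivity),
      show p / 2 * s = 1 by rw [hs_def]; field_simp, pw_one, pw_one, hβ'] at this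
  clear_value c
  set a := ∫ x, f x ∂P with ha
  have hab : ‖a - b‖ ≤ c * (E1 + β * E2) := by
    have e : a - b = ∫ x, (f x - b) ∂P := by
      rw [integral_sub hfi (integrable_const b)]; simp [ha]
    have e2 : c * (E1 + β * E2) = ∫ x, c * (h x ^ s + β * h x) ∂P := by
      rw [integral_const_mul, integral_add hhs (hh1.const_mul β), integral_const_mul]
    rw [e, e2]
    exact norm_integral_le_of_norm_le ((hhs.add (hh1.const_mul β)).const_mul c)
      (Eventually.of_forall hpt)
  have hI0 : 0 ≤ ∫ x, h x ^ 2 ∂P := integral_nonneg fun x => sq_nonneg _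
  rcases le_or_gt (β * E2) E1 with hcase | hcase
  · have h1 : ‖a - b‖ ≤ 2 * c * E1 := by nlinarith
    have h2 : E1 ^ p ≤ ∫ x, h x ^ 2 ∂P := by
      have h3 := rpow_integral_le (P := P) (f := fun x => h x ^ s)
        (fun x => Real.rpow_nonneg (hh0 x) _) hp hhs (by
          have : ∀ x, (h x ^ s) ^ p = h x ^ 2 := fun x => by
            rw [← Real.rpow_mul (hh0 x), show s * p = (2 : ℕ) by
              rw [hs_def]; push_cast; field_simp, Real.rpow_natCast]
          simpa only [this] using hh2)
      refine h3.trans (le_of_eq (integral_congr_ae (Eventually.of_forall fun x => ?_)))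
      simp only
      rw [← Real.rpow_mul (hh0 x), show s * p = (2 : ℕ) by
        rw [hs_def]; push_cast; field_simp, Real.rpow_natCast]
    calc _ ≤ 4 * ‖a - b‖ ^ p := norm_pw_half_sub_sq_le hp0 hp2 a b
      _ ≤ 4 * (2 * c * E1) ^ p := by gcongr
      _ = 4 * ((2 * c) ^ p * E1 ^ p) := by rw [Real.mul_rpow (by positivity) hE10]
      _ ≤ 4 * ((2 * c) ^ (2 : ℝ) * ∫ x, h x ^ 2 ∂P) := by
          refine mul_le_mul_of_nonneg_left (mul_le_mul ?_ h2
            (Real.rpow_nonneg hE10 _) (Real.rpow_nonneg (by linarith) _))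
            (by norm_num)
          exact Real.rpow_le_rpow_of_exponent_le (by linarith) hp2
      _ = 16 * c ^ 2 * ∫ x, h x ^ 2 ∂P := by
          rw [Real.rpow_two]; ring
  · have h1 : ‖a - b‖ ≤ 2 * c * (β * E2) := by nlinarith
    have hβpos : 0 < β := by
      rcases eq_or_lt_of_le hβ0 with h0 | h0
      · rw [← h0] at hcase; simp only [zero_mul] at hcase; linarith
      · exact h0
    have hβ2 : ‖b‖ ^ (2 - p) = β ^ 2 := by
      rw [hβ, ← Real.rpow_natCast, ← Real.rpow_mul (norm_nonneg _)]
      congr 1; push_cast; ring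
    have h2 := norm_rpow_mul_norm_pw_half_sub_sq_le hp0 hp2 a b
    rw [hβ2] at h2
    have h3 : E2 ^ 2 ≤ ∫ x, h x ^ 2 ∂P := sq_integral_le hh0 hhm hh2
    have h4 : ‖a - b‖ ^ 2 ≤ (2 * c * (β * E2)) ^ 2 := by gcongr
    have h5 : β ^ 2 * ‖pw (p / 2) a - pw (p / 2) b‖ ^ 2
        ≤ β ^ 2 * (16 * c ^ 2 * ∫ x, h x ^ 2 ∂P) := by
      calc _ ≤ 4 * ‖a - b‖ ^ 2 := h2
        _ ≤ 4 * (2 * c * (β * E2)) ^ 2 := by gcongr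
        _ = β ^ 2 * (16 * c ^ 2 * E2 ^ 2) := by ring
        _ ≤ _ := by gcongr
    exact le_of_mul_le_mul_left h5 (by positivity)

end Means

/-! ### Weighted means of `u^⟨p-1⟩` on one time slice -/

/-- A bounded nonnegative weight of unit mass. -/
structure IsWeight {X : Type} [MeasurableSpace X] (P : Measure X) (C₀ : ℝ) (η : X → ℝ) : Prop where
  meas : Measurable η
  nonneg : ∀ x, 0 ≤ η x
  le : ∀ x, η x ≤ C₀
  integral_eq : ∫ x, η x ∂P = 1

/-- The weighted mean of `f^⟨p-1⟩`. -/
def wmean {X : Type} [MeasurableSpace X] (P : Measure X) (η : X → ℝ) (p : ℝ) (f : X → Vec N) :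
    Vec N :=
  ∫ x, η x • pw (p - 1) (f x) ∂P

/-- The value whose power of exponent `p - 1` is the weighted mean of `f^⟨p-1⟩`. -/
def wval {X : Type} [MeasurableSpace X] (P : Measure X) (η : X → ℝ) (p : ℝ) (f : X → Vec N) :
    Vec N :=
  pw (1 / (p - 1)) (wmean P η p f)

theorem pw_half_wval {X : Type} [MeasurableSpace X] {P : Measure X} {η : X → ℝ} {p : ℝ}
    (hp : 1 < p) (f : X → Vec N) :
    pw (p / 2) (wval P η p f) = pw (p / (2 * (p - 1))) (wmean P η p f) := by
  have h : 0 < p - 1 := by linarith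
  rw [wval, pw_pw (by positivity)]
  congr 1
  field_simp

theorem exists_norm_pw_half_wval_sub_sq_le {p : ℝ} (hp : 1 < p) (hp2 : p ≤ 2) (C₀ : ℝ) :
    ∃ C : ℝ, 1 ≤ C ∧ ∀ {X : Type} [MeasurableSpace X] {P : Measure X} [IsProbabilityMeasure P]
      {η : X → ℝ} (_ : IsWeight P C₀ η) {N : ℕ} {f : X → Vec N} (_ : AEStronglyMeasurable f P)
      (_ : Integrable (fun x => ‖f x‖ ^ p) P) (b : Vec N),
      ‖pw (p / 2) (wval P η p f) - pw (p / 2) b‖ ^ 2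
          ≤ C * ∫ x, ‖pw (p / 2) (f x) - pw (p / 2) b‖ ^ 2 ∂P := by
  have h : 0 < p - 1 := by linarith
  set s := p / (2 * (p - 1)) with hs_def
  have hs : 1 ≤ s := by rw [hs_def, one_le_div (by positivity)]; linarith
  refine ⟨1 + ((1 + s) * 2 ^ s * (C₀ ^ s * 2 ^ s + 2 * C₀)) ^ 2,
    by linarith [sq_nonneg ((1 + s) * 2 ^ s * (C₀ ^ s * 2 ^ s + 2 * C₀))], ?_⟩
  intro X _ P _ η hη N f hf hfp b
  have hV : ∀ w : Vec N, pw s (pw (p - 1) w) = pw (p / 2) w := fun w => by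
    rw [pw_pw h]; congr 1; rw [hs_def]; field_simp
  have hUs : Integrable (fun x => ‖pw (p - 1) (f x)‖ ^ s) P := by
    have hh : Integrable (fun x => ‖f x‖ ^ (p / 2)) P :=
      integrable_rpow_of_le hf.norm (fun x => norm_nonneg _) (by positivity) (by linarith) hfp
    refine hh.congr (Eventually.of_forall fun x => ?_)
    simp only
    rw [norm_pw h, ← Real.rpow_mul (norm_nonneg _)]
    congr 1; rw [hs_def]; field_simp
  have key := norm_pw_weighted_mean_sub_le hs hη.meas.aestronglyMeasurable hη.nonneg hη.le
    hη.integral_eq (aestronglyMeasurable_pw hf (p - 1)) hUs (pw (p - 1) b)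
  simp only [hV] at key
  rw [pw_half_wval hp, ← hs_def]
  have hsq := sq_integral_le (P := P) (f := fun x => ‖pw (p / 2) (f x) - pw (p / 2) b‖)
    (fun x => norm_nonneg _)
    ((aestronglyMeasurable_pw hf _).sub aestronglyMeasurable_const).norm
    (integrable_pw_half_sub_sq (by linarith) hf hfp b)
  have h0 : 0 ≤ ∫ x, ‖pw (p / 2) (f x) - pw (p / 2) b‖ ^ 2 ∂P :=
    integral_nonneg fun x => sq_nonneg _
  calc _ ≤ ((1 + s) * 2 ^ s * (C₀ ^ s * 2 ^ s + 2 * C₀)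
          * ∫ x, ‖pw (p / 2) (f x) - pw (p / 2) b‖ ∂P) ^ 2 := by
        exact pow_le_pow_left₀ (norm_nonneg _) key 2
    _ = ((1 + s) * 2 ^ s * (C₀ ^ s * 2 ^ s + 2 * C₀)) ^ 2
          * (∫ x, ‖pw (p / 2) (f x) - pw (p / 2) b‖ ∂P) ^ 2 := by ring
    _ ≤ ((1 + s) * 2 ^ s * (C₀ ^ s * 2 ^ s + 2 * C₀)) ^ 2
          * ∫ x, ‖pw (p / 2) (f x) - pw (p / 2) b‖ ^ 2 ∂P :=
        mul_le_mul_of_nonneg_left hsq (sq_nonneg _)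
    _ ≤ _ := by rw [add_mul]; linarith

theorem norm_sub_sq_le_two {E : Type*} [SeminormedAddCommGroup E] (a b c : E) :
    ‖a - c‖ ^ 2 ≤ 2 * ‖a - b‖ ^ 2 + 2 * ‖b - c‖ ^ 2 := by
  have := norm_sub_le_norm_sub_add_norm_sub a b c
  nlinarith [norm_nonneg (a - c), sq_nonneg (‖a - b‖ - ‖b - c‖)]

/-- `wval` is a quasi-minimizer of `b ↦ ∫ |f^⟨p/2⟩ - b^⟨p/2⟩|²`. -/
theorem exists_integral_pw_half_sub_wval_le {p : ℝ} (hp : 1 < p) (hp2 : p ≤ 2) (C₀ : ℝ) :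
    ∃ C : ℝ, 1 ≤ C ∧ ∀ {X : Type} [MeasurableSpace X] {P : Measure X} [IsProbabilityMeasure P]
      {η : X → ℝ} (_ : IsWeight P C₀ η) {N : ℕ} {f : X → Vec N} (_ : AEStronglyMeasurable f P)
      (_ : Integrable (fun x => ‖f x‖ ^ p) P) (b : Vec N),
      ∫ x, ‖pw (p / 2) (f x) - pw (p / 2) (wval P η p f)‖ ^ 2 ∂P
          ≤ C * ∫ x, ‖pw (p / 2) (f x) - pw (p / 2) b‖ ^ 2 ∂P := by
  obtain ⟨C, hC, hC'⟩ := exists_norm_pw_half_wval_sub_sq_le hp hp2 C₀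
  refine ⟨2 + 2 * C, by linarith, ?_⟩
  intro X _ P _ η hη N f hf hfp b
  have h1 := hC' hη hf hfp b
  set m := wval P η p f
  have hi := integrable_pw_half_sub_sq (P := P) (by linarith : 0 < p) hf hfp b
  calc ∫ x, ‖pw (p / 2) (f x) - pw (p / 2) m‖ ^ 2 ∂P
      ≤ ∫ x, (2 * ‖pw (p / 2) (f x) - pw (p / 2) b‖ ^ 2
          + 2 * ‖pw (p / 2) m - pw (p / 2) b‖ ^ 2) ∂P := by
        refine integral_mono (integrable_pw_half_sub_sq (by linarith) hf hfp m)
          ((hi.const_mul 2).add (integrable_const _)) fun x => ?_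
        have := norm_sub_sq_le_two (pw (p / 2) (f x)) (pw (p / 2) b) (pw (p / 2) m)
        rwa [norm_sub_rev (pw (p / 2) b)] at this
    _ = 2 * ∫ x, ‖pw (p / 2) (f x) - pw (p / 2) b‖ ^ 2 ∂P
          + 2 * ‖pw (p / 2) m - pw (p / 2) b‖ ^ 2 := by
        rw [integral_add (hi.const_mul 2) (integrable_const _), integral_const_mul]; simp
    _ ≤ _ := by linarith

/-- Bounds for the oscillation of `f^⟨p/2⟩` in terms of an `L²`-bound `y` for `f - b`. -/
theorem exists_integral_pw_half_sub_wval_le_of_sq {p : ℝ} (hp : 1 < p) (hp2 : p ≤ 2) (C₀ : ℝ) :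
    ∃ C : ℝ, 1 ≤ C ∧ ∀ {X : Type} [MeasurableSpace X] {P : Measure X} [IsProbabilityMeasure P]
      {η : X → ℝ} (_ : IsWeight P C₀ η) {N : ℕ} {f : X → Vec N} (_ : AEStronglyMeasurable f P)
      (_ : Integrable (fun x => ‖f x‖ ^ p) P) (b : Vec N)
      (_ : Integrable (fun x => ‖f x - b‖ ^ 2) P) (y : ℝ) (_ : 0 ≤ y)
      (_ : ∫ x, ‖f x - b‖ ^ 2 ∂P ≤ y ^ 2),
      (∫ x, ‖pw (p / 2) (f x) - pw (p / 2) (wval P η p f)‖ ^ 2 ∂P ≤ C * y ^ p) ∧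
      (∀ l : ℝ, 0 < l → 2 * l ≤ y + ‖b‖ →
        l ^ (2 - p) * ∫ x, ‖pw (p / 2) (f x) - pw (p / 2) (wval P η p f)‖ ^ 2 ∂P ≤ C * y ^ 2) ∧
      ‖wmean P η p f‖ ≤ C₀ * (y + ‖b‖) ^ (p - 1) := by
  obtain ⟨C, hC, hC'⟩ := exists_integral_pw_half_sub_wval_le hp hp2 C₀
  refine ⟨4 * C, by linarith, ?_⟩
  intro X _ P _ η hη N f hf hfp b hi y hy hle
  have hp0 : 0 < p := by linarith
  have hp1 : 0 < p - 1 := by linarith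
  have hC₀ : 0 ≤ C₀ := by
    obtain ⟨x⟩ : Nonempty X := P.nonempty_of_neZero
    exact (hη.nonneg x).trans (hη.le x)
  have hi2 : Integrable (fun x => ‖f x - b‖ ^ (2 : ℝ)) P := by simpa using hi
  have hfb : AEStronglyMeasurable (fun x => ‖f x - b‖) P := (hf.sub aestronglyMeasurable_const).norm
  have h1 := hC' hη hf hfp b
  have hVi := integrable_pw_half_sub_sq (P := P) hp0 hf hfp b
  set J := ∫ x, ‖pw (p / 2) (f x) - pw (p / 2) (wval P η p f)‖ ^ 2 ∂P with hJ
  have hJ0 : 0 ≤ J := integral_nonneg fun x => sq_nonneg _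
  clear_value J
  have hmom : ∀ a : ℝ, 0 ≤ a → a ≤ 2 → ∫ x, ‖f x - b‖ ^ a ∂P ≤ y ^ a := by
    intro a ha ha2
    refine (integral_rpow_le_rpow hfb (fun x => norm_nonneg _) ha two_pos ha2 hi2).trans ?_
    have h0 : 0 ≤ ∫ x, ‖f x - b‖ ^ (2:ℝ) ∂P := integral_nonneg fun x => by positivity
    calc _ ≤ (y ^ 2) ^ (a / 2) := by
          refine Real.rpow_le_rpow h0 ?_ (by positivity)
          simpa using hle
      _ = y ^ a := by
          rw [← Real.rpow_natCast, ← Real.rpow_mul hy]; congr 1; push_cast; field_simp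
  have hA : J ≤ 4 * C * y ^ p := by
    calc J ≤ C * ∫ x, ‖pw (p / 2) (f x) - pw (p / 2) b‖ ^ 2 ∂P := h1
      _ ≤ C * ∫ x, 4 * ‖f x - b‖ ^ p ∂P := by
          refine mul_le_mul_of_nonneg_left (integral_mono hVi
            ((integrable_rpow_of_le hfb (fun x => norm_nonneg _) hp0.le hp2 hi2).const_mul 4)
            fun x => norm_pw_half_sub_sq_le hp0 hp2 _ _) (by linarith)
      _ ≤ C * (4 * y ^ p) := by
          rw [integral_const_mul]
          have := hmom p hp0.le hp2
          gcongr
      _ = _ := by ring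
  refine ⟨hA, ?_, ?_⟩
  · intro l hl hly
    rcases le_total l ‖b‖ with hb | hb
    · calc l ^ (2 - p) * J ≤ ‖b‖ ^ (2 - p) * J :=
            mul_le_mul_of_nonneg_right (Real.rpow_le_rpow hl.le hb (by linarith)) hJ0
        _ ≤ ‖b‖ ^ (2 - p) * (C * ∫ x, ‖pw (p / 2) (f x) - pw (p / 2) b‖ ^ 2 ∂P) :=
            mul_le_mul_of_nonneg_left h1 (Real.rpow_nonneg (norm_nonneg _) _)
        _ = C * ∫ x, ‖b‖ ^ (2 - p) * ‖pw (p / 2) (f x) - pw (p / 2) b‖ ^ 2 ∂P := by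
            rw [integral_const_mul]; ring
        _ ≤ C * ∫ x, 4 * ‖f x - b‖ ^ 2 ∂P :=
            mul_le_mul_of_nonneg_left (integral_mono (hVi.const_mul _) (hi.const_mul 4)
              fun x => norm_rpow_mul_norm_pw_half_sub_sq_le hp0 hp2 _ _) (by linarith)
        _ ≤ C * (4 * y ^ 2) := by
            rw [integral_const_mul]
            exact mul_le_mul_of_nonneg_left (by linarith) (by linarith)
        _ = _ := by ring
    · have hyl : l ≤ y := by linarith
      have hy0 : 0 < y := by linarith
      calc l ^ (2 - p) * J ≤ y ^ (2 - p) * (4 * C * y ^ p) :=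
            mul_le_mul (Real.rpow_le_rpow hl.le hyl (by linarith)) hA hJ0
              (Real.rpow_nonneg hy _)
        _ = 4 * C * (y ^ (2 - p) * y ^ p) := by ring
        _ = 4 * C * y ^ 2 := by
            rw [← Real.rpow_add hy0]; simp
  · have hfi : Integrable (fun x => ‖f x‖) P := (integrable_of_rpow hp.le hf hfp).norm
    have hfi1 : Integrable (fun x => ‖f x‖ ^ (1 : ℝ)) P := by simpa using hfi
    have hmean : ∫ x, ‖f x‖ ∂P ≤ y + ‖b‖ := by
      have h2 := hmom 1 zero_le_one one_le_two
      simp only [Real.rpow_one] at h2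
      have hib : Integrable (fun x => ‖f x - b‖) P := by
        simpa using integrable_rpow_of_le hfb (fun x => norm_nonneg _) zero_le_one one_le_two hi2
      calc ∫ x, ‖f x‖ ∂P ≤ ∫ x, (‖f x - b‖ + ‖b‖) ∂P :=
            integral_mono hfi (hib.add (integrable_const _))
              fun x => by simpa using norm_add_le (f x - b) b
        _ = ∫ x, ‖f x - b‖ ∂P + ‖b‖ := by
            rw [integral_add hib (integrable_const _)]; simp
        _ ≤ _ := by linarith
    have h3 := integral_rpow_le_rpow (P := P) hf.norm (fun x => norm_nonneg _) hp1.le one_pos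
      (by linarith : p - 1 ≤ 1) hfi1
    simp only [Real.rpow_one, div_one] at h3
    have hi1 := integrable_rpow_of_le hf.norm (fun x => norm_nonneg _) hp1.le
      (by linarith : p - 1 ≤ 1) hfi1
    calc ‖wmean P η p f‖ ≤ ∫ x, C₀ * ‖f x‖ ^ (p - 1) ∂P := by
          refine norm_integral_le_of_norm_le (hi1.const_mul C₀) (Eventually.of_forall fun x => ?_)
          rw [norm_smul, norm_pw hp1, Real.norm_of_nonneg (hη.nonneg x)]
          exact mul_le_mul_of_nonneg_right (hη.le x) (by positivity)
      _ = C₀ * ∫ x, ‖f x‖ ^ (p - 1) ∂P := integral_const_mul _ _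
      _ ≤ C₀ * (∫ x, ‖f x‖ ∂P) ^ (p - 1) := by gcongr
      _ ≤ C₀ * (y + ‖b‖) ^ (p - 1) := by
          have : 0 ≤ ∫ x, ‖f x‖ ∂P := integral_nonneg fun x => norm_nonneg _
          gcongr

/-- Comparison of two values through the difference of their powers of exponent `p - 1`. -/
theorem norm_pw_half_sub_sq_le_of_pw {p : ℝ} (hp : 1 < p) (hp2 : p ≤ 2) (M M' : Vec N) :
    ‖pw (p / 2) (pw (1 / (p - 1)) M) - pw (p / 2) (pw (1 / (p - 1)) M')‖ ^ 2
      ≤ (1 + p / (2 * (p - 1))) ^ 2 * ‖M - M'‖ ^ 2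
        * (‖pw (1 / (p - 1)) M‖ ^ (2 - p) + ‖pw (1 / (p - 1)) M'‖ ^ (2 - p)) := by
  have h : 0 < p - 1 := by linarith
  set s := p / (2 * (p - 1)) with hs_def
  have hs : 1 ≤ s := by rw [hs_def, one_le_div (by positivity)]; linarith
  have e : ∀ w : Vec N, pw (p / 2) (pw (1 / (p - 1)) w) = pw s w := fun w => by
    rw [pw_pw (by positivity)]; congr 1; rw [hs_def]; field_simp
  have e2 : ∀ w : Vec N, ‖pw (1 / (p - 1)) w‖ ^ (2 - p) = (‖w‖ ^ (s - 1)) ^ 2 := fun w => by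
    rw [norm_pw (by positivity), ← Real.rpow_natCast, ← Real.rpow_mul (norm_nonneg _),
      ← Real.rpow_mul (norm_nonneg _)]
    congr 1; rw [hs_def]; push_cast; field_simp; ring
  rw [e, e, e2, e2]
  have h1 := norm_pw_sub_pw_le hs M M'
  have h2 : (max ‖M‖ ‖M'‖ ^ (s - 1)) ^ 2 ≤ (‖M‖ ^ (s - 1)) ^ 2 + (‖M'‖ ^ (s - 1)) ^ 2 := by
    rcases max_choice ‖M‖ ‖M'‖ with h | h <;> rw [h] <;> nlinarith [sq_nonneg (‖M‖ ^ (s - 1)),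
      sq_nonneg (‖M'‖ ^ (s - 1))]
  calc _ ≤ ((1 + s) * max ‖M‖ ‖M'‖ ^ (s - 1) * ‖M - M'‖) ^ 2 :=
        pow_le_pow_left₀ (norm_nonneg _) h1 2
    _ = (1 + s) ^ 2 * ‖M - M'‖ ^ 2 * (max ‖M‖ ‖M'‖ ^ (s - 1)) ^ 2 := by ring
    _ ≤ _ := mul_le_mul_of_nonneg_left h2 (by positivity)

/-! ### Interpolation in time -/

theorem rpow_mul_rpow_le_add {A Z θ ε : ℝ} (hA : 0 ≤ A) (hZ : 0 ≤ Z) (hθ : 0 < θ) (hθ1 : θ ≤ 1)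
    (hε : 0 < ε) : A ^ (1 - θ) * Z ^ θ ≤ ε * A + ε ^ (-(1 / θ - 1)) * Z := by
  have h := Real.geom_mean_le_arith_mean2_weighted (by linarith : 0 ≤ 1 - θ) hθ.le
    (by positivity : 0 ≤ ε * A) (by positivity : 0 ≤ ε ^ (-(1 / θ - 1)) * Z) (by ring)
  have e : (ε * A) ^ (1 - θ) * (ε ^ (-(1 / θ - 1)) * Z) ^ θ = A ^ (1 - θ) * Z ^ θ := by
    rw [Real.mul_rpow hε.le hA, Real.mul_rpow (by positivity) hZ, ← Real.rpow_mul hε.le]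
    have : -(1 / θ - 1) * θ = -(1 - θ) := by field_simp
    rw [this, Real.rpow_neg hε.le]
    have : 0 < ε ^ (1 - θ) := by positivity
    field_simp
  rw [e] at h
  have h1 : 0 ≤ ε * A := by positivity
  have h2 : 0 ≤ ε ^ (-(1 / θ - 1)) * Z := by positivity
  nlinarith

theorem integral_le_of_le_rpow {Y : Type} [MeasurableSpace Y] {P : Measure Y} {w x : Y → ℝ}
    {A B q r ε : ℝ} (hw : Integrable w P) (hw0 : ∀ t, 0 ≤ w t) (hx0 : ∀ t, 0 ≤ x t)
    (hxq : Integrable (fun t => x t ^ q) P) (hA : 0 ≤ A) (hB : 0 ≤ B) (hq : 0 < q) (hqr : q ≤ r)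
    (hε : 0 < ε) (hwA : ∀ᵐ t ∂P, w t ≤ A) (hwB : ∀ᵐ t ∂P, w t ≤ B * x t ^ r) :
    ∫ t, w t ∂P ≤ ε * A + ε ^ (-(r / q - 1)) * (B * (∫ t, x t ^ q ∂P) ^ (r / q)) := by
  have hr : 0 < r := by linarith
  set θ := q / r with hθ
  have hθ0 : 0 < θ := by positivity
  have hθ1 : θ ≤ 1 := by rw [hθ, div_le_one hr]; exact hqr
  have hI : 0 ≤ ∫ t, x t ^ q ∂P := integral_nonneg fun t => Real.rpow_nonneg (hx0 t) _
  have h1 : ∫ t, w t ∂P ≤ ∫ t, A ^ (1 - θ) * B ^ θ * x t ^ q ∂P := by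
    refine integral_mono_ae hw (hxq.const_mul _) ?_
    filter_upwards [hwA, hwB] with t h1 h2
    have h3 : w t = w t ^ (1 - θ) * w t ^ θ := by
      rcases (hw0 t).eq_or_lt with h | h
      · rw [← h, Real.zero_rpow hθ0.ne', mul_zero]
      · rw [← Real.rpow_add h]; simp
    have h4 : w t ^ θ ≤ B ^ θ * x t ^ q := by
      calc w t ^ θ ≤ (B * x t ^ r) ^ θ := Real.rpow_le_rpow (hw0 t) h2 hθ0.le
        _ = B ^ θ * x t ^ q := by
          rw [Real.mul_rpow hB (Real.rpow_nonneg (hx0 t) _), ← Real.rpow_mul (hx0 t)]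
          congr 2; rw [hθ]; field_simp
    calc w t = w t ^ (1 - θ) * w t ^ θ := h3
      _ ≤ A ^ (1 - θ) * (B ^ θ * x t ^ q) :=
        mul_le_mul (Real.rpow_le_rpow (hw0 t) h1 (by linarith)) h4
          (Real.rpow_nonneg (hw0 t) _) (Real.rpow_nonneg hA _)
      _ = _ := by ring
  rw [integral_const_mul] at h1
  have h5 := rpow_mul_rpow_le_add hA (by positivity : 0 ≤ B * (∫ t, x t ^ q ∂P) ^ (r / q))
    hθ0 hθ1 hε
  have e1 : (B * (∫ t, x t ^ q ∂P) ^ (r / q)) ^ θ = B ^ θ * ∫ t, x t ^ q ∂P := by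
    rw [Real.mul_rpow hB (Real.rpow_nonneg hI _), ← Real.rpow_mul hI]
    have : r / q * θ = 1 := by rw [hθ]; field_simp
    rw [this, Real.rpow_one]
  have e2 : 1 / θ = r / q := by rw [hθ]; field_simp
  rw [e1, e2] at h5
  linarith [mul_assoc (A ^ (1 - θ)) (B ^ θ) (∫ t, x t ^ q ∂P)]

theorem mul_rpow_neg_le {ε a b : ℝ} (hε : 0 < ε) (hε1 : ε ≤ 1) (hab : a ≤ b) {Z : ℝ} (hZ : 0 ≤ Z) :
    ε ^ (-a) * Z ≤ ε ^ (-b) * Z :=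
  mul_le_mul_of_nonneg_right (Real.rpow_le_rpow_of_exponent_ge hε hε1 (by linarith)) hZ

theorem integral_pw_half_sub_sq_le {p : ℝ} (hp : 1 < p) (hp2 : p ≤ 2) {Y : Type}
    [MeasurableSpace Y] {P : Measure Y} [IsProbabilityMeasure P] {M : Y → Vec N}
    (hM : AEStronglyMeasurable M P)
    (hMp : Integrable (fun t => ‖pw (1 / (p - 1)) (M t)‖ ^ p) P) {G R : ℝ}
    (hR : ∫ t, ‖pw (1 / (p - 1)) (M t)‖ ^ p ∂P ≤ R) {M' : Vec N}
    (hM' : ‖pw (1 / (p - 1)) M'‖ ^ p ≤ R) (hG : ∀ᵐ t ∂P, ‖M t - M'‖ ≤ G) :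
    ∫ t, ‖pw (p / 2) (pw (1 / (p - 1)) (M t)) - pw (p / 2) (pw (1 / (p - 1)) M')‖ ^ 2 ∂P
      ≤ 2 * (1 + p / (2 * (p - 1))) ^ 2 * G ^ 2 * R ^ ((2 - p) / p) := by
  have hp0 : 0 < p := by linarith
  have hm : AEStronglyMeasurable (fun t => pw (1 / (p - 1)) (M t)) P := aestronglyMeasurable_pw hM _
  have hi := integrable_pw_half_sub_sq hp0 hm hMp (pw (1 / (p - 1)) M')
  have hi2 : Integrable (fun t => ‖pw (1 / (p - 1)) (M t)‖ ^ (2 - p)) P :=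
    integrable_rpow_of_le hm.norm (fun _ => norm_nonneg _) (by linarith) (by linarith) hMp
  have h1 : ∫ t, ‖pw (1 / (p - 1)) (M t)‖ ^ (2 - p) ∂P ≤ R ^ ((2 - p) / p) :=
    (integral_rpow_le_rpow hm.norm (fun _ => norm_nonneg _) (by linarith) hp0 (by linarith)
      hMp).trans (Real.rpow_le_rpow (integral_nonneg fun _ => Real.rpow_nonneg (norm_nonneg _) _) hR
        (div_nonneg (by linarith) hp0.le))
  have h2 : ‖pw (1 / (p - 1)) M'‖ ^ (2 - p) ≤ R ^ ((2 - p) / p) := by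
    calc _ = (‖pw (1 / (p - 1)) M'‖ ^ p) ^ ((2 - p) / p) := by
          rw [← Real.rpow_mul (norm_nonneg _)]; congr 1; field_simp
      _ ≤ _ := Real.rpow_le_rpow (by positivity) hM' (div_nonneg (by linarith) hp0.le)
  set c := (1 + p / (2 * (p - 1))) ^ 2 with hc
  have hc0 : 0 ≤ c := sq_nonneg _
  calc _ ≤ ∫ t, c * G ^ 2 * (‖pw (1 / (p - 1)) (M t)‖ ^ (2 - p)
          + ‖pw (1 / (p - 1)) M'‖ ^ (2 - p)) ∂P := by
        refine integral_mono_ae hi ((hi2.add (integrable_const _)).const_mul _) ?_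
        filter_upwards [hG] with t ht
        refine (norm_pw_half_sub_sq_le_of_pw hp hp2 (M t) M').trans ?_
        have : ‖M t - M'‖ ^ 2 ≤ G ^ 2 := pow_le_pow_left₀ (norm_nonneg _) ht 2
        refine mul_le_mul_of_nonneg_right (mul_le_mul_of_nonneg_left this hc0)
          (add_nonneg (Real.rpow_nonneg (norm_nonneg _) _) (Real.rpow_nonneg (norm_nonneg _) _))
    _ = c * G ^ 2 * (∫ t, ‖pw (1 / (p - 1)) (M t)‖ ^ (2 - p) ∂P
          + ‖pw (1 / (p - 1)) M'‖ ^ (2 - p)) := by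
        rw [integral_const_mul, integral_add hi2 (integrable_const _)]; simp
    _ ≤ c * G ^ 2 * (R ^ ((2 - p) / p) + R ^ ((2 - p) / p)) :=
        mul_le_mul_of_nonneg_left (add_le_add h1 h2) (mul_nonneg hc0 (sq_nonneg _))
    _ = _ := by ring

theorem exponent_facts {p q : ℝ} (hp : 1 < p) (hp2 : p ≤ 2) (hq : 1 ≤ q) (hqp : q ≤ p) :
    p / q - 1 ≤ (2 - q * (p - 1)) / (q * (p - 1)) ∧ 2 / q - 1 ≤ (2 - q * (p - 1)) / (q * (p - 1))
      ∧ 1 / (2 * (p - 1) / p) - 1 ≤ (2 - q * (p - 1)) / (q * (p - 1)) := by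
  have h : 0 < p - 1 := by linarith
  have hq0 : 0 < q := by linarith
  have e : (2 - q * (p - 1)) / (q * (p - 1)) = 2 / (q * (p - 1)) - 1 := by field_simp
  rw [e]
  have hle : q * (p - 1) ≤ q := by nlinarith
  have h2 : 2 / q ≤ 2 / (q * (p - 1)) := div_le_div_of_nonneg_left (by norm_num) (by positivity) hle
  have h1 : p / q ≤ 2 / q := div_le_div_of_nonneg_right hp2 hq0.le
  refine ⟨by linarith, by linarith, ?_⟩
  have : 1 / (2 * (p - 1) / p) ≤ 2 / (q * (p - 1)) := by
    rw [one_div_div, div_le_div_iff₀ (by positivity) (by positivity)]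
    nlinarith [mul_nonneg (by linarith : 0 ≤ 2 - p) h.le, mul_nonneg (by linarith : 0 ≤ p - q) h.le,
      mul_nonneg (mul_nonneg (by linarith : 0 ≤ p - q) h.le) (by linarith : 0 ≤ p)]
  linarith

set_option maxHeartbeats 1600000 in
/-- The estimate for a family of weighted means `M t` with slice oscillations `J t`. -/
theorem exists_time_estimate {p q K C : ℝ} (hp : 1 < p) (hp2 : p ≤ 2) (hq : 1 ≤ q) (hqp : q ≤ p)
    (hK : 1 ≤ K) (hC : 1 ≤ C) :
    ∃ C' : ℝ, 1 ≤ C' ∧ ∀ {Y : Type} [MeasurableSpace Y] {P : Measure Y} [IsProbabilityMeasure P]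
      {N : ℕ} {M : Y → Vec N} {J x : Y → ℝ} {μ S Λ Z I X ε : ℝ} (_ : AEStronglyMeasurable M P)
      (_ : Integrable (fun t => ‖pw (1 / (p - 1)) (M t)‖ ^ p) P) (_ : Integrable J P)
      (_ : ∀ t, 0 ≤ J t) (_ : ∀ t, 0 ≤ x t) (_ : Integrable (fun t => x t ^ q) P)
      (_ : Integrable (fun t => x t ^ p) P) (_ : 0 < μ) (_ : 0 ≤ S) (_ : 0 < Λ) (_ : 0 ≤ Z)
      (_ : Z ≤ Λ) (_ : 0 ≤ X) (_ : X ^ p ≤ Z) (_ : ∫ t, x t ^ q ∂P = X ^ q)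
      (_ : ∫ t, x t ^ p ∂P ≤ Λ) (_ : 0 < ε) (_ : ε ≤ 1)
      (_ : ∀ᵐ t ∂P, μ ^ 2 * J t ≤ C * S) (_ : ∀ᵐ t ∂P, μ ^ p * J t ≤ C * x t ^ p)
      (_ : ∀ᵐ t ∂P, ∀ l : ℝ, 0 < l → C * l ^ (p - 1) ≤ ‖M t‖ →
        l ^ (2 - p) * (μ ^ 2 * J t) ≤ C * x t ^ (2 : ℝ))
      (_ : ∀ᵐ s ∂P, ∀ᵐ t ∂P, μ * ‖M t - M s‖ ≤ C * Z ^ ((p - 1) / p))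
      (_ : ∫ t, ‖pw (1 / (p - 1)) (M t)‖ ^ p ∂P ≤ C * I) (_ : I ≤ K * Λ)
      (_ : Λ ≤ K * I ∨ μ ^ p ≤ K)
      (_ : ∀ s, I ≤ 4 * ∫ t, J t ∂P + 4 * ∫ t, ‖pw (p / 2) (pw (1 / (p - 1)) (M t))
        - pw (p / 2) (pw (1 / (p - 1)) (M s))‖ ^ 2 ∂P + 2 * ‖pw (1 / (p - 1)) (M s)‖ ^ p),
      ∃ s, μ ^ 2 * (∫ t, J t ∂P + ∫ t, ‖pw (p / 2) (pw (1 / (p - 1)) (M t))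
          - pw (p / 2) (pw (1 / (p - 1)) (M s))‖ ^ 2 ∂P)
        ≤ C' * (ε * (S + Λ) + ε ^ (-((2 - q * (p - 1)) / (q * (p - 1)))) * Z) := by
  have hp0 : 0 < p := by linarith
  have hp1 : 0 < p - 1 := by linarith
  have hq0 : 0 < q := by linarith
  obtain ⟨hβ1, hβ2, hβ3⟩ := exponent_facts hp hp2 hq hqp
  set β := (2 - q * (p - 1)) / (q * (p - 1)) with hβ
  clear_value β
  obtain ⟨cE, hcE⟩ : ∃ c, c = 2 * (1 + p / (2 * (p - 1))) ^ 2 * C ^ 2 * (C * K) := ⟨_, rfl⟩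
  have hcE0 : 0 ≤ cE := by rw [hcE]; positivity
  obtain ⟨Cs, hCs⟩ : ∃ c, c = 8 * K * (C + cE) := ⟨_, rfl⟩
  have hKC : 1 ≤ K * C := by nlinarith
  have hCs1 : 8 * (K * C) ≤ Cs := by rw [hCs]; nlinarith
  have hKCs : 8 * K ≤ Cs := (mul_le_mul_of_nonneg_left
    (le_mul_of_one_le_right (by linarith : 0 ≤ K) hC) (by norm_num)).trans hCs1
  have hCs0 : 0 ≤ Cs := by linarith
  have hCCs : 0 ≤ C * Cs := mul_nonneg (by linarith) hCs0
  obtain ⟨κ, hκ⟩ : ∃ c : ℝ, c = (8 * K * C) ^ (-(1 / (p - 1))) := ⟨_, rfl⟩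
  have hκ0 : 0 < κ := by rw [hκ]; positivity
  have hκp : κ ^ (p - 1) = (8 * K * C)⁻¹ := by
    rw [hκ, ← Real.rpow_mul (by positivity), show -(1 / (p - 1)) * (p - 1) = -1 by field_simp,
      Real.rpow_neg_one]
  have hκ2 : 0 < κ ^ (2 - p) := by positivity
  refine ⟨C + C * Cs + C * (κ ^ (2 - p))⁻¹ + cE, ?_, ?_⟩
  · have : 0 ≤ C * (κ ^ (2 - p))⁻¹ := by positivity
    linarith
  intro Y _ P _ N M J x μ S Λ Z I X ε hM hMp hJ hJ0 hx0 hxq hxp hμ hS hΛ hZ hZΛ hX hXZ hxX hxΛ hε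
    hε1 ha hb hc hd he hIK hor hf
  -- choice of the reference time
  obtain ⟨s, hs, hsm⟩ := exists_notMem_null_le_integral hMp (ae_iff.mp hd)
  simp only [mem_ofPred_eq, not_not] at hs
  refine ⟨s, ?_⟩
  have hR : ∫ t, ‖pw (1 / (p - 1)) (M t)‖ ^ p ∂P ≤ C * K * Λ := by
    linarith [mul_le_mul_of_nonneg_left hIK (by linarith : 0 ≤ C)]
  have hG : ∀ᵐ t ∂P, ‖M t - M s‖ ≤ C * Z ^ ((p - 1) / p) / μ := by
    filter_upwards [hs] with t ht
    rw [le_div_iff₀ hμ]; linarith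
  have hE := integral_pw_half_sub_sq_le hp hp2 hM hMp hR (hsm.trans hR) hG
  have hfs := hf s
  set E := ∫ t, ‖pw (p / 2) (pw (1 / (p - 1)) (M t)) - pw (p / 2) (pw (1 / (p - 1)) (M s))‖ ^ 2 ∂P
  have hE0 : 0 ≤ E := integral_nonneg fun _ => sq_nonneg _
  clear_value E
  obtain ⟨m, hm⟩ : ∃ m, m = ‖pw (1 / (p - 1)) (M s)‖ := ⟨_, rfl⟩
  have hm0 : 0 ≤ m := hm ▸ norm_nonneg _
  have hmM : m ^ (p - 1) = ‖M s‖ := by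
    rw [hm, norm_pw (by positivity), ← Real.rpow_mul (norm_nonneg _),
      show 1 / (p - 1) * (p - 1) = 1 by field_simp, Real.rpow_one]
  rw [← hm] at hfs
  have hZ2 : (Z ^ ((p - 1) / p)) ^ 2 = Z ^ (2 * (p - 1) / p) := by
    rw [← Real.rpow_natCast, ← Real.rpow_mul hZ]; congr 1; push_cast; ring
  have hθe : 1 - 2 * (p - 1) / p = (2 - p) / p := by field_simp; ring
  have hE1 : μ ^ 2 * E ≤ cE * (Λ ^ (1 - 2 * (p - 1) / p) * Z ^ (2 * (p - 1) / p)) := by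
    have h1 : (C * K * Λ) ^ ((2 - p) / p) ≤ C * K * Λ ^ ((2 - p) / p) := by
      rw [Real.mul_rpow (by positivity) hΛ.le]
      refine mul_le_mul_of_nonneg_right ?_ (by positivity)
      have : (2 - p) / p ≤ 1 := by rw [div_le_one hp0]; linarith
      calc (C * K) ^ ((2 - p) / p) ≤ (C * K) ^ (1 : ℝ) :=
            Real.rpow_le_rpow_of_exponent_le (by linarith) this
        _ = _ := Real.rpow_one _
    calc μ ^ 2 * E ≤ μ ^ 2 * (2 * (1 + p / (2 * (p - 1))) ^ 2 * (C * Z ^ ((p - 1) / p) / μ) ^ 2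
          * (C * K * Λ ^ ((2 - p) / p))) :=
          mul_le_mul_of_nonneg_left (hE.trans (mul_le_mul_of_nonneg_left h1 (by positivity)))
            (by positivity)
      _ = _ := by
        rw [hcE, hθe, div_pow, mul_pow, hZ2]; field_simp
  have hθ0 : 0 < 2 * (p - 1) / p := by positivity
  have hθ1 : 2 * (p - 1) / p ≤ 1 := by rw [div_le_one hp0]; linarith
  have hE2 : μ ^ 2 * E ≤ cE * (ε * Λ + ε ^ (-β) * Z) := by
    refine hE1.trans (mul_le_mul_of_nonneg_left ?_ hcE0)
    have := rpow_mul_rpow_le_add hΛ.le hZ hθ0 hθ1 hε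
    have h2 := mul_rpow_neg_le hε hε1 hβ3 hZ
    linarith
  have hεβ : 0 < ε ^ (-β) := by positivity
  have hJμ : ∫ t, μ ^ 2 * J t ∂P = μ ^ 2 * ∫ t, J t ∂P := integral_const_mul _ _
  -- it remains to bound the mean of the slice oscillations
  suffices hfin : μ ^ 2 * ∫ t, J t ∂P ≤ ε * (C * S)
      + ε ^ (-β) * ((C * Cs + C * (κ ^ (2 - p))⁻¹) * Z) by
    have h2 : 0 ≤ C * (κ ^ (2 - p))⁻¹ := by positivity
    have h3 : 0 ≤ ε * S := by positivity
    have h4 : 0 ≤ ε * Λ := by positivity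
    have h5 : 0 ≤ ε ^ (-β) * Z := by positivity
    rw [mul_add]
    linarith [mul_nonneg hCCs h3, mul_nonneg hCCs h4, mul_nonneg h2 h3, mul_nonneg h2 h4,
      mul_nonneg hcE0 h3, mul_nonneg (by linarith : 0 ≤ C) h4, mul_nonneg (by linarith : 0 ≤ C) h5]
  have hCS : 0 ≤ C * S := by positivity
  have hXr : ∀ r : ℝ, (X ^ q) ^ (r / q) = X ^ r := fun r => by
    rw [← Real.rpow_mul hX]; congr 1; field_simp
  rcases le_or_gt μ Cs with hcase | hcase
  · have hw : ∀ᵐ t ∂P, μ ^ 2 * J t ≤ C * Cs * x t ^ p := by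
      filter_upwards [hb] with t ht
      have h1 : μ ^ 2 = μ ^ (2 - p) * μ ^ p := by
        rw [← Real.rpow_add hμ]; simp
      have h2 : μ ^ (2 - p) ≤ Cs := by
        calc μ ^ (2 - p) ≤ Cs ^ (2 - p) := Real.rpow_le_rpow hμ.le hcase (by linarith)
          _ ≤ Cs ^ (1 : ℝ) := Real.rpow_le_rpow_of_exponent_le (by linarith) (by linarith)
          _ = Cs := Real.rpow_one _
      calc μ ^ 2 * J t = μ ^ (2 - p) * (μ ^ p * J t) := by rw [h1]; ring
        _ ≤ Cs * (C * x t ^ p) := mul_le_mul h2 ht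
            (mul_nonneg (by positivity) (hJ0 t)) hCs0
        _ = _ := by ring
    have h1 := integral_le_of_le_rpow (hJ.const_mul (μ ^ 2))
      (fun t => mul_nonneg (sq_nonneg _) (hJ0 t)) hx0 hxq hCS
      hCCs hq0 hqp hε ha hw
    rw [hJμ, hxX, hXr] at h1
    have h2 := mul_rpow_neg_le hε hε1 hβ1 (Z := C * Cs * X ^ p)
      (mul_nonneg hCCs (by positivity))
    have h3 : C * Cs * X ^ p ≤ (C * Cs + C * (κ ^ (2 - p))⁻¹) * Z := by
      have h2 : 0 ≤ C * (κ ^ (2 - p))⁻¹ := by positivity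
      linarith [mul_le_mul_of_nonneg_left hXZ hCCs, mul_nonneg h2 hZ]
    linarith [mul_le_mul_of_nonneg_left h3 hεβ.le]
  · have hμ1 : 1 ≤ μ := by linarith
    have hμp : μ ≤ μ ^ p := by
      simpa using Real.rpow_le_rpow_of_exponent_le hμ1 hp.le
    have hKμ : K < μ := by linarith
    have hΛI : Λ ≤ K * I := hor.resolve_right (by linarith)
    have hJ1 : μ * ∫ t, J t ∂P ≤ C * Λ := by
      have h0 : 0 ≤ ∫ t, J t ∂P := integral_nonneg hJ0
      calc μ * ∫ t, J t ∂P ≤ μ ^ p * ∫ t, J t ∂P := mul_le_mul_of_nonneg_right hμp h0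
        _ = ∫ t, μ ^ p * J t ∂P := (integral_const_mul _ _).symm
        _ ≤ ∫ t, C * x t ^ p ∂P := integral_mono_ae (hJ.const_mul _) (hxp.const_mul _) hb
        _ = C * ∫ t, x t ^ p ∂P := integral_const_mul _ _
        _ ≤ C * Λ := mul_le_mul_of_nonneg_left hxΛ (by linarith)
    have hE3 : μ * E ≤ cE * Λ := by
      have h1 : Λ ^ (1 - 2 * (p - 1) / p) * Z ^ (2 * (p - 1) / p) ≤ Λ := by
        calc _ ≤ Λ ^ (1 - 2 * (p - 1) / p) * Λ ^ (2 * (p - 1) / p) :=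
              mul_le_mul_of_nonneg_left (Real.rpow_le_rpow hZ hZΛ hθ0.le) (by positivity)
          _ = Λ := by rw [← Real.rpow_add hΛ]; simp
      have h2 : μ * E ≤ μ ^ 2 * E := mul_le_mul_of_nonneg_right (le_self_pow₀ hμ1 two_ne_zero) hE0
      linarith [mul_le_mul_of_nonneg_left h1 hcE0]
    have hmΛ : Λ / (4 * K) ≤ m ^ p := by
      rw [div_le_iff₀ (by positivity)]
      have h1 : μ * Λ ≤ K * (4 * (C * Λ) + 4 * (cE * Λ) + 2 * μ * m ^ p) := by
        calc μ * Λ ≤ μ * (K * I) := mul_le_mul_of_nonneg_left hΛI hμ.le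
          _ = K * (μ * I) := by ring
          _ ≤ K * (μ * (4 * ∫ t, J t ∂P + 4 * E + 2 * m ^ p)) :=
            mul_le_mul_of_nonneg_left (mul_le_mul_of_nonneg_left hfs hμ.le) (by linarith)
          _ ≤ _ := mul_le_mul_of_nonneg_left (by linarith) (by linarith)
      have h2 : 2 * (K * (4 * (C * Λ) + 4 * (cE * Λ))) ≤ μ * Λ := by
        have : Cs * Λ ≤ μ * Λ := mul_le_mul_of_nonneg_right hcase.le hΛ.le
        rw [hCs] at this; linarith
      have h3 : μ * Λ ≤ μ * (m ^ p * (4 * K)) := by linarith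
      exact le_of_mul_le_mul_left h3 hμ
    obtain ⟨Λh, hΛh⟩ : ∃ c, c = Λ ^ ((p - 1) / p) := ⟨_, rfl⟩
    have hΛh0 : 0 < Λh := by rw [hΛh]; positivity
    have hMs : Λh / (4 * K) ≤ ‖M s‖ := by
      have h1 : (4 * K) ^ ((p - 1) / p) ≤ 4 * K := by
        have h2 : (p - 1) / p ≤ 1 := by rw [div_le_one hp0]; linarith
        simpa using Real.rpow_le_rpow_of_exponent_le (by linarith : 1 ≤ 4 * K) h2
      calc Λh / (4 * K) ≤ Λh / (4 * K) ^ ((p - 1) / p) :=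
            div_le_div_of_nonneg_left hΛh0.le (by positivity) h1
        _ = (Λ / (4 * K)) ^ ((p - 1) / p) := by rw [Real.div_rpow hΛ.le (by positivity), hΛh]
        _ ≤ (m ^ p) ^ ((p - 1) / p) := Real.rpow_le_rpow (by positivity) hmΛ (by positivity)
        _ = ‖M s‖ := by rw [← hmM, ← Real.rpow_mul hm0]; congr 1; field_simp
    have hMt : ∀ᵐ t ∂P, Λh / (8 * K) ≤ ‖M t‖ := by
      filter_upwards [hs] with t ht
      have h1 : ‖M s‖ ≤ ‖M t‖ + ‖M t - M s‖ := by
        have := norm_sub_norm_le (M s) (M t)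
        rw [norm_sub_rev] at this; linarith
      have h2 : Z ^ ((p - 1) / p) ≤ Λh := by
        rw [hΛh]; exact Real.rpow_le_rpow hZ hZΛ (by positivity)
      have h3 : ‖M t - M s‖ ≤ Λh / (8 * K) := by
        rw [le_div_iff₀ (by positivity)]
        have h5 : 8 * (K * C) * ‖M t - M s‖ ≤ C * Λh := by
          have := mul_le_mul_of_nonneg_right (hCs1.trans hcase.le) (norm_nonneg (M t - M s))
          have := mul_le_mul_of_nonneg_left h2 (by linarith : 0 ≤ C)
          linarith
        have h6 : C * (‖M t - M s‖ * (8 * K)) ≤ C * Λh := by linarith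
        exact le_of_mul_le_mul_left h6 (by linarith)
      have h4 : Λh / (4 * K) = Λh / (8 * K) + Λh / (8 * K) := by field_simp; norm_num
      linarith
    obtain ⟨l, hl⟩ : ∃ c, c = κ * Λ ^ (1 / p) := ⟨_, rfl⟩
    have hl0 : 0 < l := by rw [hl]; positivity
    have hlp : C * l ^ (p - 1) = Λh / (8 * K) := by
      rw [hl, Real.mul_rpow hκ0.le (by positivity), hκp, ← Real.rpow_mul hΛ.le,
        show 1 / p * (p - 1) = (p - 1) / p by ring, hΛh]
      field_simp
    have hl2 : l ^ (2 - p) = κ ^ (2 - p) * Λ ^ ((2 - p) / p) := by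
      rw [hl, Real.mul_rpow hκ0.le (by positivity), ← Real.rpow_mul hΛ.le,
        show 1 / p * (2 - p) = (2 - p) / p by ring]
    have hl20 : 0 < l ^ (2 - p) := by positivity
    have hw : ∀ᵐ t ∂P, μ ^ 2 * J t ≤ C * (l ^ (2 - p))⁻¹ * x t ^ (2 : ℝ) := by
      filter_upwards [hc, hMt] with t ht htM
      have := ht l hl0 (by rw [hlp]; exact htM)
      rw [mul_comm, ← le_div_iff₀ hl20] at this
      refine this.trans (le_of_eq ?_)
      field_simp
    have h1 := integral_le_of_le_rpow (hJ.const_mul (μ ^ 2))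
      (fun t => mul_nonneg (sq_nonneg _) (hJ0 t)) hx0 hxq hCS
      (by positivity : 0 ≤ C * (l ^ (2 - p))⁻¹) hq0 (by linarith : q ≤ 2) hε ha hw
    rw [hJμ, hxX, hXr] at h1
    have h2 := mul_rpow_neg_le hε hε1 hβ2 (Z := C * (l ^ (2 - p))⁻¹ * X ^ (2 : ℝ)) (by positivity)
    have hX2 : X ^ (2 : ℝ) ≤ Λ ^ ((2 - p) / p) * Z := by
      rcases hX.eq_or_lt with h | h
      · rw [← h, Real.zero_rpow two_ne_zero]; positivity
      · have h3 : X ^ (2 - p) ≤ Λ ^ ((2 - p) / p) := by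
          calc X ^ (2 - p) = (X ^ p) ^ ((2 - p) / p) := by
                rw [← Real.rpow_mul hX]; congr 1; field_simp
            _ ≤ _ := Real.rpow_le_rpow (by positivity) (hXZ.trans hZΛ)
                (div_nonneg (by linarith) hp0.le)
        calc X ^ (2 : ℝ) = X ^ (2 - p) * X ^ p := by rw [← Real.rpow_add h]; simp
          _ ≤ _ := mul_le_mul h3 hXZ (by positivity) (by positivity)
    have h3 : C * (l ^ (2 - p))⁻¹ * X ^ (2 : ℝ) ≤ (C * Cs + C * (κ ^ (2 - p))⁻¹) * Z := by
      calc C * (l ^ (2 - p))⁻¹ * X ^ (2 : ℝ) ≤ C * (l ^ (2 - p))⁻¹ * (Λ ^ ((2 - p) / p) * Z) :=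
            mul_le_mul_of_nonneg_left hX2 (by positivity)
        _ = C * (κ ^ (2 - p))⁻¹ * Z := by
            rw [hl2]; field_simp
        _ ≤ _ := by linarith [mul_nonneg hCCs hZ]
    linarith [mul_le_mul_of_nonneg_left h3 hεβ.le]

/-! ### The estimate in normalized form -/

section normalized

variable {X Y : Type} [MeasurableSpace X] [MeasurableSpace Y] {PX : Measure X} {PT : Measure Y}
  [IsProbabilityMeasure PX] [IsProbabilityMeasure PT]

theorem measurable_wmean {η : X → ℝ} (hη : Measurable η) (p : ℝ) {u : X × Y → Vec N}
    (hu : Measurable u) : Measurable fun t => wmean PX η p fun x => u (x, t) := by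
  have h : Measurable fun z : X × Y => η z.1 • pw (p - 1) (u z) :=
    (hη.comp measurable_fst).smul ((measurable_pw _).comp hu)
  exact (h.stronglyMeasurable.integral_prod_left').measurable

theorem exists_slice_bounds {p C₀ : ℝ} (hp : 1 < p) (hp2 : p ≤ 2) (C₁ : ℝ) (hC₁ : 1 ≤ C₁) :
    ∃ C : ℝ, 1 ≤ C ∧ ∀ {X : Type} [MeasurableSpace X] {P : Measure X} [IsProbabilityMeasure P]
      {η : X → ℝ} (_ : IsWeight P C₀ η) {N : ℕ} {f : X → Vec N} (_ : AEStronglyMeasurable f P)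
      (_ : Integrable (fun x => ‖f x‖ ^ p) P) {μ x : ℝ} (_ : 0 < μ) (_ : 0 ≤ x)
      (_ : ∃ b : Vec N, Integrable (fun x => ‖f x - b‖ ^ 2) P ∧
        μ ^ 2 * ∫ x, ‖f x - b‖ ^ 2 ∂P ≤ C₁ * x ^ 2),
      (μ ^ p * ∫ x, ‖pw (p / 2) (f x) - pw (p / 2) (wval P η p f)‖ ^ 2 ∂P ≤ C * x ^ p) ∧
      (∀ l : ℝ, 0 < l → C * l ^ (p - 1) ≤ ‖wmean P η p f‖ →
        l ^ (2 - p) * (μ ^ 2 * ∫ x, ‖pw (p / 2) (f x) - pw (p / 2) (wval P η p f)‖ ^ 2 ∂P)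
          ≤ C * x ^ (2 : ℝ)) := by
  obtain ⟨C, hC, hC'⟩ := exists_integral_pw_half_sub_wval_le_of_sq hp hp2 C₀
  have hC1 : 0 ≤ C * C₁ := by nlinarith
  refine ⟨C * C₁ + 2 * max C₀ 1, by linarith [le_max_right C₀ 1], ?_⟩
  intro X _ P _ η hη N f hf hfp μ x hμ hx ⟨b, hbi, hb⟩
  have hm0 : 0 ≤ max C₀ 1 := by linarith [le_max_right C₀ 1]
  obtain ⟨y, hy⟩ : ∃ y, y = √C₁ * x / μ := ⟨_, rfl⟩
  have hy0 : 0 ≤ y := by rw [hy]; positivity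
  have hy2 : μ ^ 2 * y ^ 2 = C₁ * x ^ 2 := by
    rw [hy, div_pow, mul_pow, Real.sq_sqrt (by linarith)]; field_simp
  obtain ⟨h1, h2, h3⟩ := hC' hη hf hfp b hbi y hy0 (by
    refine le_of_mul_le_mul_left (hb.trans_eq hy2.symm) (by positivity))
  obtain ⟨J, hJ⟩ : ∃ J, J = ∫ x, ‖pw (p / 2) (f x) - pw (p / 2) (wval P η p f)‖ ^ 2 ∂P := ⟨_, rfl⟩
  rw [← hJ] at h1 h2 ⊢
  have hC₁p : (√C₁) ^ p ≤ C₁ := by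
    calc (√C₁) ^ p ≤ (√C₁) ^ (2 : ℝ) :=
          Real.rpow_le_rpow_of_exponent_le (Real.one_le_sqrt.mpr hC₁) hp2
      _ = C₁ := by simp [Real.sq_sqrt (by linarith : 0 ≤ C₁)]
  have hμp : 0 < μ ^ p := by positivity
  constructor
  · calc μ ^ p * J ≤ μ ^ p * (C * y ^ p) := mul_le_mul_of_nonneg_left h1 hμp.le
      _ = C * (√C₁ ^ p * x ^ p) := by
          rw [hy, Real.div_rpow (by positivity) hμ.le, Real.mul_rpow (by positivity) hx]
          field_simp
      _ ≤ C * (C₁ * x ^ p) := mul_le_mul_of_nonneg_left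
          (mul_le_mul_of_nonneg_right hC₁p (by positivity)) (by linarith)
      _ ≤ _ := by
          have : 0 ≤ 2 * max C₀ 1 * x ^ p := by positivity
          linarith
  · intro l hl hlM
    have hyl : 2 * l ≤ y + ‖b‖ := by
      by_contra! hcon
      have h4 : (y + ‖b‖) ^ (p - 1) < (2 * l) ^ (p - 1) :=
        Real.rpow_lt_rpow (by positivity) hcon (by linarith)
      have h5 : (2 * l) ^ (p - 1) ≤ 2 * l ^ (p - 1) := by
        rw [Real.mul_rpow (by norm_num) hl.le]
        refine mul_le_mul_of_nonneg_right ?_ (by positivity)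
        simpa using Real.rpow_le_rpow_of_exponent_le one_le_two (by linarith : p - 1 ≤ 1)
      have h6 : C₀ * (y + ‖b‖) ^ (p - 1) < max C₀ 1 * (2 * l ^ (p - 1)) := by
        have h7 : (y + ‖b‖) ^ (p - 1) < 2 * l ^ (p - 1) := h4.trans_le h5
        calc _ ≤ max C₀ 1 * (y + ‖b‖) ^ (p - 1) :=
              mul_le_mul_of_nonneg_right (le_max_left _ _) (by positivity)
          _ < _ := mul_lt_mul_of_pos_left h7 (by linarith [le_max_right C₀ 1])
      have h8 : 0 ≤ C * C₁ * l ^ (p - 1) := by positivity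
      linarith
    have h4 := h2 l hl hyl
    have h5 : μ ^ 2 * (l ^ (2 - p) * J) ≤ C * (C₁ * x ^ 2) := by
      rw [← hy2]
      linarith [mul_le_mul_of_nonneg_left h4 (sq_nonneg μ)]
    have h6 : 0 ≤ 2 * max C₀ 1 * x ^ 2 := by positivity
    rw [Real.rpow_two]
    linarith

set_option maxHeartbeats 1600000 in
theorem exists_normalized_estimate {p q K C₀ C₁ C₂ : ℝ} (hp : 1 < p) (hp2 : p ≤ 2) (hq : 1 ≤ q)
    (hqp : q ≤ p) (hK : 1 ≤ K) (hC₁ : 1 ≤ C₁) (hC₂ : 0 ≤ C₂) :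
    ∃ c : ℝ, 1 ≤ c ∧ ∀ {X Y : Type} [MeasurableSpace X] [MeasurableSpace Y] {PX : Measure X}
      {PT : Measure Y} [IsProbabilityMeasure PX] [IsProbabilityMeasure PT] {N : ℕ}
      {u : X × Y → Vec N} {d f : X × Y → ℝ} {η : X → ℝ} {μ S ε : ℝ} (_ : IsWeight PX C₀ η)
      (_ : Measurable u) (_ : Measurable d) (_ : Measurable f) (_ : ∀ z, 0 ≤ d z)
      (_ : ∀ z, 0 ≤ f z) (_ : Integrable (fun z => ‖u z‖ ^ p) (PX.prod PT))
      (_ : Integrable (fun z => d z ^ p) (PX.prod PT))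
      (_ : Integrable (fun z => f z ^ p) (PX.prod PT)) (_ : 0 < μ) (_ : 0 ≤ S) (_ : 0 < ε)
      (_ : ε ≤ 1)
      (_ : ∀ᵐ t ∂PT, ∃ b : Vec N, Integrable (fun x => ‖u (x, t) - b‖ ^ 2) PX ∧
        μ ^ 2 * ∫ x, ‖u (x, t) - b‖ ^ 2 ∂PX ≤ C₁ * ((∫ x, d (x, t) ^ q ∂PX) ^ (1 / q)) ^ 2)
      (_ : ∀ᵐ s ∂PT, ∀ᵐ t ∂PT,
        μ * ‖wmean PX η p (fun x => u (x, t)) - wmean PX η p (fun x => u (x, s))‖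
          ≤ C₂ * ∫ z, (d z ^ (p - 1) + f z ^ (p - 1)) ∂(PX.prod PT))
      (_ : ∫ z, ‖u z‖ ^ p ∂(PX.prod PT) ≤ K * ∫ z, (d z ^ p + f z ^ p) ∂(PX.prod PT))
      (_ : ∫ z, (d z ^ p + f z ^ p) ∂(PX.prod PT) ≤ K * ∫ z, ‖u z‖ ^ p ∂(PX.prod PT) ∨ μ ^ p ≤ K)
      (_ : ∀ᵐ t ∂PT, μ ^ 2 * ∫ x, ‖pw (p / 2) (u (x, t))
        - pw (p / 2) (∫ z, u z ∂(PX.prod PT))‖ ^ 2 ∂PX ≤ S),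
      μ ^ 2 * ∫ z, ‖pw (p / 2) (u z) - pw (p / 2) (∫ z, u z ∂(PX.prod PT))‖ ^ 2 ∂(PX.prod PT)
        ≤ ε * (S + ∫ z, d z ^ p ∂(PX.prod PT))
          + c * ε ^ (-((2 - q * (p - 1)) / (q * (p - 1))))
            * ((∫ z, d z ^ q ∂(PX.prod PT)) ^ (p / q) + ∫ z, f z ^ p ∂(PX.prod PT)) := by
  have hp0 : 0 < p := by linarith
  have hp1 : 0 < p - 1 := by linarith
  have hq0 : 0 < q := by linarith
  obtain ⟨CA, hCA, hA⟩ := exists_integral_pw_half_sub_wval_le hp hp2 C₀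
  obtain ⟨CB, hCB, hB⟩ := exists_slice_bounds (C₀ := C₀) hp hp2 C₁ hC₁
  obtain ⟨CD, hCD, hD⟩ := exists_norm_pw_half_wval_sub_sq_le hp hp2 C₀
  obtain ⟨C, hC⟩ : ∃ C, C = CA + CB + CD + 2 * C₂ := ⟨_, rfl⟩
  have hC1 : 1 ≤ C := by linarith
  obtain ⟨C', hC', hT⟩ := exists_time_estimate hp hp2 hq hqp hK hC1
  obtain ⟨cm, hcm⟩ : ∃ c : ℝ, c = 16 * ((1 + 2 / p) * 2 ^ (2 / p)) ^ 2 := ⟨_, rfl⟩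
  have hcm0 : 0 ≤ cm := by rw [hcm]; positivity
  obtain ⟨c₃, hc₃⟩ : ∃ c, c = (2 + 2 * cm) * 2 * C' := ⟨_, rfl⟩
  have hc₃1 : 1 ≤ c₃ := by rw [hc₃]; nlinarith
  set β := (2 - q * (p - 1)) / (q * (p - 1)) with hβ
  have hβ0 : 0 ≤ β := (exponent_facts hp hp2 hq hqp).1.trans' (by
    rw [sub_nonneg, le_div_iff₀ hq0]; linarith)
  clear_value β
  refine ⟨c₃ * c₃ ^ β + 1, by have := Real.rpow_nonneg (by linarith : 0 ≤ c₃) β; nlinarith, ?_⟩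
  intro X Y _ _ PX PT _ _ N u d f η μ S ε hη hu hd hf hd0 hf0 hup hdp hfp hμ hS hε hε1 h1 h2 h3 h4 h5
  set P := PX.prod PT with hP
  obtain ⟨a, ha⟩ : ∃ a, a = ∫ z, u z ∂P := ⟨_, rfl⟩
  rw [← ha] at h5 ⊢
  -- slices
  have hus : ∀ t, AEStronglyMeasurable (fun x => u (x, t)) PX := fun t =>
    (hu.comp measurable_prodMk_right).aestronglyMeasurable
  have hups : ∀ᵐ t ∂PT, Integrable (fun x => ‖u (x, t)‖ ^ p) PX := hup.prod_left_ae
  have hdps : ∀ᵐ t ∂PT, Integrable (fun x => d (x, t) ^ p) PX := hdp.prod_left_ae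
  have hdq : Integrable (fun z => d z ^ q) P :=
    integrable_rpow_of_le hd.aestronglyMeasurable hd0 hq0.le hqp hdp
  set M : Y → Vec N := fun t => wmean PX η p fun x => u (x, t) with hMdef
  have hMm : Measurable M := measurable_wmean hη.meas p hu
  set m : Y → Vec N := fun t => pw (1 / (p - 1)) (M t) with hmdef
  have hmm : Measurable m := (measurable_pw _).comp hMm
  have hmw : ∀ t, wval PX η p (fun x => u (x, t)) = m t := fun t => rfl
  have hmp_le : ∀ᵐ t ∂PT, ‖m t‖ ^ p ≤ CD * ∫ x, ‖u (x, t)‖ ^ p ∂PX := by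
    filter_upwards [hups] with t ht
    have := hD hη (hus t) ht 0
    simp only [pw_zero, sub_zero, norm_pw_half_sq hp0, hmw] at this
    exact this
  have hmp : Integrable (fun t => ‖m t‖ ^ p) PT := by
    refine (hup.integral_prod_right.const_mul CD).mono'
      (hmm.norm.pow_const p).aestronglyMeasurable ?_
    filter_upwards [hmp_le] with t ht
    rwa [Real.norm_of_nonneg (by positivity)]
  have hVm : Measurable fun z : X × Y => ‖pw (p / 2) (u z) - pw (p / 2) (m z.2)‖ ^ 2 :=
    ((((measurable_pw _).comp hu).sub ((measurable_pw _).comp (hmm.comp measurable_snd))).norm).pow_const 2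
  have hg : Integrable (fun z : X × Y => ‖pw (p / 2) (u z) - pw (p / 2) (m z.2)‖ ^ 2) P := by
    refine ((hup.const_mul 2).add ((hmp.comp_snd PX).const_mul 2)).mono'
      hVm.aestronglyMeasurable (Eventually.of_forall fun z => ?_)
    rw [Real.norm_of_nonneg (sq_nonneg _)]
    exact norm_pw_half_sub_sq_le_add hp0 _ _
  set J : Y → ℝ := fun t => ∫ x, ‖pw (p / 2) (u (x, t)) - pw (p / 2) (m t)‖ ^ 2 ∂PX with hJdef
  have hJi : Integrable J PT := hg.integral_prod_right
  have hJP : ∫ z, ‖pw (p / 2) (u z) - pw (p / 2) (m z.2)‖ ^ 2 ∂P = ∫ t, J t ∂PT :=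
    integral_prod_symm _ hg
  have hJ0 : ∀ t, 0 ≤ J t := fun t => integral_nonneg fun _ => sq_nonneg _
  have hVmi : ∀ b : Vec N, Integrable (fun t => ‖pw (p / 2) (m t) - pw (p / 2) b‖ ^ 2) PT :=
    integrable_pw_half_sub_sq hp0 hmm.aestronglyMeasurable hmp
  have hsplit : ∀ b : Vec N, ∫ z, ‖pw (p / 2) (u z) - pw (p / 2) b‖ ^ 2 ∂P
      ≤ 2 * ∫ t, J t ∂PT + 2 * ∫ t, ‖pw (p / 2) (m t) - pw (p / 2) b‖ ^ 2 ∂PT := by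
    intro b
    have hib : Integrable (fun z : X × Y => ‖pw (p / 2) (m z.2) - pw (p / 2) b‖ ^ 2) P :=
      (hVmi b).comp_snd PX
    have e : ∫ z : X × Y, ‖pw (p / 2) (m z.2) - pw (p / 2) b‖ ^ 2 ∂P
        = ∫ t, ‖pw (p / 2) (m t) - pw (p / 2) b‖ ^ 2 ∂PT := by
      rw [hP, integral_prod_symm _ hib]; simp
    rw [← hJP, ← e, ← integral_const_mul, ← integral_const_mul,
      ← integral_add (hg.const_mul 2) (hib.const_mul 2)]
    exact integral_mono (integrable_pw_half_sub_sq hp0 hu.aestronglyMeasurable hup b)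
      ((hg.const_mul 2).add (hib.const_mul 2)) fun z => norm_sub_sq_le_two _ _ _
  have hmean : ∀ b : Vec N, ∫ z, ‖pw (p / 2) (u z) - pw (p / 2) a‖ ^ 2 ∂P
      ≤ (2 + 2 * cm) * ∫ z, ‖pw (p / 2) (u z) - pw (p / 2) b‖ ^ 2 ∂P := by
    intro b
    have hib := integrable_pw_half_sub_sq (P := P) hp0 hu.aestronglyMeasurable hup b
    have h6 := norm_pw_half_mean_sub_sq_le (P := P) hp.le hp2 hu.aestronglyMeasurable hup b
    rw [← ha, ← hcm] at h6
    calc _ ≤ ∫ z, (2 * ‖pw (p / 2) (u z) - pw (p / 2) b‖ ^ 2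
          + 2 * ‖pw (p / 2) a - pw (p / 2) b‖ ^ 2) ∂P := by
          refine integral_mono (integrable_pw_half_sub_sq hp0 hu.aestronglyMeasurable hup a)
            ((hib.const_mul 2).add (integrable_const _)) fun z => ?_
          have := norm_sub_sq_le_two (pw (p / 2) (u z)) (pw (p / 2) b) (pw (p / 2) a)
          rwa [norm_sub_rev (pw (p / 2) b)] at this
      _ = 2 * ∫ z, ‖pw (p / 2) (u z) - pw (p / 2) b‖ ^ 2 ∂P
          + 2 * ‖pw (p / 2) a - pw (p / 2) b‖ ^ 2 := by
          rw [integral_add (hib.const_mul 2) (integrable_const _), integral_const_mul]; simp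
      _ ≤ _ := by linarith
  -- the scalar quantities
  have hadd : ∫ z, (d z ^ p + f z ^ p) ∂P = ∫ z, d z ^ p ∂P + ∫ z, f z ^ p ∂P :=
    integral_add hdp hfp
  rw [hadd] at h3 h4
  obtain ⟨D, hDd⟩ : ∃ D, D = ∫ z, d z ^ p ∂P := ⟨_, rfl⟩
  obtain ⟨Fp, hFd⟩ : ∃ D, D = ∫ z, f z ^ p ∂P := ⟨_, rfl⟩
  obtain ⟨I, hI⟩ : ∃ D, D = ∫ z, ‖u z‖ ^ p ∂P := ⟨_, rfl⟩
  obtain ⟨Xq, hXq⟩ : ∃ D, D = ∫ z, d z ^ q ∂P := ⟨_, rfl⟩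
  have hD0 : 0 ≤ D := hDd ▸ integral_nonneg fun z => Real.rpow_nonneg (hd0 z) _
  have hF0 : 0 ≤ Fp := hFd ▸ integral_nonneg fun z => Real.rpow_nonneg (hf0 z) _
  have hI0 : 0 ≤ I := hI ▸ integral_nonneg fun z => Real.rpow_nonneg (norm_nonneg _) _
  have hXq0 : 0 ≤ Xq := hXq ▸ integral_nonneg fun z => Real.rpow_nonneg (hd0 z) _
  have hXD : Xq ^ (p / q) ≤ D := by
    have h6 := integral_rpow_le_rpow (P := P) hd.aestronglyMeasurable hd0 hq0.le hp0 hqp hdp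
    rw [← hXq, ← hDd] at h6
    calc Xq ^ (p / q) ≤ (D ^ (q / p)) ^ (p / q) := Real.rpow_le_rpow hXq0 h6 (by positivity)
      _ = D := by rw [← Real.rpow_mul hD0, show q / p * (p / q) = 1 by field_simp, Real.rpow_one]
  have hXp0 : 0 ≤ Xq ^ (p / q) := by positivity
  have hdf : ∫ z, (d z ^ (p - 1) + f z ^ (p - 1)) ∂P ≤ 2 * (Xq ^ (p / q) + Fp) ^ ((p - 1) / p) := by
    have i1 : Integrable (fun z => d z ^ (p - 1)) P :=
      integrable_rpow_of_le hd.aestronglyMeasurable hd0 hp1.le (by linarith) hdp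
    have i2 : Integrable (fun z => f z ^ (p - 1)) P :=
      integrable_rpow_of_le hf.aestronglyMeasurable hf0 hp1.le (by linarith) hfp
    rw [integral_add i1 i2]
    have e1 := integral_rpow_le_rpow (P := P) hd.aestronglyMeasurable hd0 hp1.le hq0
      (by linarith : p - 1 ≤ q) hdq
    have e2 := integral_rpow_le_rpow (P := P) hf.aestronglyMeasurable hf0 hp1.le hp0
      (by linarith : p - 1 ≤ p) hfp
    rw [← hXq] at e1
    rw [← hFd] at e2
    have e3 : Xq ^ ((p - 1) / q) ≤ (Xq ^ (p / q) + Fp) ^ ((p - 1) / p) := by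
      calc Xq ^ ((p - 1) / q) = (Xq ^ (p / q)) ^ ((p - 1) / p) := by
            rw [← Real.rpow_mul hXq0]; congr 1; field_simp
        _ ≤ _ := Real.rpow_le_rpow hXp0 (by linarith) (by positivity)
    have e4 : Fp ^ ((p - 1) / p) ≤ (Xq ^ (p / q) + Fp) ^ ((p - 1) / p) :=
      Real.rpow_le_rpow hF0 (by linarith) (by positivity)
    linarith
  rw [← hDd, ← hFd, ← hI] at h3 h4
  rw [← hDd, ← hFd, ← hXq]
  obtain ⟨Z, hZ⟩ : ∃ Z, Z = Xq ^ (p / q) + Fp := ⟨_, rfl⟩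
  rw [← hZ] at hdf ⊢
  have hZ0 : 0 ≤ Z := by linarith
  have hZΛ : Z ≤ D + Fp := by linarith
  have hcβ : 0 ≤ c₃ ^ β := Real.rpow_nonneg (by linarith) β
  have hεβ : 0 ≤ ε ^ (-β) := by positivity
  have hRHS : 0 ≤ (c₃ * c₃ ^ β + 1) * ε ^ (-β) * Z :=
    mul_nonneg (mul_nonneg (by nlinarith) hεβ) hZ0
  rcases (by linarith : 0 ≤ D + Fp).eq_or_lt with hΛ | hΛ
  · -- degenerate case
    have hI00 : I = 0 := le_antisymm (by rw [← hΛ] at h3; linarith) hI0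
    have h6 := hmean 0
    simp only [pw_zero, sub_zero, norm_pw_half_sq hp0] at h6
    rw [← hI, hI00, mul_zero] at h6
    have : 0 ≤ ε * (S + D) := by positivity
    have := mul_le_mul_of_nonneg_left h6 (sq_nonneg μ)
    linarith
  have hε' : 0 < ε / c₃ := by positivity
  have hε'1 : ε / c₃ ≤ 1 := by rw [div_le_one (by linarith)]; linarith
  set x : Y → ℝ := fun t => (∫ x, d (x, t) ^ q ∂PX) ^ (1 / q) with hx
  have hdqs0 : ∀ t, 0 ≤ ∫ x, d (x, t) ^ q ∂PX :=
    fun t => integral_nonneg fun _ => Real.rpow_nonneg (hd0 _) _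
  have hx0 : ∀ t, 0 ≤ x t := fun t => Real.rpow_nonneg (hdqs0 t) _
  have hxq : ∀ t, x t ^ q = ∫ x, d (x, t) ^ q ∂PX := fun t => by
    rw [hx]; simp only
    rw [← Real.rpow_mul (hdqs0 t), show 1 / q * q = 1 by field_simp, Real.rpow_one]
  have hxqi : Integrable (fun t => x t ^ q) PT := by
    simp only [hxq]; exact hdq.integral_prod_right
  have hxm : AEStronglyMeasurable x PT :=
    (hdq.integral_prod_right.aestronglyMeasurable.aemeasurable.pow_const _).aestronglyMeasurable
  have hxp_le : ∀ᵐ t ∂PT, x t ^ p ≤ ∫ x, d (x, t) ^ p ∂PX := by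
    filter_upwards [hdps] with t ht
    have h6 := integral_rpow_le_rpow (P := PX) (f := fun x => d (x, t))
      (hd.comp measurable_prodMk_right).aestronglyMeasurable (fun x => hd0 _) hq0.le hp0 hqp ht
    have h7 : 0 ≤ ∫ x, d (x, t) ^ p ∂PX := integral_nonneg fun _ => Real.rpow_nonneg (hd0 _) _
    calc x t ^ p = (∫ x, d (x, t) ^ q ∂PX) ^ (p / q) := by
          rw [hx]; simp only
          rw [← Real.rpow_mul (hdqs0 t)]; congr 1; ring
      _ ≤ ((∫ x, d (x, t) ^ p ∂PX) ^ (q / p)) ^ (p / q) :=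
          Real.rpow_le_rpow (hdqs0 t) h6 (by positivity)
      _ = _ := by rw [← Real.rpow_mul h7, show q / p * (p / q) = 1 by field_simp, Real.rpow_one]
  have hxpi : Integrable (fun t => x t ^ p) PT := by
    refine hdp.integral_prod_right.mono' (hxm.aemeasurable.pow_const _).aestronglyMeasurable ?_
    filter_upwards [hxp_le] with t ht
    rwa [Real.norm_of_nonneg (Real.rpow_nonneg (hx0 t) _)]
  obtain ⟨s, hs⟩ := hT (M := M) (J := J) (x := x) (μ := μ) (S := S) (Λ := D + Fp) (Z := Z) (I := I)
    (X := Xq ^ (1 / q)) (ε := ε / c₃) hMm.aestronglyMeasurable hmp hJi hJ0 hx0 hxqi hxpi hμ hS hΛ hZ0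
    hZΛ (by positivity)
    (by rw [← Real.rpow_mul hXq0, show 1 / q * p = p / q by ring]; linarith)
    (by
      rw [← Real.rpow_mul hXq0, show 1 / q * q = 1 by field_simp, Real.rpow_one, hXq]
      simp only [hxq]
      exact (integral_prod_symm _ hdq).symm)
    (by
      refine (integral_mono_ae hxpi hdp.integral_prod_right hxp_le).trans ?_
      rw [← integral_prod_symm _ hdp, ← hP, ← hDd]; linarith)
    hε' hε'1
    (by
      filter_upwards [h5, hups] with t ht htu
      have h6 : J t ≤ _ := hA hη (hus t) htu a
      have h7 : 0 ≤ ∫ x, ‖pw (p / 2) (u (x, t)) - pw (p / 2) a‖ ^ 2 ∂PX :=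
        integral_nonneg fun _ => sq_nonneg _
      calc μ ^ 2 * J t ≤ μ ^ 2 * (CA * _) := mul_le_mul_of_nonneg_left h6 (sq_nonneg _)
        _ = CA * (μ ^ 2 * _) := by ring
        _ ≤ CA * S := mul_le_mul_of_nonneg_left ht (by linarith)
        _ ≤ C * S := mul_le_mul_of_nonneg_right (by linarith) hS)
    (by
      filter_upwards [h1, hups] with t ht htu
      have h6 := (hB hη (hus t) htu hμ (hx0 t) ht).1
      exact h6.trans (mul_le_mul_of_nonneg_right (by linarith) (Real.rpow_nonneg (hx0 t) _)))
    (by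
      filter_upwards [h1, hups] with t ht htu l hl hlM
      have h6 := (hB hη (hus t) htu hμ (hx0 t) ht).2 l hl (le_trans
        (mul_le_mul_of_nonneg_right (by linarith) (by positivity)) hlM)
      exact h6.trans (mul_le_mul_of_nonneg_right (by linarith) (Real.rpow_nonneg (hx0 t) _)))
    (by
      filter_upwards [h2] with s hs
      filter_upwards [hs] with t ht
      refine ht.trans ?_
      have h6 : 0 ≤ Z ^ ((p - 1) / p) := by positivity
      calc _ ≤ C₂ * (2 * Z ^ ((p - 1) / p)) := mul_le_mul_of_nonneg_left hdf hC₂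
        _ = 2 * C₂ * Z ^ ((p - 1) / p) := by ring
        _ ≤ _ := mul_le_mul_of_nonneg_right (by linarith) h6)
    (by
      have h6 := integral_mono_ae hmp (hup.integral_prod_right.const_mul CD) hmp_le
      rw [integral_const_mul, ← integral_prod_symm _ hup, ← hP, ← hI] at h6
      exact h6.trans (mul_le_mul_of_nonneg_right (by linarith) hI0))
    h3 h4
    (by
      intro s
      have h6 := hsplit (m s)
      have h7 : I ≤ 2 * ∫ z, ‖pw (p / 2) (u z) - pw (p / 2) (m s)‖ ^ 2 ∂P + 2 * ‖m s‖ ^ p := by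
        have hib := integrable_pw_half_sub_sq (P := P) hp0 hu.aestronglyMeasurable hup (m s)
        calc I ≤ ∫ z, (2 * ‖pw (p / 2) (u z) - pw (p / 2) (m s)‖ ^ 2 + 2 * ‖m s‖ ^ p) ∂P := by
              rw [hI]
              refine integral_mono hup ((hib.const_mul 2).add (integrable_const _)) fun z => ?_
              have := norm_sub_sq_le_two (pw (p / 2) (u z)) (pw (p / 2) (m s)) 0
              simpa only [sub_zero, norm_pw_half_sq hp0] using this
          _ = _ := by
              rw [integral_add (hib.const_mul 2) (integrable_const _), integral_const_mul]; simp
      change I ≤ 4 * ∫ t, J t ∂PT + 4 * ∫ t, ‖pw (p / 2) (m t) - pw (p / 2) (m s)‖ ^ 2 ∂PT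
        + 2 * ‖m s‖ ^ p
      linarith)
  change μ ^ 2 * (∫ t, J t ∂PT + ∫ t, ‖pw (p / 2) (m t) - pw (p / 2) (m s)‖ ^ 2 ∂PT) ≤ _ at hs
  have h8 : μ ^ 2 * ∫ z, ‖pw (p / 2) (u z) - pw (p / 2) a‖ ^ 2 ∂P
      ≤ c₃ * (ε / c₃ * (S + (D + Fp)) + (ε / c₃) ^ (-β) * Z) := by
    have h9 := (hmean (m s)).trans (mul_le_mul_of_nonneg_left (hsplit (m s)) (by linarith))
    have h10 := mul_le_mul_of_nonneg_left h9 (sq_nonneg μ)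
    have h11 := mul_le_mul_of_nonneg_left hs (by linarith : 0 ≤ (2 + 2 * cm) * 2)
    calc _ ≤ (2 + 2 * cm) * 2 * C' * (ε / c₃ * (S + (D + Fp)) + (ε / c₃) ^ (-β) * Z) := by linarith
      _ = _ := by rw [← hc₃]
  have h9 : (ε / c₃) ^ (-β) = c₃ ^ β * ε ^ (-β) := by
    rw [Real.div_rpow hε.le (by linarith), Real.rpow_neg (by linarith : 0 ≤ c₃), div_inv_eq_mul,
      mul_comm]
  have h10 : c₃ * (ε / c₃ * (S + (D + Fp)) + (ε / c₃) ^ (-β) * Z)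
      = ε * (S + D) + ε * Fp + c₃ * c₃ ^ β * ε ^ (-β) * Z := by
    rw [h9]; field_simp; ring
  have h11 : ε * Fp ≤ ε ^ (-β) * Z := by
    have h12 : 1 ≤ ε ^ (-β) := Real.one_le_rpow_of_pos_of_le_one_of_nonpos hε hε1 (by linarith)
    exact mul_le_mul (by linarith) (by linarith) hF0 hεβ
  linarith

end normalized

/-- A `C¹` function at a point is controlled by its integral along a segment. -/
lemma enorm_le_lintegral_segment {h : Spc n → ℝ} (hh : ContDiff ℝ 1 h) (x b : Spc n) {c : ℝ}
    (hc : 0 < c) :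
    ‖h x‖ₑ ≤ (ENNReal.ofReal c⁻¹ + ‖b‖ₑ) *
      ∫⁻ s in Icc 0 c, (‖h (x + s • b)‖ₑ + ‖fderiv ℝ h (x + s • b)‖ₑ) := by
  have hcont : Continuous fun s : ℝ => x + s • b := by fun_prop
  have hline : ContDiff ℝ 1 fun s : ℝ => h (x + s • b) := hh.comp (by fun_prop)
  have hderiv : ∀ s, ‖deriv (fun s : ℝ => h (x + s • b)) s‖ₑ ≤
      ‖fderiv ℝ h (x + s • b)‖ₑ * ‖b‖ₑ := by
    intro s
    have h1 : HasDerivAt (fun s : ℝ => x + s • b) b s := by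
      simpa using ((hasDerivAt_id s).smul_const b).const_add x
    have h2 := ((hh.differentiable one_ne_zero) (x + s • b)).hasFDerivAt.comp_hasDerivAt s h1
    rw [show deriv (fun s : ℝ => h (x + s • b)) s = _ from h2.deriv]
    exact ContinuousLinearMap.le_opENorm _ _
  have hDc : Continuous fun s : ℝ => fderiv ℝ h (x + s • b) :=
    (hh.continuous_fderiv one_ne_zero).comp hcont
  have hm1 : Measurable fun s : ℝ => ‖h (x + s • b)‖ₑ :=
    (hh.continuous.comp hcont).enorm.measurable
  have hm2 : Measurable fun s : ℝ => ‖fderiv ℝ h (x + s • b)‖ₑ := hDc.enorm.measurable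
  set J := ∫⁻ s in Icc 0 c, ‖fderiv ℝ h (x + s • b)‖ₑ
  have hpt : ∀ s ∈ Icc 0 c, ‖h x‖ₑ ≤ ‖h (x + s • b)‖ₑ + J * ‖b‖ₑ := by
    intro s hs
    have h1 := enorm_sub_le_lintegral_deriv_of_contDiffOn_Icc (hline.contDiffOn (s := Icc 0 s)) hs.1
    have h2 : ∫⁻ r in Icc 0 s, ‖deriv (fun s : ℝ => h (x + s • b)) r‖ₑ ≤ J * ‖b‖ₑ := by
      rw [← lintegral_mul_const _ hm2]
      exact (lintegral_mono fun r => hderiv r).trans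
        (lintegral_mono_set (Icc_subset_Icc_right hs.2))
    have h3 : ‖h x‖ₑ ≤ ‖h (x + s • b)‖ₑ + ‖h (x + s • b) - h x‖ₑ := by
      have := enorm_sub_le (E := ℝ) (a := h (x + s • b)) (b := h (x + s • b) - h x)
      simpa using this
    refine h3.trans (add_le_add le_rfl ?_)
    simpa using h1.trans h2
  have h_int : ENNReal.ofReal c * ‖h x‖ₑ ≤
      (∫⁻ s in Icc 0 c, ‖h (x + s • b)‖ₑ) + ENNReal.ofReal c * (J * ‖b‖ₑ) := by
    have h1 : ∫⁻ _ in Icc 0 c, ‖h x‖ₑ ≤ ∫⁻ s in Icc 0 c, (‖h (x + s • b)‖ₑ + J * ‖b‖ₑ) :=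
      setLIntegral_mono (hm1.add_const _) hpt
    rw [lintegral_add_left hm1] at h1
    simpa [mul_comm] using h1
  have hci : ENNReal.ofReal c⁻¹ * ENNReal.ofReal c = 1 := by
    rw [← ENNReal.ofReal_mul (by positivity), inv_mul_cancel₀ hc.ne', ENNReal.ofReal_one]
  rw [lintegral_add_left hm1]
  calc ‖h x‖ₑ = ENNReal.ofReal c⁻¹ * (ENNReal.ofReal c * ‖h x‖ₑ) := by
        rw [← mul_assoc, hci, one_mul]
    _ ≤ ENNReal.ofReal c⁻¹ * ((∫⁻ s in Icc 0 c, ‖h (x + s • b)‖ₑ)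
          + ENNReal.ofReal c * (J * ‖b‖ₑ)) := by gcongr
    _ = ENNReal.ofReal c⁻¹ * (∫⁻ s in Icc 0 c, ‖h (x + s • b)‖ₑ) + ‖b‖ₑ * J := by
        rw [mul_add, ← mul_assoc, hci, one_mul, mul_comm J]
    _ ≤ _ := by
        rw [add_mul, mul_add, mul_add]
        gcongr
        · exact le_self_add
        · exact le_add_self

/-- Lebesgue measure scales by a positive finite factor under linear isomorphisms. -/
lemma exists_lintegral_comp_linear (T : (Fin n → ℝ) ≃L[ℝ] Spc n) :
    ∃ κ : ℝ≥0∞, κ ≠ 0 ∧ κ ≠ ∞ ∧ ∀ f : Spc n → ℝ≥0∞, Measurable f →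
      ∫⁻ y, f (T y) = κ * ∫⁻ x, f x := by
  have := ContinuousLinearEquiv.isAddHaarMeasure_map T (volume : Measure (Fin n → ℝ))
  refine ⟨(Measure.addHaarScalarFactor (Measure.map T volume) (volume : Measure (Spc n)) : ℝ≥0∞),
    ?_, ENNReal.coe_ne_top, fun f hf => ?_⟩
  · exact_mod_cast (Measure.addHaarScalarFactor_pos_of_isAddHaarMeasure _ _).ne'
  · rw [← lintegral_map hf T.continuous.measurable]
    conv_lhs => rw [Measure.isAddLeftInvariant_eq_smul (Measure.map T volume)
      (volume : Measure (Spc n))]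
    rw [lintegral_smul_measure]
    rfl

/-- Gagliardo–Nirenberg–Sobolev estimate on a set from which `n` independent directions point
into the set `B`. -/
lemma exists_sobolev_of_directions (hn : 2 ≤ n) (T : (Fin n → ℝ) ≃L[ℝ] Spc n) {U B : Set (Spc n)}
    (hU : MeasurableSet U) (hB : MeasurableSet B) {c : ℝ} (hc : 0 < c)
    (hdir : ∀ x ∈ U, ∀ i, ∀ s ∈ Icc 0 c, x + s • T (Pi.single i 1) ∈ B) :
    ∃ C : ℝ≥0∞, C ≠ ∞ ∧ ∀ h : Spc n → ℝ, ContDiff ℝ 1 h →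
      ∫⁻ x in U, ‖h x‖ₑ ^ ((n : ℝ) / (n - 1)) ≤
        C * (∫⁻ x in B, (‖h x‖ₑ + ‖fderiv ℝ h x‖ₑ)) ^ ((n : ℝ) / (n - 1)) := by
  obtain ⟨κ, hκ0, hκ1, hκ⟩ := exists_lintegral_comp_linear T
  have hn1 : (1 : ℝ) < n := by exact_mod_cast hn
  have hr : 0 ≤ (n : ℝ) / (n - 1) := div_nonneg (by linarith) (by linarith)
  have hs : 0 ≤ 1 / ((n : ℝ) - 1) := div_nonneg (by linarith) (by linarith)
  obtain ⟨M, hM⟩ : ∃ M : ℝ≥0∞, M = ENNReal.ofReal c⁻¹ + ∑ i, ‖T (Pi.single i 1)‖ₑ := ⟨_, rfl⟩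
  have hMtop : M ≠ ∞ := by
    rw [hM]
    exact ENNReal.add_ne_top.2 ⟨ENNReal.ofReal_ne_top, ENNReal.sum_ne_top.2 fun _ _ => enorm_ne_top⟩
  refine ⟨κ⁻¹ * (M * κ) ^ ((n : ℝ) / (n - 1)), ?_, fun h hh => ?_⟩
  · exact ENNReal.mul_ne_top (ENNReal.inv_ne_top.2 hκ0)
      (ENNReal.rpow_ne_top_of_nonneg hr (ENNReal.mul_ne_top hMtop hκ1))
  have hmD : Measurable fun x => ‖h x‖ₑ + ‖fderiv ℝ h x‖ₑ :=
    hh.continuous.enorm.measurable.add (hh.continuous_fderiv one_ne_zero).enorm.measurable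
  obtain ⟨f, hf⟩ : ∃ f : Spc n → ℝ≥0∞, f = B.indicator fun x => ‖h x‖ₑ + ‖fderiv ℝ h x‖ₑ :=
    ⟨_, rfl⟩
  have hfm : Measurable f := hf ▸ hmD.indicator hB
  have hTm : Measurable T := T.continuous.measurable
  have hpt : ∀ y, T y ∈ U → ∀ i, ‖h (T y)‖ₑ ≤ M * ∫⁻ τ, f (T (Function.update y i τ)) := by
    intro y hy i
    refine (enorm_le_lintegral_segment hh (T y) (T (Pi.single i 1)) hc).trans ?_
    refine mul_le_mul' ?_ ?_
    · rw [hM]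
      gcongr
      exact Finset.single_le_sum (f := fun i => ‖T (Pi.single i 1)‖ₑ) (fun _ _ => zero_le)
        (Finset.mem_univ i)
    · have hupd : ∀ τ, T (Function.update y i τ) = T y + (τ - y i) • T (Pi.single i 1) := by
        intro τ
        rw [← map_smul, ← map_add]
        congr 1
        ext j
        by_cases hj : j = i
        · subst hj; simp
        · simp [hj]
      calc ∫⁻ s in Icc 0 c, (‖h (T y + s • T (Pi.single i 1))‖ₑ
              + ‖fderiv ℝ h (T y + s • T (Pi.single i 1))‖ₑ)
          = ∫⁻ s in Icc 0 c, f (T y + s • T (Pi.single i 1)) := by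
            refine setLIntegral_congr_fun measurableSet_Icc fun s hs => ?_
            rw [hf, indicator_of_mem (hdir _ hy i s hs)]
        _ ≤ ∫⁻ s, f (T y + s • T (Pi.single i 1)) := setLIntegral_le_lintegral _ _
        _ = ∫⁻ τ, f (T y + (τ - y i) • T (Pi.single i 1)) :=
            (lintegral_sub_right_eq_self (fun s => f (T y + s • T (Pi.single i 1))) (y i)).symm
        _ = _ := by simp_rw [hupd]
  have hgrid := lintegral_prod_lintegral_pow_le (fun _ : Fin n => (volume : Measure ℝ))
    (p := (n : ℝ) / (n - 1)) (f := fun y => f (T y))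
    (by simpa [Real.conjExponent] using Real.HolderConjugate.conjExponent hn1) (hfm.comp hTm)
  simp only [Fintype.card_fin] at hgrid
  have hpow : ∀ y, U.indicator (fun x => ‖h x‖ₑ ^ ((n : ℝ) / (n - 1))) (T y) ≤
      M ^ ((n : ℝ) / (n - 1)) *
        ∏ i, (∫⁻ τ, f (T (Function.update y i τ))) ^ (1 / ((n : ℝ) - 1)) := by
    intro y
    by_cases hy : T y ∈ U
    · rw [indicator_of_mem hy]
      have hcard : ∀ a : ℝ≥0∞, a ^ ((n : ℝ) / (n - 1)) = ∏ _i : Fin n, a ^ (1 / ((n : ℝ) - 1)) := by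
        intro a
        rw [Finset.prod_const, Finset.card_univ, Fintype.card_fin, ← ENNReal.rpow_natCast,
          ← ENNReal.rpow_mul]
        congr 1
        ring
      rw [hcard, hcard M, ← Finset.prod_mul_distrib]
      refine Finset.prod_le_prod' fun i _ => ?_
      rw [← ENNReal.mul_rpow_of_nonneg _ _ hs]
      exact ENNReal.rpow_le_rpow (hpt y hy i) hs
    · rw [indicator_of_notMem hy]; exact zero_le
  have hmU : Measurable (U.indicator fun x => ‖h x‖ₑ ^ ((n : ℝ) / (n - 1))) :=
    (hh.continuous.enorm.measurable.pow_const _).indicator hU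
  have hMr : M ^ ((n : ℝ) / (n - 1)) ≠ ∞ := ENNReal.rpow_ne_top_of_nonneg hr hMtop
  have hmain : κ * ∫⁻ x in U, ‖h x‖ₑ ^ ((n : ℝ) / (n - 1)) ≤ (M * κ) ^ ((n : ℝ) / (n - 1)) *
      (∫⁻ x in B, (‖h x‖ₑ + ‖fderiv ℝ h x‖ₑ)) ^ ((n : ℝ) / (n - 1)) := by
    rw [← lintegral_indicator hU, ← hκ _ hmU]
    refine (lintegral_mono hpow).trans ?_
    rw [lintegral_const_mul' _ _ hMr, ENNReal.mul_rpow_of_nonneg _ _ hr, mul_assoc,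
      ← ENNReal.mul_rpow_of_nonneg _ _ hr, ← lintegral_indicator hB, ← hf, ← hκ _ hfm]
    gcongr
    exact hgrid
  calc ∫⁻ x in U, ‖h x‖ₑ ^ ((n : ℝ) / (n - 1))
      = κ⁻¹ * (κ * ∫⁻ x in U, ‖h x‖ₑ ^ ((n : ℝ) / (n - 1))) := by
        rw [← mul_assoc, ENNReal.inv_mul_cancel hκ0 hκ1, one_mul]
    _ ≤ _ := by rw [mul_assoc]; gcongr

/-- A linear isomorphism whose coordinate directions are `δ e_i - σ e_k`. -/
lemma exists_linear_directions (k : Fin n) {σ δ : ℝ} (hδ : 0 < δ) (hσδ : σ ≠ δ) :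
    ∃ T : (Fin n → ℝ) ≃L[ℝ] Spc n, ∀ i, T (Pi.single i 1) =
      δ • EuclideanSpace.single i 1 - σ • EuclideanSpace.single k 1 := by
  let f : (Fin n → ℝ) →ₗ[ℝ] Spc n :=
    { toFun := fun y => δ • WithLp.toLp 2 y - (∑ i, y i) • (σ • EuclideanSpace.single k 1)
      map_add' := by
        intro x y
        simp only [Pi.add_apply, Finset.sum_add_distrib, WithLp.toLp_add, smul_add, add_smul]
        abel
      map_smul' := by
        intro c x
        simp only [Pi.smul_apply, smul_eq_mul, ← Finset.mul_sum, WithLp.toLp_smul, mul_smul,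
          smul_sub, RingHom.id_apply]
        rw [smul_comm] }
  have hf : Function.Injective f := by
    rw [← LinearMap.ker_eq_bot, LinearMap.ker_eq_bot']
    intro y hy
    have hi : ∀ i, δ * y i = (∑ i, y i) * (σ * if i = k then 1 else 0) := by
      intro i
      have := congrArg (fun v : Spc n => v i) hy
      simp only [f, LinearMap.coe_mk, AddHom.coe_mk, PiLp.sub_apply, PiLp.smul_apply, smul_eq_mul,
        PiLp.zero_apply, PiLp.single_apply] at this
      linarith
    have hsum : δ * ∑ i, y i = (∑ i, y i) * σ := by
      rw [Finset.mul_sum, Finset.sum_congr rfl fun i _ => hi i, ← Finset.mul_sum,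
        ← Finset.mul_sum]
      simp
    have h0 : ∑ i, y i = 0 := by
      have : (∑ i, y i) * (σ - δ) = 0 := by linarith
      exact (mul_eq_zero.1 this).resolve_right (sub_ne_zero.2 hσδ)
    ext i
    have := hi i
    rw [h0, zero_mul] at this
    exact (mul_eq_zero.1 this).resolve_left hδ.ne'
  refine ⟨(f.linearEquivOfInjective hf (by simp)).toContinuousLinearEquiv, fun i => ?_⟩
  change f (Pi.single i 1) = _
  simp [f]

/-- Points of the unit ball with a large component in direction `σ e_k` stay in the ball when moved
slightly in a direction close to `-σ e_k`. -/
lemma add_smul_mem_ball {a σ s : ℝ} (ha : 0 < a) (ha1 : a ≤ 1) (hσ : |σ| = 1) {k i : Fin n}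
    {x : Spc n} (hx : ‖x‖ < 1) (hxk : a * ‖x‖ ≤ σ * x k) (hs : s ∈ Icc 0 (a / 8)) :
    x + s • ((a / 2) • EuclideanSpace.single i (1 : ℝ) - σ • EuclideanSpace.single k (1 : ℝ)) ∈
      Metric.ball (0 : Spc n) 1 := by
  obtain ⟨b, hb⟩ : ∃ b : Spc n, b = (a / 2) • EuclideanSpace.single i (1 : ℝ)
    - σ • EuclideanSpace.single k (1 : ℝ) := ⟨_, rfl⟩
  rw [← hb, mem_ball_zero_iff]
  have hbn : ‖b‖ ≤ 2 := by
    rw [hb]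
    refine (norm_sub_le _ _).trans ?_
    rw [norm_smul, norm_smul, PiLp.norm_single, PiLp.norm_single]
    simp only [norm_one, mul_one, Real.norm_eq_abs, hσ, abs_of_pos (half_pos ha)]
    linarith
  have hin : inner ℝ x b ≤ -(a / 2) * ‖x‖ := by
    rw [hb, inner_sub_right, inner_smul_right, inner_smul_right, EuclideanSpace.inner_single_right,
      EuclideanSpace.inner_single_right]
    have := (le_abs_self (x i)).trans (PiLp.norm_apply_le x i)
    simp only [conj_trivial, one_mul]
    nlinarith
  have hsq : ‖x + s • b‖ ^ 2 < 1 := by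
    rw [norm_add_sq_real, inner_smul_right, norm_smul, Real.norm_of_nonneg hs.1]
    have h0 := norm_nonneg x
    have hs0 := hs.1
    have hs1 := hs.2
    have h1 : (s * ‖b‖) ^ 2 ≤ 4 * s ^ 2 := by
      have : s * ‖b‖ ≤ s * 2 := mul_le_mul_of_nonneg_left hbn hs0
      nlinarith [mul_nonneg hs0 (norm_nonneg b)]
    have h2 : s * inner ℝ x b ≤ s * (-(a / 2) * ‖x‖) := mul_le_mul_of_nonneg_left hin hs0
    rcases le_total (1 / 2) ‖x‖ with h | h
    · have : s * (a / 2) * (1 / 2) ≤ s * (a / 2) * ‖x‖ :=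
        mul_le_mul_of_nonneg_left h (by positivity)
      have h3 : s * s ≤ s * (a / 8) := mul_le_mul_of_nonneg_left hs1 hs0
      nlinarith
    · have : 0 ≤ s * (a / 2) * ‖x‖ := by positivity
      nlinarith
  nlinarith [norm_nonneg (x + s • b)]

/-- Every vector has a coordinate which is comparable to its norm. -/
lemma exists_norm_le_abs_apply (hn : 1 ≤ n) (x : Spc n) :
    ∃ k, (Real.sqrt n)⁻¹ * ‖x‖ ≤ |x k| := by
  have : Nonempty (Fin n) := ⟨⟨0, hn⟩⟩
  obtain ⟨k, hk⟩ := Finite.exists_max fun i => |x i|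
  refine ⟨k, ?_⟩
  have hn0 : (0 : ℝ) < Real.sqrt n := Real.sqrt_pos.2 (by exact_mod_cast hn)
  rw [inv_mul_le_iff₀ hn0, EuclideanSpace.norm_eq]
  refine Real.sqrt_le_iff.2 ⟨by positivity, ?_⟩
  rw [mul_pow, Real.sq_sqrt (by positivity)]
  calc ∑ i, ‖x i‖ ^ 2 ≤ ∑ _i : Fin n, |x k| ^ 2 := by
        gcongr with i
        exact hk i
    _ = _ := by simp

/-- Gagliardo–Nirenberg–Sobolev inequality of exponent one on the unit ball. -/
lemma exists_sobolev_one_ball (hn : 2 ≤ n) :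
    ∃ C : ℝ≥0∞, C ≠ ∞ ∧ ∀ h : Spc n → ℝ, ContDiff ℝ 1 h →
      ∫⁻ x in Metric.ball (0 : Spc n) 1, ‖h x‖ₑ ^ ((n : ℝ) / (n - 1)) ≤
        C * (∫⁻ x in Metric.ball (0 : Spc n) 1, (‖h x‖ₑ + ‖fderiv ℝ h x‖ₑ))
          ^ ((n : ℝ) / (n - 1)) := by
  obtain ⟨a, ha⟩ : ∃ a, a = (Real.sqrt n)⁻¹ := ⟨_, rfl⟩
  have hn1 : (1 : ℝ) ≤ Real.sqrt n := Real.one_le_sqrt.2 (by exact_mod_cast (by lia : 1 ≤ n))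
  have ha0 : 0 < a := by rw [ha]; positivity
  have ha1 : a ≤ 1 := by rw [ha]; exact inv_le_one_of_one_le₀ hn1
  let sg : Bool → ℝ := fun b => if b then 1 else -1
  have hsg : ∀ b, |sg b| = 1 := by intro b; cases b <;> simp [sg]
  let U : Fin n × Bool → Set (Spc n) := fun j =>
    Metric.ball 0 1 ∩ {x | a * ‖x‖ ≤ sg j.2 * x j.1}
  have hUm : ∀ j, MeasurableSet (U j) := fun j => by
    refine measurableSet_ball.inter (measurableSet_le (by fun_prop) ?_)
    exact (measurable_const.mul (by fun_prop))
  have hcov : Metric.ball (0 : Spc n) 1 ⊆ ⋃ j, U j := by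
    intro x hx
    obtain ⟨k, hk⟩ := exists_norm_le_abs_apply (by lia) x
    rw [mem_iUnion]
    rcases abs_choice (x k) with h | h
    · exact ⟨(k, true), hx, by simpa [sg, ha, h] using hk⟩
    · exact ⟨(k, false), hx, by simpa [sg, ha, h] using hk⟩
  have hex : ∀ j, ∃ C : ℝ≥0∞, C ≠ ∞ ∧ ∀ h : Spc n → ℝ, ContDiff ℝ 1 h →
      ∫⁻ x in U j, ‖h x‖ₑ ^ ((n : ℝ) / (n - 1)) ≤
        C * (∫⁻ x in Metric.ball (0 : Spc n) 1, (‖h x‖ₑ + ‖fderiv ℝ h x‖ₑ))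
          ^ ((n : ℝ) / (n - 1)) := by
    intro j
    have hne : sg j.2 ≠ a / 2 := by
      intro h
      have := hsg j.2
      rw [h, abs_of_pos (half_pos ha0)] at this
      linarith
    obtain ⟨T, hT⟩ := exists_linear_directions j.1 (half_pos ha0) hne
    refine exists_sobolev_of_directions hn T (hUm j) measurableSet_ball
      (by positivity : 0 < a / 8) fun x hx i s hs => ?_
    rw [hT]
    exact add_smul_mem_ball ha0 ha1 (hsg _) (by simpa using hx.1) hx.2 hs
  choose C hCtop hC using hex
  refine ⟨∑ j, C j, ENNReal.sum_ne_top.2 fun j _ => hCtop j, fun h hh => ?_⟩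
  calc _ ≤ ∫⁻ x in ⋃ j, U j, ‖h x‖ₑ ^ ((n : ℝ) / (n - 1)) := lintegral_mono_set hcov
    _ ≤ ∑' j, ∫⁻ x in U j, ‖h x‖ₑ ^ ((n : ℝ) / (n - 1)) := lintegral_iUnion_le _ _
    _ = ∑ j, ∫⁻ x in U j, ‖h x‖ₑ ^ ((n : ℝ) / (n - 1)) := tsum_fintype _
    _ ≤ _ := by
      rw [Finset.sum_mul]
      exact Finset.sum_le_sum fun j _ => hC j h hh

/-- Jensen's inequality for the lower Lebesgue integral with respect to a probability measure. -/
lemma lintegral_rpow_le_lintegral_rpow {X : Type*} [MeasurableSpace X] {P : Measure X}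
    [IsProbabilityMeasure P] {q : ℝ} (hq : 1 ≤ q) {f : X → ℝ≥0∞} (hf : AEMeasurable f P) :
    (∫⁻ x, f x ∂P) ^ q ≤ ∫⁻ x, f x ^ q ∂P := by
  have hq0 : 0 < q := by linarith
  have h := ENNReal.lintegral_mul_norm_pow_le (hf.pow_const q) (aemeasurable_const (b := 1))
    (inv_nonneg.2 hq0.le) (sub_nonneg.2 (inv_le_one_of_one_le₀ hq)) (by ring)
  simp only [ENNReal.one_rpow, mul_one, lintegral_const, measure_univ, ← ENNReal.rpow_mul,
    mul_inv_cancel₀ hq0.ne', ENNReal.rpow_one] at h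
  calc (∫⁻ x, f x ∂P) ^ q ≤ ((∫⁻ x, f x ^ q ∂P) ^ q⁻¹) ^ q := ENNReal.rpow_le_rpow h hq0.le
    _ = _ := by rw [← ENNReal.rpow_mul, inv_mul_cancel₀ hq0.ne', ENNReal.rpow_one]

/-- An affine change of variables with factor at least one half. -/
lemma lintegral_comp_add_smul_le {f : Spc n → ℝ≥0∞} (hf : Measurable f) (a : Spc n) {s : ℝ}
    (hs : 1 / 2 ≤ s) : ∫⁻ y, f (a + s • y) ≤ 2 ^ n * ∫⁻ y, f y := by
  have hs0 : 0 < s := by linarith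
  have h1 : ∫⁻ y, f (a + s • y) = ∫⁻ y, f (a + y) ∂(Measure.map (s • ·) volume) :=
    (lintegral_map (hf.comp (measurable_const_add a)) (measurable_const_smul s)).symm
  rw [h1, Measure.map_addHaar_smul _ hs0.ne', lintegral_smul_measure, lintegral_add_left_eq_self]
  rw [smul_eq_mul, finrank_euclideanSpace_fin]
  gcongr
  rw [abs_of_pos (by positivity)]
  have h2 : (s ^ n)⁻¹ ≤ 2 ^ n := by
    rw [← inv_pow]
    have : s⁻¹ ≤ 2 := by rw [inv_le_comm₀ hs0 (by norm_num)]; linarith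
    gcongr
  calc ENNReal.ofReal (s ^ n)⁻¹ ≤ ENNReal.ofReal (2 ^ n) := ENNReal.ofReal_le_ofReal h2
    _ = 2 ^ n := by rw [ENNReal.ofReal_pow (by norm_num)]; simp

/-- A `C¹` map along a segment. -/
lemma enorm_sub_le_lintegral_segment {v : Spc n → Vec N} (hv : ContDiff ℝ 1 v) (x y : Spc n) :
    ‖v x - v y‖ₑ ≤ ‖y - x‖ₑ * ∫⁻ s in Icc (0 : ℝ) 1, ‖fderiv ℝ v ((1 - s) • x + s • y)‖ₑ := by
  have hEq : ∀ s : ℝ, (1 - s) • x + s • y = x + s • (y - x) := fun s => by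
    rw [sub_smul, one_smul, smul_sub]; abel
  simp_rw [hEq]
  have hcont : Continuous fun s : ℝ => x + s • (y - x) := by fun_prop
  have hline : ContDiff ℝ 1 fun s : ℝ => v (x + s • (y - x)) := hv.comp (by fun_prop)
  have hm : Measurable fun s : ℝ => ‖fderiv ℝ v (x + s • (y - x))‖ₑ :=
    ((hv.continuous_fderiv one_ne_zero).comp hcont).enorm.measurable
  have hderiv : ∀ s, ‖deriv (fun s : ℝ => v (x + s • (y - x))) s‖ₑ ≤
      ‖y - x‖ₑ * ‖fderiv ℝ v (x + s • (y - x))‖ₑ := by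
    intro s
    have h1 : HasDerivAt (fun s : ℝ => x + s • (y - x)) (y - x) s := by
      simpa using ((hasDerivAt_id s).smul_const (y - x)).const_add x
    have h2 := ((hv.differentiable one_ne_zero) (x + s • (y - x))).hasFDerivAt.comp_hasDerivAt s h1
    rw [show deriv (fun s : ℝ => v (x + s • (y - x))) s = _ from h2.deriv, mul_comm]
    exact ContinuousLinearMap.le_opENorm _ _
  have h1 := enorm_sub_le_lintegral_deriv_of_contDiffOn_Icc (hline.contDiffOn (s := Icc 0 1))
    zero_le_one
  simp only [one_smul, zero_smul, add_zero, add_sub_cancel] at h1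
  rw [enorm_sub_rev, ← lintegral_const_mul _ hm]
  exact h1.trans (lintegral_mono fun s => hderiv s)

/-- Poincaré inequality on the unit ball in difference form. -/
lemma lintegral_lintegral_enorm_sub_rpow_le {q : ℝ} (hq : 1 ≤ q) {v : Spc n → Vec N}
    (hv : ContDiff ℝ 1 v) :
    ∫⁻ x in Metric.ball (0 : Spc n) 1, ∫⁻ y in Metric.ball (0 : Spc n) 1, ‖v x - v y‖ₑ ^ q ≤
      2 ^ q * (2 ^ n * volume (Metric.ball (0 : Spc n) 1)) *
        ∫⁻ x in Metric.ball (0 : Spc n) 1, ‖fderiv ℝ v x‖ₑ ^ q := by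
  have hq0 : 0 ≤ q := by linarith
  obtain ⟨B, hB⟩ : ∃ B, B = Metric.ball (0 : Spc n) 1 := ⟨_, rfl⟩
  have hBm : MeasurableSet B := hB ▸ measurableSet_ball
  have hBc : Convex ℝ B := hB ▸ convex_ball _ _
  have hgm : Measurable fun x => ‖fderiv ℝ v x‖ₑ ^ q :=
    ((hv.continuous_fderiv one_ne_zero).enorm.measurable).pow_const q
  obtain ⟨f, hf⟩ : ∃ f : Spc n → ℝ≥0∞, f = B.indicator fun x => ‖fderiv ℝ v x‖ₑ ^ q := ⟨_, rfl⟩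
  have hfm : Measurable f := hf ▸ hgm.indicator hBm
  have : IsProbabilityMeasure (volume.restrict (Icc (0 : ℝ) 1)) := ⟨by simp⟩
  rw [← hB]
  have hpt : ∀ x ∈ B, ∀ y ∈ B, ‖v x - v y‖ₑ ^ q ≤
      2 ^ q * ∫⁻ s in Icc (0 : ℝ) 1, f ((1 - s) • x + s • y) := by
    intro x hx y hy
    have hxy : ‖y - x‖ₑ ≤ 2 := by
      rw [hB, mem_ball_zero_iff] at hx hy
      rw [← ofReal_norm]
      exact ENNReal.ofReal_le_of_le_toReal ((norm_sub_le _ _).trans (by simp; linarith))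
    have hms : Measurable fun s : ℝ => ‖fderiv ℝ v ((1 - s) • x + s • y)‖ₑ :=
      ((hv.continuous_fderiv one_ne_zero).comp (by fun_prop)).enorm.measurable
    calc ‖v x - v y‖ₑ ^ q
        ≤ (2 * ∫⁻ s in Icc (0 : ℝ) 1, ‖fderiv ℝ v ((1 - s) • x + s • y)‖ₑ) ^ q := by
          refine ENNReal.rpow_le_rpow ((enorm_sub_le_lintegral_segment hv x y).trans ?_) hq0
          gcongr
      _ ≤ 2 ^ q * ∫⁻ s in Icc (0 : ℝ) 1, ‖fderiv ℝ v ((1 - s) • x + s • y)‖ₑ ^ q := by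
          rw [ENNReal.mul_rpow_of_nonneg _ _ hq0]
          gcongr
          exact lintegral_rpow_le_lintegral_rpow hq hms.aemeasurable
      _ = _ := by
          congr 1
          refine setLIntegral_congr_fun measurableSet_Icc fun s hs => ?_
          rw [hf, indicator_of_mem]
          exact hBc hx hy (by linarith [hs.2]) hs.1 (by ring)
  have hmain : ∀ s ∈ Icc (0 : ℝ) 1, ∫⁻ x in B, ∫⁻ y in B, f ((1 - s) • x + s • y) ≤
      2 ^ n * volume B * ∫⁻ x, f x := by
    have hhalf : ∀ s : ℝ, 1 / 2 ≤ s → ∫⁻ x in B, ∫⁻ y in B, f ((1 - s) • x + s • y) ≤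
        2 ^ n * volume B * ∫⁻ x, f x := by
      intro s hs
      calc ∫⁻ x in B, ∫⁻ y in B, f ((1 - s) • x + s • y)
          ≤ ∫⁻ x in B, 2 ^ n * ∫⁻ y, f y := lintegral_mono fun x =>
            (setLIntegral_le_lintegral _ _).trans (lintegral_comp_add_smul_le hfm _ hs)
        _ = _ := by
            rw [lintegral_const, Measure.restrict_apply_univ]
            ring
    intro s hs
    rcases le_total (1 / 2) s with h | h
    · exact hhalf s h
    · have h1 := hhalf (1 - s) (by linarith)
      have h2 : ∫⁻ x in B, ∫⁻ y in B, f ((1 - s) • x + s • y) =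
          ∫⁻ y in B, ∫⁻ x in B, f ((1 - s) • x + s • y) :=
        lintegral_lintegral_swap (hfm.comp (by fun_prop)).aemeasurable
      rw [h2]
      refine le_trans (le_of_eq ?_) h1
      simp only [sub_sub_cancel]
      simp_rw [add_comm]
  have hmf : Measurable fun w : (Spc n × Spc n) × ℝ => f ((1 - w.2) • w.1.1 + w.2 • w.1.2) :=
    hfm.comp (by fun_prop)
  have hswap : ∫⁻ x in B, ∫⁻ y in B, ∫⁻ s in Icc (0 : ℝ) 1, f ((1 - s) • x + s • y) =
      ∫⁻ s in Icc (0 : ℝ) 1, ∫⁻ x in B, ∫⁻ y in B, f ((1 - s) • x + s • y) := by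
    calc _ = ∫⁻ w : Spc n × Spc n, (∫⁻ s in Icc (0 : ℝ) 1, f ((1 - s) • w.1 + s • w.2))
            ∂((volume.restrict B).prod (volume.restrict B)) :=
          (lintegral_prod _ hmf.lintegral_prod_right'.aemeasurable).symm
      _ = ∫⁻ s in Icc (0 : ℝ) 1, (∫⁻ w : Spc n × Spc n, f ((1 - s) • w.1 + s • w.2)
            ∂((volume.restrict B).prod (volume.restrict B))) :=
          lintegral_lintegral_swap hmf.aemeasurable
      _ = _ := by
          refine lintegral_congr fun s => lintegral_prod _ ?_
          exact (hfm.comp (by fun_prop)).aemeasurable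
  calc ∫⁻ x in B, ∫⁻ y in B, ‖v x - v y‖ₑ ^ q
      ≤ ∫⁻ x in B, ∫⁻ y in B, 2 ^ q * ∫⁻ s in Icc (0 : ℝ) 1, f ((1 - s) • x + s • y) :=
        setLIntegral_mono' hBm fun x hx => setLIntegral_mono' hBm fun y hy => hpt x hx y hy
    _ = 2 ^ q * ∫⁻ s in Icc (0 : ℝ) 1, ∫⁻ x in B, ∫⁻ y in B, f ((1 - s) • x + s • y) := by
        have h2 : (2 : ℝ≥0∞) ^ q ≠ ∞ := ENNReal.rpow_ne_top_of_nonneg hq0 (by simp)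
        simp_rw [lintegral_const_mul' _ _ h2]
        rw [hswap]
    _ ≤ 2 ^ q * ∫⁻ s in Icc (0 : ℝ) 1, 2 ^ n * volume B * ∫⁻ x, f x := by
        gcongr 2 ^ q * ?_
        exact setLIntegral_mono' measurableSet_Icc hmain
    _ = _ := by
        rw [lintegral_const, measure_univ, mul_one, hf, lintegral_indicator hBm]
        ring

/-- Absorption of a sublinear power in the extended nonnegative reals. -/
lemma ENNReal.le_of_le_mul_rpow {W C G : ℝ≥0∞} {a b : ℝ} (ha : a < 1)
    (hW : W ≠ ∞) (h : W ≤ C * W ^ a * G ^ b) :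
    W ≤ C ^ (1 / (1 - a)) * G ^ (b / (1 - a)) := by
  rcases eq_or_ne W 0 with h0 | h0
  · rw [h0]; exact zero_le
  have h1a : 0 < 1 - a := by linarith
  have hWa : W ^ (1 - a) ≤ C * G ^ b := by
    calc W ^ (1 - a) = W * W ^ (-a) := by
          rw [sub_eq_add_neg, ENNReal.rpow_add _ _ h0 hW, ENNReal.rpow_one]
      _ ≤ (C * W ^ a * G ^ b) * W ^ (-a) := by gcongr
      _ = C * G ^ b * (W ^ a * W ^ (-a)) := by ring
      _ = C * G ^ b := by
          rw [← ENNReal.rpow_add _ _ h0 hW, add_neg_cancel, ENNReal.rpow_zero, mul_one]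
  calc W = (W ^ (1 - a)) ^ (1 / (1 - a)) := by
        rw [← ENNReal.rpow_mul, mul_one_div_cancel h1a.ne', ENNReal.rpow_one]
    _ ≤ (C * G ^ b) ^ (1 / (1 - a)) := ENNReal.rpow_le_rpow hWa (by positivity)
    _ = _ := by
        rw [ENNReal.mul_rpow_of_nonneg _ _ (by positivity), ← ENNReal.rpow_mul]
        congr 2
        ring

lemma ENNReal.add_add_rpow_le {q : ℝ} (hq : 0 ≤ q) (a b c : ℝ≥0∞) :
    (a + b + c) ^ q ≤ 3 ^ q * (a ^ q + b ^ q + c ^ q) := by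
  have h : ∀ d : ℝ≥0∞, a ≤ d → b ≤ d → c ≤ d → (a + b + c) ^ q ≤ 3 ^ q * d ^ q := by
    intro d ha hb hc
    rw [← ENNReal.mul_rpow_of_nonneg _ _ hq]
    refine ENNReal.rpow_le_rpow ?_ hq
    calc a + b + c ≤ d + d + d := by gcongr
      _ = 3 * d := by ring
  rcases le_total a b with h1 | h1 <;> rcases le_total b c with h2 | h2
  · exact (h c (h1.trans h2) h2 le_rfl).trans (by gcongr; exact le_add_self)
  · exact (h b h1 le_rfl h2).trans (by gcongr; exact le_add_self.trans le_self_add)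
  · rcases le_total a c with h3 | h3
    · exact (h c h3 h2 le_rfl).trans (by gcongr; exact le_add_self)
    · exact (h a le_rfl h1 h3).trans (by gcongr; exact le_self_add.trans le_self_add)
  · exact (h a le_rfl h1 (h2.trans h1)).trans (by gcongr; exact le_self_add.trans le_self_add)

/-- The regularised power `(δ² + ‖v - b‖²)^β` of a `C¹` map and its derivative. -/
lemma enorm_fderiv_regularized_le {v : Spc n → Vec N} (hv : ContDiff ℝ 1 v) (b : Vec N) {δ β : ℝ}
    (hδ : 0 < δ) (hβ0 : 0 ≤ β) (hβ1 : β ≤ 1) (x : Spc n) :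
    ‖fderiv ℝ (fun x => (δ ^ 2 + ‖v x - b‖ ^ 2) ^ β) x‖ ≤
      2 * Real.sqrt (δ ^ 2 + ‖v x - b‖ ^ 2) ^ (2 * β - 1) * ‖fderiv ℝ v x‖ := by
  have hD := ((hv.differentiable one_ne_zero) x).hasFDerivAt
  have hpos : 0 < δ ^ 2 + ‖v x - b‖ ^ 2 := by positivity
  have h1 := ((hD.sub_const b).norm_sq.const_add (δ ^ 2)).rpow_const (p := β) (Or.inl hpos.ne')
  rw [h1.fderiv, norm_smul]
  obtain ⟨y, hy⟩ : ∃ y, y = δ ^ 2 + ‖v x - b‖ ^ 2 := ⟨_, rfl⟩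
  rw [← hy] at hpos ⊢
  have hsy : 0 < Real.sqrt y := Real.sqrt_pos.2 hpos
  have hle : ‖v x - b‖ ≤ Real.sqrt y := by
    apply Real.le_sqrt_of_sq_le; rw [hy]; nlinarith
  have hpow : y ^ (β - 1) = Real.sqrt y ^ (2 * β - 2) := by
    rw [Real.sqrt_eq_rpow, ← Real.rpow_mul hpos.le]; congr 1; ring
  have hcomp : ‖(2 : ℕ) • (innerSL ℝ (v x - b)).comp (fderiv ℝ v x)‖ ≤
      2 * (Real.sqrt y * ‖fderiv ℝ v x‖) := by
    rw [← Nat.cast_smul_eq_nsmul ℝ, norm_smul]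
    have := ContinuousLinearMap.opNorm_comp_le (innerSL ℝ (v x - b)) (fderiv ℝ v x)
    rw [innerSL_apply_norm] at this
    rw [show ‖((2 : ℕ) : ℝ)‖ = 2 by norm_num]
    exact mul_le_mul_of_nonneg_left (this.trans (mul_le_mul_of_nonneg_right hle (norm_nonneg _)))
      zero_le_two
  rw [Real.norm_of_nonneg (by positivity), hpow]
  have h2 : Real.sqrt y ^ (2 * β - 1) = Real.sqrt y ^ (2 * β - 2) * Real.sqrt y := by
    rw [← Real.rpow_add_one hsy.ne']; congr 1; ring
  rw [h2]
  have hr : 0 ≤ Real.sqrt y ^ (2 * β - 2) := by positivity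
  calc _ ≤ 1 * Real.sqrt y ^ (2 * β - 2) * (2 * (Real.sqrt y * ‖fderiv ℝ v x‖)) := by
        refine mul_le_mul (mul_le_mul_of_nonneg_right hβ1 hr) hcomp (norm_nonneg _) (by positivity)
    _ = _ := by ring

set_option maxHeartbeats 1600000 in
/-- Sobolev inequality on the unit ball for the regularised modulus of a `C¹` map. -/
lemma exists_sobolev_regularized (hn : 2 ≤ n) :
    ∃ C : ℝ≥0∞, C ≠ ∞ ∧ ∀ {N : ℕ} {v : Spc n → Vec N}, ContDiff ℝ 1 v → ∀ (b : Vec N) {δ : ℝ},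
      0 < δ → ∫⁻ x in Metric.ball (0 : Spc n) 1, ‖v x - b‖ₑ ^ 2 ≤
        C * (∫⁻ x in Metric.ball (0 : Spc n) 1, (ENNReal.ofReal δ + ‖v x - b‖ₑ + ‖fderiv ℝ v x‖ₑ)
          ^ (2 * (n : ℝ) / (n + 2))) ^ (2 / (2 * (n : ℝ) / (n + 2))) := by
  obtain ⟨C, hC, hS⟩ := exists_sobolev_one_ball hn
  have hn2 : (2 : ℝ) ≤ n := by exact_mod_cast hn
  have hn1 : (0 : ℝ) < n - 1 := by linarith
  obtain ⟨r, hr⟩ : ∃ r : ℝ, r = (n : ℝ) / (n - 1) := ⟨_, rfl⟩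
  obtain ⟨q, hq⟩ : ∃ q : ℝ, q = 2 * (n : ℝ) / (n + 2) := ⟨_, rfl⟩
  obtain ⟨θ, hθ⟩ : ∃ θ : ℝ, θ = ((n : ℝ) - 2) / (2 * n) := ⟨_, rfl⟩
  have hr0 : 0 < r := by rw [hr]; positivity
  have hq0 : 0 < q := by rw [hq]; positivity
  have hθ0 : 0 ≤ θ := by rw [hθ]; exact div_nonneg (by linarith) (by linarith)
  have hq1 : 1 / q = 1 - θ := by rw [hq, hθ]; field_simp; ring
  have hθr : θ * r < 1 := by
    rw [hθ, hr, div_mul_div_comm, div_lt_one (by positivity)]; nlinarith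
  have hexp : (1 / q * r) / (1 - θ * r) = 2 / q := by
    have h1 : 1 - θ * r = r / 2 := by rw [hθ, hr]; field_simp; ring
    rw [h1]; field_simp
  rw [← hq]
  simp_rw [← hr] at hS
  refine ⟨(C * 2 ^ r) ^ (1 / (1 - θ * r)), ?_, fun {N v} hv b δ hδ => ?_⟩
  · refine ENNReal.rpow_ne_top_of_nonneg (one_div_nonneg.2 (by linarith)) ?_
    exact ENNReal.mul_ne_top hC (ENNReal.rpow_ne_top_of_nonneg hr0.le (by simp))
  obtain ⟨w, hw⟩ : ∃ w : Spc n → ℝ, w = fun x => Real.sqrt (δ ^ 2 + ‖v x - b‖ ^ 2) := ⟨_, rfl⟩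
  have hpos : ∀ x, 0 < δ ^ 2 + ‖v x - b‖ ^ 2 := fun x => by positivity
  have hw0 : ∀ x, 0 < w x := fun x => by rw [hw]; exact Real.sqrt_pos.2 (hpos x)
  have hwsq : ∀ x, w x ^ 2 = δ ^ 2 + ‖v x - b‖ ^ 2 := fun x => by
    rw [hw]; exact Real.sq_sqrt (hpos x).le
  have hwle : ∀ x, w x ≤ δ + ‖v x - b‖ := fun x => by
    rw [hw]
    refine Real.sqrt_le_iff.2 ⟨by positivity, ?_⟩
    nlinarith [norm_nonneg (v x - b)]
  have hlew : ∀ x, ‖v x - b‖ ≤ w x := fun x => by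
    rw [hw]
    refine Real.le_sqrt_of_sq_le ?_
    nlinarith
  have hvc := hv.continuous
  have hwc : Continuous w := by rw [hw]; fun_prop
  have hh : ContDiff ℝ 1 fun x => (δ ^ 2 + ‖v x - b‖ ^ 2) ^ (1 / r) :=
    (contDiff_const.add ((hv.sub contDiff_const).norm_sq ℝ)).rpow_const_of_ne
      fun x => (hpos x).ne'
  have hr1 : 1 / r ≤ 1 := by
    rw [hr, one_div_div, div_le_one (by positivity)]; linarith
  have hbr : 2 * (1 / r) - 1 = 2 * θ := by rw [hr, hθ]; field_simp; ring
  -- the function whose Sobolev norm is estimated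
  have hval : ∀ x, ‖(δ ^ 2 + ‖v x - b‖ ^ 2) ^ (1 / r)‖ₑ ^ r = ‖w x‖ₑ ^ (2 : ℝ) := by
    intro x
    rw [← hwsq, ← Real.rpow_natCast, ← Real.rpow_mul (hw0 x).le,
      Real.enorm_eq_ofReal (by positivity [(hw0 x).le]), Real.enorm_eq_ofReal (hw0 x).le,
      ENNReal.ofReal_rpow_of_nonneg (by positivity [(hw0 x).le]) hr0.le,
      ENNReal.ofReal_rpow_of_nonneg (hw0 x).le (by norm_num), ← Real.rpow_mul (hw0 x).le]
    congr 2
    push_cast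
    field_simp
  have hsum : ∀ x, ‖(δ ^ 2 + ‖v x - b‖ ^ 2) ^ (1 / r)‖ₑ +
      ‖fderiv ℝ (fun x => (δ ^ 2 + ‖v x - b‖ ^ 2) ^ (1 / r)) x‖ₑ ≤
        2 * ((‖w x‖ₑ ^ (2 : ℝ)) ^ θ * ((‖w x‖ₑ + ‖fderiv ℝ v x‖ₑ) ^ q) ^ (1 - θ)) := by
    intro x
    have h1 : (δ ^ 2 + ‖v x - b‖ ^ 2) ^ (1 / r) = w x ^ (2 * θ) * w x := by
      rw [← hwsq, ← Real.rpow_natCast, ← Real.rpow_mul (hw0 x).le, ← Real.rpow_add_one (hw0 x).ne']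
      congr 1
      push_cast
      linarith
    have h2 := enorm_fderiv_regularized_le hv b hδ (one_div_pos.2 hr0).le hr1 x
    rw [hbr] at h2
    have hwx : w x = Real.sqrt (δ ^ 2 + ‖v x - b‖ ^ 2) := by rw [hw]
    rw [← hwx] at h2
    have h3 : ‖fderiv ℝ (fun x => (δ ^ 2 + ‖v x - b‖ ^ 2) ^ (1 / r)) x‖ₑ ≤
        2 * (‖w x‖ₑ ^ (2 * θ) * ‖fderiv ℝ v x‖ₑ) := by
      rw [← ofReal_norm]
      refine (ENNReal.ofReal_le_ofReal h2).trans (le_of_eq ?_)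
      rw [mul_assoc, ENNReal.ofReal_mul (by norm_num), ENNReal.ofReal_mul (by positivity [hw0 x]),
        Real.enorm_eq_ofReal (hw0 x).le, ENNReal.ofReal_rpow_of_nonneg (hw0 x).le (by positivity),
        ofReal_norm, ENNReal.ofReal_ofNat]
    have h4 : ((‖w x‖ₑ + ‖fderiv ℝ v x‖ₑ) ^ q) ^ (1 - θ) = ‖w x‖ₑ + ‖fderiv ℝ v x‖ₑ := by
      rw [← hq1, ← ENNReal.rpow_mul, mul_one_div_cancel hq0.ne', ENNReal.rpow_one]
    rw [h4, ← ENNReal.rpow_mul, h1, enorm_mul, mul_add, mul_add]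
    have h5 : ‖w x ^ (2 * θ)‖ₑ = ‖w x‖ₑ ^ (2 * θ) := by
      rw [Real.enorm_eq_ofReal (hw0 x).le, Real.enorm_eq_ofReal (by positivity [hw0 x]),
        ENNReal.ofReal_rpow_of_nonneg (hw0 x).le (by positivity)]
    rw [h5]
    refine add_le_add ?_ h3
    exact le_mul_of_one_le_left zero_le one_le_two
  have hmw : Measurable fun x => ‖w x‖ₑ := hwc.enorm.measurable
  have hmg : Measurable fun x => ‖fderiv ℝ v x‖ₑ :=
    (hv.continuous_fderiv one_ne_zero).enorm.measurable
  obtain ⟨W, hW⟩ : ∃ W, W = ∫⁻ x in Metric.ball (0 : Spc n) 1, ‖w x‖ₑ ^ (2 : ℝ) := ⟨_, rfl⟩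
  obtain ⟨G, hG⟩ : ∃ G, G = ∫⁻ x in Metric.ball (0 : Spc n) 1,
    (‖w x‖ₑ + ‖fderiv ℝ v x‖ₑ) ^ q := ⟨_, rfl⟩
  have hWtop : W ≠ ∞ := by
    have hi : IntegrableOn (fun x => w x ^ 2) (Metric.ball (0 : Spc n) 1) :=
      ((hwc.pow 2).continuousOn.integrableOn_compact
        (isCompact_closedBall (0 : Spc n) 1)).mono_set Metric.ball_subset_closedBall
    have := hi.2
    rw [hasFiniteIntegral_iff_enorm] at this
    rw [hW]
    refine (lt_of_eq_of_lt ?_ this).ne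
    refine lintegral_congr fun x => ?_
    rw [enorm_pow]; norm_cast
  have hmain : W ≤ (C * 2 ^ r) * W ^ (θ * r) * G ^ (1 / q * r) := by
    have h1 := hS _ hh
    simp_rw [hval] at h1
    rw [← hW] at h1
    refine h1.trans ?_
    have h2 : ∫⁻ x in Metric.ball (0 : Spc n) 1, (‖(δ ^ 2 + ‖v x - b‖ ^ 2) ^ (1 / r)‖ₑ +
        ‖fderiv ℝ (fun x => (δ ^ 2 + ‖v x - b‖ ^ 2) ^ (1 / r)) x‖ₑ) ≤
        2 * (W ^ θ * G ^ (1 - θ)) := by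
      refine (lintegral_mono hsum).trans ?_
      rw [lintegral_const_mul' _ _ (by simp), hW, hG]
      gcongr
      exact ENNReal.lintegral_mul_norm_pow_le (hmw.pow_const _).aemeasurable
        ((hmw.add hmg).pow_const _).aemeasurable hθ0 (hq1 ▸ (one_div_pos.2 hq0).le) (by ring)
    refine (mul_le_mul' le_rfl (ENNReal.rpow_le_rpow h2 hr0.le)).trans (le_of_eq ?_)
    rw [ENNReal.mul_rpow_of_nonneg _ _ hr0.le, ENNReal.mul_rpow_of_nonneg _ _ hr0.le,
      ← ENNReal.rpow_mul, ← ENNReal.rpow_mul, hq1]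
    ring
  have hfin := ENNReal.le_of_le_mul_rpow hθr hWtop hmain
  rw [hexp] at hfin
  calc ∫⁻ x in Metric.ball (0 : Spc n) 1, ‖v x - b‖ₑ ^ 2 ≤ W := by
        rw [hW]
        refine lintegral_mono fun x => ?_
        simp only
        rw [← ENNReal.rpow_ofNat]
        refine ENNReal.rpow_le_rpow ?_ (by norm_num)
        rw [← ofReal_norm, Real.enorm_eq_ofReal (hw0 x).le]
        exact ENNReal.ofReal_le_ofReal (hlew x)
    _ ≤ _ := hfin
    _ ≤ _ := by
        refine mul_le_mul' le_rfl (ENNReal.rpow_le_rpow ?_ (by positivity))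
        rw [hG]
        refine lintegral_mono fun x => ENNReal.rpow_le_rpow ?_ hq0.le
        gcongr
        rw [← ofReal_norm (v x - b), Real.enorm_eq_ofReal (hw0 x).le,
          ← ENNReal.ofReal_add hδ.le (norm_nonneg _)]
        exact ENNReal.ofReal_le_ofReal (hwle x)

/-- On the line, the oscillation of a `C¹` map is controlled by the integral of its derivative. -/
lemma enorm_sub_le_lintegral_ball_one {v : Spc 1 → Vec N} (hv : ContDiff ℝ 1 v) {x y : Spc 1}
    (hx : x ∈ Metric.ball (0 : Spc 1) 1) (hy : y ∈ Metric.ball (0 : Spc 1) 1) :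
    ‖v x - v y‖ₑ ≤ ∫⁻ z in Metric.ball (0 : Spc 1) 1, ‖fderiv ℝ v z‖ₑ := by
  let e : ℝ → Spc 1 := fun τ => WithLp.toLp 2 fun _ => τ
  have he : MeasurePreserving e volume volume :=
    (PiLp.volume_preserving_toLp (Fin 1)).comp
      ((volume_preserving_funUnique (Fin 1) ℝ).symm _)
  have hem : MeasurableEmbedding e :=
    (MeasurableEquiv.toLp 2 (Fin 1 → ℝ)).measurableEmbedding.comp
      (MeasurableEquiv.funUnique (Fin 1) ℝ).symm.measurableEmbedding
  have hnorm : ∀ τ, ‖e τ‖ = |τ| := fun τ => by simp [e, EuclideanSpace.norm_eq, Real.sqrt_sq_eq_abs]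
  have hsurj : ∀ z : Spc 1, e (z 0) = z := fun z => by
    ext i; fin_cases i; rfl
  have hed : ∀ τ, HasDerivAt e (EuclideanSpace.single 0 1) τ := by
    intro τ
    have h1 : e = fun τ : ℝ => τ • EuclideanSpace.single (0 : Fin 1) (1 : ℝ) := by
      funext s; ext i; fin_cases i; simp [e]
    rw [h1]
    simpa using (hasDerivAt_id τ).smul_const (EuclideanSpace.single (0 : Fin 1) (1 : ℝ))
  have hec : ContDiff ℝ 1 e := by
    have h1 : e = fun τ : ℝ => τ • EuclideanSpace.single (0 : Fin 1) (1 : ℝ) := by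
      funext s; ext i; fin_cases i; simp [e]
    rw [h1]; fun_prop
  have hpre : e ⁻¹' Metric.ball 0 1 = Ioo (-1) 1 := by
    ext τ; simp [hnorm, abs_lt]
  have hderiv : ∀ s, ‖deriv (fun s => v (e s)) s‖ₑ ≤ ‖fderiv ℝ v (e s)‖ₑ := by
    intro s
    have h2 := ((hv.differentiable one_ne_zero) (e s)).hasFDerivAt.comp_hasDerivAt s (hed s)
    rw [show deriv (fun s => v (e s)) s = _ from h2.deriv]
    refine (ContinuousLinearMap.le_opENorm _ _).trans (le_of_eq ?_)
    rw [← ofReal_norm (EuclideanSpace.single _ _)]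
    simp
  have key : ∀ a b : ℝ, a ≤ b → a ∈ Ioo (-1 : ℝ) 1 → b ∈ Ioo (-1 : ℝ) 1 →
      ‖v (e b) - v (e a)‖ₑ ≤ ∫⁻ z in Metric.ball (0 : Spc 1) 1, ‖fderiv ℝ v z‖ₑ := by
    intro a b hab ha hb
    refine (enorm_sub_le_lintegral_deriv_of_contDiffOn_Icc
      ((hv.comp hec).contDiffOn (s := Icc a b)) hab).trans ?_
    rw [← he.setLIntegral_comp_preimage_emb hem, hpre]
    refine (lintegral_mono fun s => hderiv s).trans (lintegral_mono_set ?_)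
    exact fun s hs => ⟨ha.1.trans_le hs.1, hs.2.trans_lt hb.2⟩
  have hmem : ∀ z ∈ Metric.ball (0 : Spc 1) 1, z 0 ∈ Ioo (-1 : ℝ) 1 := by
    intro z hz
    rw [← hpre, mem_preimage, hsurj]
    exact hz
  rcases le_total (x 0) (y 0) with h | h
  · have := key _ _ h (hmem x hx) (hmem y hy)
    rwa [hsurj, hsurj, enorm_sub_rev] at this
  · have := key _ _ h (hmem y hy) (hmem x hx)
    rwa [hsurj, hsurj] at this

lemma enorm_sub_sq_le_two {V : Type*} [NormedAddCommGroup V] (a b c : V) :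
    ‖a - b‖ₑ ^ 2 ≤ 2 * ‖a - c‖ₑ ^ 2 + 2 * ‖b - c‖ₑ ^ 2 := by
  have h1 : ‖a - b‖ₑ ≤ ‖a - c‖ₑ + ‖b - c‖ₑ := by
    rw [show a - b = (a - c) - (b - c) by abel]
    exact enorm_sub_le
  have h2 := ENNReal.rpow_add_le_mul_rpow_add_rpow ‖a - c‖ₑ ‖b - c‖ₑ (p := 2) (by norm_num)
  norm_num at h2
  calc ‖a - b‖ₑ ^ 2 ≤ (‖a - c‖ₑ + ‖b - c‖ₑ) ^ 2 := by gcongr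
    _ ≤ _ := by rw [← mul_add]; exact h2

set_option maxHeartbeats 1600000 in
/-- Sobolev–Poincaré inequality on the unit ball in dimension at least two. -/
lemma exists_sobolev_poincare_unit_ball_of_two_le (hn : 2 ≤ n) :
    ∃ C : ℝ≥0∞, C ≠ ∞ ∧ ∀ {N : ℕ} {v : Spc n → Vec N}, ContDiff ℝ 1 v →
      ∫⁻ x in Metric.ball (0 : Spc n) 1, ∫⁻ y in Metric.ball (0 : Spc n) 1, ‖v x - v y‖ₑ ^ 2 ≤
        C * (∫⁻ x in Metric.ball (0 : Spc n) 1, ‖fderiv ℝ v x‖ₑ ^ (2 * (n : ℝ) / (n + 2)))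
          ^ (2 / (2 * (n : ℝ) / (n + 2))) := by
  obtain ⟨C, hC, hS⟩ := exists_sobolev_regularized hn
  have hn2 : (2 : ℝ) ≤ n := by exact_mod_cast hn
  obtain ⟨q, hq⟩ : ∃ q : ℝ, q = 2 * (n : ℝ) / (n + 2) := ⟨_, rfl⟩
  have hq1 : 1 ≤ q := by rw [hq, le_div_iff₀ (by positivity)]; linarith
  have hq0 : 0 < q := by linarith
  rw [← hq]
  simp_rw [← hq] at hS
  obtain ⟨B, hB⟩ : ∃ B, B = Metric.ball (0 : Spc n) 1 := ⟨_, rfl⟩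
  have hB0 : volume B ≠ 0 := by
    rw [hB]; exact (Metric.measure_ball_pos volume _ one_pos).ne'
  have hB1 : volume B ≠ ∞ := by rw [hB]; exact measure_ball_lt_top.ne
  have hBm : MeasurableSet B := hB ▸ measurableSet_ball
  obtain ⟨C₁, hC₁⟩ : ∃ C₁ : ℝ≥0∞, C₁ = 2 ^ q * (2 ^ n * volume B) / volume B := ⟨_, rfl⟩
  have hC₁top : C₁ ≠ ∞ := by
    rw [hC₁]
    refine ENNReal.div_ne_top (ENNReal.mul_ne_top (ENNReal.rpow_ne_top_of_nonneg hq0.le (by simp))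
      (ENNReal.mul_ne_top (by simp) hB1)) hB0
  have h3top : (3 : ℝ≥0∞) ^ q ≠ ∞ := ENNReal.rpow_ne_top_of_nonneg hq0.le (by simp)
  have h2q : 0 ≤ 2 / q := by positivity
  refine ⟨4 * volume B * (C * (3 ^ q * (C₁ + 1)) ^ (2 / q)), ?_, fun {N v} hv => ?_⟩
  · refine ENNReal.mul_ne_top (ENNReal.mul_ne_top (by simp) hB1) (ENNReal.mul_ne_top hC
      (ENNReal.rpow_ne_top_of_nonneg h2q (ENNReal.mul_ne_top h3top ?_)))
    exact ENNReal.add_ne_top.2 ⟨hC₁top, by simp⟩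
  have hP := lintegral_lintegral_enorm_sub_rpow_le hq1 hv
  rw [← hB] at hP ⊢
  rw [← hB] at hS
  have hmg : Measurable fun x => ‖fderiv ℝ v x‖ₑ ^ q :=
    (hv.continuous_fderiv one_ne_zero).enorm.measurable.pow_const q
  obtain ⟨G, hG⟩ : ∃ G, G = ∫⁻ x in B, ‖fderiv ℝ v x‖ₑ ^ q := ⟨_, rfl⟩
  rw [← hG] at hP ⊢
  have hvm : Measurable v := hv.continuous.measurable
  have hm2 : Measurable fun w : Spc n × Spc n => ‖v w.1 - v w.2‖ₑ ^ q :=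
    (((hvm.comp measurable_fst).sub (hvm.comp measurable_snd)).enorm).pow_const q
  obtain ⟨x₀, -, hx₀⟩ := exists_le_setLAverage (s := B) (μ := volume)
    (f := fun x => ∫⁻ y in B, ‖v x - v y‖ₑ ^ q) hB0 hB1
    hm2.lintegral_prod_right'.aemeasurable
  have hb : ∫⁻ y in B, ‖v y - v x₀‖ₑ ^ q ≤ C₁ * G := by
    calc _ = ∫⁻ y in B, ‖v x₀ - v y‖ₑ ^ q := by simp_rw [enorm_sub_rev (v x₀)]
      _ ≤ _ := hx₀
      _ ≤ _ := by
        rw [setLAverage_eq, hC₁, ← ENNReal.mul_div_right_comm]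
        exact ENNReal.div_le_div_right hP _
  have hdelta : ∀ δ : ℝ, 0 < δ → ∫⁻ x in B, ‖v x - v x₀‖ₑ ^ 2 ≤
      C * (3 ^ q * (ENNReal.ofReal δ ^ q * volume B + (C₁ + 1) * G)) ^ (2 / q) := by
    intro δ hδ
    refine (hS hv (v x₀) hδ).trans (mul_le_mul' le_rfl (ENNReal.rpow_le_rpow ?_ h2q))
    refine (lintegral_mono fun x => ENNReal.add_add_rpow_le hq0.le _ _ _).trans ?_
    rw [lintegral_const_mul' _ _ h3top, lintegral_add_right _ hmg,
      lintegral_add_left measurable_const, lintegral_const, Measure.restrict_apply_univ, ← hG,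
      add_mul, one_mul, ← add_assoc]
    gcongr
  have hlim : Tendsto (fun k : ℕ => C * (3 ^ q * (ENNReal.ofReal (1 / ((k : ℝ) + 1)) ^ q * volume B
      + (C₁ + 1) * G)) ^ (2 / q)) atTop (𝓝 (C * (3 ^ q * (0 * volume B
      + (C₁ + 1) * G)) ^ (2 / q))) := by
    refine ENNReal.Tendsto.const_mul ?_ (Or.inr hC)
    refine (ENNReal.continuous_rpow_const.tendsto _).comp ?_
    refine ENNReal.Tendsto.const_mul (Tendsto.add ?_ tendsto_const_nhds) (Or.inr h3top)
    refine ENNReal.Tendsto.mul_const ?_ (Or.inr hB1)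
    have h1 : Tendsto (fun k : ℕ => ENNReal.ofReal (1 / ((k : ℝ) + 1))) atTop (𝓝 0) := by
      simpa using ENNReal.tendsto_ofReal tendsto_one_div_add_atTop_nhds_zero_nat
    have h2 := ((ENNReal.continuous_rpow_const (y := q)).tendsto 0).comp h1
    rwa [ENNReal.zero_rpow_of_pos hq0] at h2
  have hfin := ge_of_tendsto' hlim fun k => hdelta _ (by positivity)
  rw [zero_mul, zero_add, ← mul_assoc, ENNReal.mul_rpow_of_nonneg _ _ h2q, ← mul_assoc] at hfin
  have hmv : Measurable fun x => 2 * ‖v x - v x₀‖ₑ ^ 2 :=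
    ((hvm.sub_const _).enorm.pow_const 2).const_mul _
  calc ∫⁻ x in B, ∫⁻ y in B, ‖v x - v y‖ₑ ^ 2
      ≤ ∫⁻ x in B, ∫⁻ y in B, (2 * ‖v x - v x₀‖ₑ ^ 2 + 2 * ‖v y - v x₀‖ₑ ^ 2) :=
        lintegral_mono fun x => lintegral_mono fun y => enorm_sub_sq_le_two _ _ _
    _ = 4 * volume B * ∫⁻ x in B, ‖v x - v x₀‖ₑ ^ 2 := by
        simp_rw [lintegral_add_left measurable_const, lintegral_const, Measure.restrict_apply_univ]
        rw [lintegral_add_right _ measurable_const, lintegral_const, Measure.restrict_apply_univ,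
          lintegral_mul_const _ hmv, lintegral_const_mul' _ _ (by simp)]
        ring
    _ ≤ 4 * volume B * (C * (3 ^ q * (C₁ + 1)) ^ (2 / q) * G ^ (2 / q)) := by gcongr
    _ = _ := by ring

/-- Sobolev–Poincaré inequality on the unit ball. -/
lemma exists_sobolev_poincare_unit_ball (hn : 1 ≤ n) {q : ℝ}
    (hq : q = max (2 * (n : ℝ) / (n + 2)) 1) :
    ∃ C : ℝ≥0∞, C ≠ ∞ ∧ ∀ {N : ℕ} {v : Spc n → Vec N}, ContDiff ℝ 1 v →
      ∫⁻ x in Metric.ball (0 : Spc n) 1, ∫⁻ y in Metric.ball (0 : Spc n) 1, ‖v x - v y‖ₑ ^ 2 ≤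
        C * (∫⁻ x in Metric.ball (0 : Spc n) 1, ‖fderiv ℝ v x‖ₑ ^ q) ^ (2 / q) := by
  rcases hn.lt_or_eq with hn2 | hn1
  · have hn' : (2 : ℝ) ≤ n := by exact_mod_cast hn2
    have : q = 2 * (n : ℝ) / (n + 2) := by
      rw [hq, max_eq_left]
      rw [le_div_iff₀ (by positivity)]; linarith
    rw [this]
    exact exists_sobolev_poincare_unit_ball_of_two_le hn2
  · subst hn1
    have hq1 : q = 1 := by
      rw [hq, max_eq_right]; norm_num
    refine ⟨volume (Metric.ball (0 : Spc 1) 1) * volume (Metric.ball (0 : Spc 1) 1),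
      ENNReal.mul_ne_top measure_ball_lt_top.ne measure_ball_lt_top.ne, fun {N v} hv => ?_⟩
    rw [hq1]
    simp only [ENNReal.rpow_one, div_one, ENNReal.rpow_ofNat]
    obtain ⟨G, hG⟩ : ∃ G, G = ∫⁻ x in Metric.ball (0 : Spc 1) 1, ‖fderiv ℝ v x‖ₑ := ⟨_, rfl⟩
    rw [← hG]
    calc _ ≤ ∫⁻ _ in Metric.ball (0 : Spc 1) 1, ∫⁻ _ in Metric.ball (0 : Spc 1) 1, G ^ 2 := by
          refine setLIntegral_mono' measurableSet_ball fun x hx =>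
            setLIntegral_mono' measurableSet_ball fun y hy => ?_
          rw [hG]
          gcongr
          exact enorm_sub_le_lintegral_ball_one hv hx hy
      _ = _ := by
          simp only [lintegral_const, Measure.restrict_apply_univ]
          ring

/-- Change of variables from a ball to the unit ball. -/
lemma setLIntegral_ball_eq {f : Spc n → ℝ≥0∞} (hf : Measurable f) (x₀ : Spc n) {r : ℝ}
    (hr : 0 < r) :
    ∫⁻ x in Metric.ball x₀ r, f x =
      ENNReal.ofReal r ^ n * ∫⁻ y in Metric.ball (0 : Spc n) 1, f (x₀ + r • y) := by
  have hg : Measurable ((Metric.ball x₀ r).indicator f) := hf.indicator measurableSet_ball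
  have h1 : ∫⁻ y in Metric.ball (0 : Spc n) 1, f (x₀ + r • y) =
      ∫⁻ y, (Metric.ball x₀ r).indicator f (x₀ + r • y) := by
    rw [← lintegral_indicator measurableSet_ball]
    refine lintegral_congr fun y => ?_
    have : x₀ + r • y ∈ Metric.ball x₀ r ↔ y ∈ Metric.ball (0 : Spc n) 1 := by
      simp [norm_smul, abs_of_pos hr, hr]
    by_cases hy : y ∈ Metric.ball (0 : Spc n) 1
    · rw [indicator_of_mem hy, indicator_of_mem (this.2 hy)]
    · rw [indicator_of_notMem hy, indicator_of_notMem (fun h => hy (this.1 h))]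
  have h2 : ∫⁻ y, (Metric.ball x₀ r).indicator f (x₀ + r • y) =
      ∫⁻ y, (Metric.ball x₀ r).indicator f (x₀ + y) ∂(Measure.map (r • ·) volume) :=
    (lintegral_map (hg.comp (measurable_const_add x₀)) (measurable_const_smul r)).symm
  rw [h1, h2, Measure.map_addHaar_smul _ hr.ne', lintegral_smul_measure,
    lintegral_add_left_eq_self, lintegral_indicator measurableSet_ball, smul_eq_mul,
    finrank_euclideanSpace_fin, ← mul_assoc, abs_of_pos (by positivity), ← ENNReal.ofReal_pow hr.le,
    ← ENNReal.ofReal_mul (by positivity), mul_inv_cancel₀ (by positivity), ENNReal.ofReal_one,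
    one_mul]

/-- Sobolev–Poincaré inequality on balls. -/
lemma exists_sobolev_poincare_ball (hn : 1 ≤ n) {q : ℝ}
    (hq : q = max (2 * (n : ℝ) / (n + 2)) 1) :
    ∃ C : ℝ≥0∞, C ≠ ∞ ∧ ∀ {N : ℕ} {v : Spc n → Vec N} (x₀ : Spc n) {r : ℝ}, 0 < r →
      ContDiff ℝ 1 v →
      ∫⁻ x in Metric.ball x₀ r, ∫⁻ y in Metric.ball x₀ r, ‖v x - v y‖ₑ ^ 2 ≤
        C * ENNReal.ofReal r ^ (2 * (n : ℝ) + 2 - 2 * n / q) *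
          (∫⁻ x in Metric.ball x₀ r, ‖fderiv ℝ v x‖ₑ ^ q) ^ (2 / q) := by
  obtain ⟨C, hC, hS⟩ := exists_sobolev_poincare_unit_ball hn hq
  have hq0 : 0 < q := by rw [hq]; exact lt_max_of_lt_right one_pos
  refine ⟨C, hC, fun {N v} x₀ r hr hv => ?_⟩
  have hw : ContDiff ℝ 1 fun y => v (x₀ + r • y) := hv.comp (by fun_prop)
  have hvm : Measurable v := hv.continuous.measurable
  have hD : ∀ y, ‖fderiv ℝ (fun y => v (x₀ + r • y)) y‖ₑ =
      ENNReal.ofReal r * ‖fderiv ℝ v (x₀ + r • y)‖ₑ := by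
    intro y
    have h1 : HasFDerivAt (fun y : Spc n => x₀ + r • y) (r • ContinuousLinearMap.id ℝ (Spc n)) y :=
      ((hasFDerivAt_id y).const_smul r).const_add x₀
    have h2 := ((hv.differentiable one_ne_zero) (x₀ + r • y)).hasFDerivAt.comp y h1
    rw [show fderiv ℝ (fun y => v (x₀ + r • y)) y = _ from h2.fderiv,
      ContinuousLinearMap.comp_smul, ContinuousLinearMap.comp_id, enorm_smul,
      Real.enorm_eq_ofReal hr.le]
  have hmg : Measurable fun x => ‖fderiv ℝ v x‖ₑ ^ q :=
    (hv.continuous_fderiv one_ne_zero).enorm.measurable.pow_const q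
  have hmi : ∀ x, Measurable fun y => ‖v x - v y‖ₑ ^ 2 := fun x =>
    ((measurable_const.sub hvm).enorm).pow_const 2
  have hmo : Measurable fun x => ∫⁻ y in Metric.ball (0 : Spc n) 1, ‖v x - v (x₀ + r • y)‖ₑ ^ 2 :=
    Measurable.lintegral_prod_right' (f := fun w : Spc n × Spc n => ‖v w.1 - v (x₀ + r • w.2)‖ₑ ^ 2)
      (((hvm.comp measurable_fst).sub (hvm.comp (by fun_prop))).enorm.pow_const 2)
  have hR0 : ENNReal.ofReal r ≠ 0 := by simpa using hr
  have hR1 : ENNReal.ofReal r ≠ ∞ := ENNReal.ofReal_ne_top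
  simp_rw [fun x => setLIntegral_ball_eq (hmi x) x₀ hr]
  rw [lintegral_const_mul' _ _ (ENNReal.pow_ne_top hR1), setLIntegral_ball_eq hmo x₀ hr,
    setLIntegral_ball_eq hmg x₀ hr]
  have h := hS hw
  simp_rw [hD, ENNReal.mul_rpow_of_nonneg _ _ hq0.le] at h
  rw [lintegral_const_mul' _ _ (ENNReal.rpow_ne_top_of_nonneg hq0.le hR1)] at h
  obtain ⟨G, hG⟩ : ∃ G, G = ∫⁻ y in Metric.ball (0 : Spc n) 1, ‖fderiv ℝ v (x₀ + r • y)‖ₑ ^ q :=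
    ⟨_, rfl⟩
  rw [← hG] at h ⊢
  refine (mul_le_mul' le_rfl (mul_le_mul' le_rfl h)).trans (le_of_eq ?_)
  have h2q : 0 ≤ 2 / q := by positivity
  rw [ENNReal.mul_rpow_of_nonneg _ _ h2q, ENNReal.mul_rpow_of_nonneg _ _ h2q,
    ← ENNReal.rpow_natCast, ← ENNReal.rpow_mul, ← ENNReal.rpow_mul]
  generalize ENNReal.ofReal r = R at hR0 hR1
  have : R ^ (n : ℝ) * R ^ (n : ℝ) * R ^ (q * (2 / q)) =
      R ^ (2 * (n : ℝ) + 2 - 2 * n / q) * R ^ ((n : ℝ) * (2 / q)) := by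
    rw [← ENNReal.rpow_add _ _ hR0 hR1, ← ENNReal.rpow_add _ _ hR0 hR1,
      ← ENNReal.rpow_add _ _ hR0 hR1]
    congr 1
    field_simp
    ring
  calc _ = C * (R ^ (n : ℝ) * R ^ (n : ℝ) * R ^ (q * (2 / q))) * G ^ (2 / q) := by ring
    _ = _ := by rw [this]; ring

/-- The Frobenius norm dominates the operator norm. -/
theorem opNorm_le_of_apply_single {T : Spc n →L[ℝ] Vec N} {M : Mat N n}
    (h : ∀ i j, T (EuclideanSpace.single j 1) i = M (i, j)) : ‖T‖ ≤ ‖M‖ := by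
  refine T.opNorm_le_bound (norm_nonneg _) fun x => ?_
  have hTx : ∀ i, T x i = ∑ j, M (i, j) * x j := by
    intro i
    have hx : x = ∑ j, x j • EuclideanSpace.single j (1 : ℝ) := by
      ext k
      simp [Finset.sum_apply, Pi.single_apply]
    conv_lhs => rw [hx]
    simp only [map_sum, map_smul, WithLp.ofLp_sum, Finset.sum_apply, PiLp.smul_apply,
      smul_eq_mul, h]
    exact Finset.sum_congr rfl fun j _ => mul_comm _ _
  refine (sq_le_sq₀ (norm_nonneg _) (by positivity)).1 ?_
  rw [mul_pow, EuclideanSpace.norm_sq_eq, EuclideanSpace.norm_sq_eq, EuclideanSpace.norm_sq_eq,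
    Fintype.sum_prod_type, Finset.sum_mul]
  refine Finset.sum_le_sum fun i _ => ?_
  simp only [Real.norm_eq_abs, sq_abs]
  rw [hTx]
  exact Finset.sum_mul_sq_le_sq_mul_sq _ _ _

/-- Convolution with a probability density does not increase the `L^q` norm. -/
theorem lintegral_enorm_convolution_rpow_le {E : Type*} [NormedAddCommGroup E] [NormedSpace ℝ E]
    [MeasurableSpace E] [BorelSpace E] (φ : ContDiffBump (0 : Spc n)) {G : Spc n → E}
    (hG : Measurable G) {q : ℝ} (hq : 1 ≤ q) :
    ∫⁻ x, ‖(MeasureTheory.convolution (φ.normed volume) G (ContinuousLinearMap.lsmul ℝ ℝ)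
      volume) x‖ₑ ^ q ≤ ∫⁻ x, ‖G x‖ₑ ^ q := by
  have hφm : Measurable fun t => ENNReal.ofReal (φ.normed volume t) :=
    (φ.continuous_normed).measurable.ennreal_ofReal
  set P : Measure (Spc n) := volume.withDensity fun t => ENNReal.ofReal (φ.normed volume t)
    with hP
  have hPp : IsProbabilityMeasure P := by
    constructor
    rw [hP, withDensity_apply _ MeasurableSet.univ, Measure.restrict_univ,
      ← ofReal_integral_eq_lintegral_ofReal φ.integrable_normed
        (ae_of_all _ fun x => φ.nonneg_normed x), φ.integral_normed, ENNReal.ofReal_one]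
  have hGs : Measurable fun z : Spc n × Spc n => ‖G (z.1 - z.2)‖ₑ :=
    (hG.comp (measurable_fst.sub measurable_snd)).enorm
  calc ∫⁻ x, ‖(MeasureTheory.convolution (φ.normed volume) G (ContinuousLinearMap.lsmul ℝ ℝ)
      volume) x‖ₑ ^ q ≤ ∫⁻ x, (∫⁻ t, ‖G (x - t)‖ₑ ^ q ∂P) := by
        refine lintegral_mono fun x => ?_
        have hm : Measurable fun t => ‖G (x - t)‖ₑ := hGs.comp measurable_prodMk_left
        refine le_trans (ENNReal.rpow_le_rpow ?_ (by linarith))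
          (lintegral_rpow_le_lintegral_rpow hq hm.aemeasurable)
        rw [MeasureTheory.convolution_def]
        refine (enorm_integral_le_lintegral_enorm _).trans (le_of_eq ?_)
        rw [hP, lintegral_withDensity_eq_lintegral_mul _ hφm hm]
        refine lintegral_congr fun t => ?_
        simp only [ContinuousLinearMap.lsmul_apply, enorm_smul, Pi.mul_apply]
        rw [Real.enorm_of_nonneg (φ.nonneg_normed t)]
    _ = ∫⁻ t, (∫⁻ x, ‖G (x - t)‖ₑ ^ q) ∂P := by
        rw [lintegral_lintegral_swap]
        exact (hGs.pow_const q).aemeasurable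
    _ = ∫⁻ x, ‖G x‖ₑ ^ q := by
        have : ∀ t, ∫⁻ x, ‖G (x - t)‖ₑ ^ q = ∫⁻ x, ‖G x‖ₑ ^ q := fun t =>
          lintegral_sub_right_eq_self (fun x => ‖G x‖ₑ ^ q) t
        simp [this]

/-- Standard mollifiers at scale `ρ / (k + 2)`. -/
def mollBump {E : Type*} [Zero E] {ρ : ℝ} (hρ : 0 < ρ) (k : ℕ) : ContDiffBump (0 : E) where
  rIn := ρ / (2 * (k + 2))
  rOut := ρ / (k + 2)
  rIn_pos := by positivity
  rIn_lt_rOut := by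
    apply div_lt_div_of_pos_left hρ (by positivity)
    have : (0 : ℝ) ≤ k := k.cast_nonneg
    linarith

theorem tendsto_rOut_mollBump {E : Type*} [Zero E] {ρ : ℝ} (hρ : 0 < ρ) :
    Tendsto (fun k => (mollBump (E := E) hρ k).rOut) atTop (𝓝 0) := by
  have h := (tendsto_const_div_atTop_nhds_zero_nat ρ).comp (tendsto_add_atTop_nat 2)
  refine h.congr fun k => ?_
  simp [mollBump]

theorem rOut_mollBump_le {E : Type*} [Zero E] {ρ : ℝ} (hρ : 0 < ρ) (k : ℕ) :
    (mollBump (E := E) hρ k).rOut ≤ 2 * (mollBump (E := E) hρ k).rIn := by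
  simp only [mollBump]
  apply le_of_eq
  field_simp

theorem rOut_mollBump_lt {E : Type*} [Zero E] {ρ : ℝ} (hρ : 0 < ρ) (k : ℕ) :
    (mollBump (E := E) hρ k).rOut < ρ := by
  simp only [mollBump]
  rw [div_lt_iff₀ (by positivity)]
  have : (0 : ℝ) ≤ k := k.cast_nonneg
  nlinarith

/-- Mollification of a pair `(f, G)`, where `G` is the weak gradient of `f` tested against
translated mollifiers at a dense set of points. -/
theorem norm_fderiv_convolution_le {φ : ContDiffBump (0 : Spc n)} {f : Spc n → Vec N}
    {G : Spc n → Mat N n} (hf : LocallyIntegrable f) (hG : LocallyIntegrable G)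
    {U D : Set (Spc n)} (hU : IsOpen U) (hD : Dense D)
    (h : ∀ x ∈ D, x ∈ U → ∀ i j,
      ∫ y, f y i * fderiv ℝ (φ.normed volume) (x - y) (EuclideanSpace.single j 1)
        = ∫ y, G y (i, j) * φ.normed volume (x - y)) {x : Spc n} (hx : x ∈ U) :
    ‖fderiv ℝ (MeasureTheory.convolution (φ.normed volume) f (ContinuousLinearMap.lsmul ℝ ℝ)
      volume) x‖ ≤ ‖(MeasureTheory.convolution (φ.normed volume) G
        (ContinuousLinearMap.lsmul ℝ ℝ) volume) x‖ := by
  have hφc : HasCompactSupport (φ.normed volume) := φ.hasCompactSupport_normed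
  have hφ1 : ContDiff ℝ 1 (φ.normed volume) := φ.contDiff_normed
  have hφ' : Continuous (fderiv ℝ (φ.normed volume)) := hφ1.continuous_fderiv one_ne_zero
  set L : ℝ →L[ℝ] Vec N →L[ℝ] Vec N := ContinuousLinearMap.lsmul ℝ ℝ with hL
  set v := MeasureTheory.convolution (φ.normed volume) f L volume with hv
  set w := MeasureTheory.convolution (φ.normed volume) G
    (ContinuousLinearMap.lsmul ℝ ℝ) volume with hw
  have hv1 : ContDiff ℝ 1 v := hφc.contDiff_convolution_left L hφ1 hf
  have hwc : Continuous w := hφc.continuous_convolution_left _ φ.continuous_normed hG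
  refine opNorm_le_of_apply_single fun i j => ?_
  have hE : EqOn (fun x => fderiv ℝ v x (EuclideanSpace.single j 1) i) (fun x => w x (i, j))
      U := by
    refine EqOn.of_subset_closure (s := U ∩ D) ?_ ?_ ?_ inter_subset_left
      (hD.open_subset_closure_inter hU)
    · rintro y ⟨hyU, hyD⟩
      have h1 := h y hyD hyU i j
      have hd := (hφc.hasFDerivAt_convolution_left L hφ1 hf y).fderiv
      have hi1 := ((hφc.fderiv ℝ).convolutionExists_left (L.precompL (Spc n)) hφ' hf y)
      have hi2 := (hφc.convolutionExists_left (ContinuousLinearMap.lsmul ℝ ℝ)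
        φ.continuous_normed hG y)
      have e1 := ((EuclideanSpace.proj i : Vec N →L[ℝ] ℝ).comp
        (ContinuousLinearMap.apply ℝ (Vec N) (EuclideanSpace.single j (1 : ℝ)))).integral_comp_comm
          hi1.integrable_swap
      have e2 := (EuclideanSpace.proj (i, j) : Mat N n →L[ℝ] ℝ).integral_comp_comm
          hi2.integrable_swap
      simp only [ContinuousLinearMap.comp_apply, ContinuousLinearMap.apply_apply,
        PiLp.proj_apply, ContinuousLinearMap.precompL_apply, hL,
        ContinuousLinearMap.lsmul_apply, PiLp.smul_apply, smul_eq_mul] at e1 e2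
      show fderiv ℝ v y (EuclideanSpace.single j 1) i = w y (i, j)
      rw [hv, hd, hw, MeasureTheory.convolution_eq_swap, MeasureTheory.convolution_eq_swap]
      refine e1.symm.trans (Eq.trans ?_ e2)
      simp only [mul_comm (f _ i), mul_comm (G _ _)] at h1
      exact h1
    · have := hv1.continuous_fderiv one_ne_zero
      exact Continuous.continuousOn (by fun_prop)
    · exact Continuous.continuousOn (by fun_prop)
  exact hE hx

/-- Sobolev–Poincaré inequality for a Sobolev function on a ball, whose weak gradient is
tested against translated mollifiers at a dense set of points. -/
theorem lintegral_sub_sq_le_of_weakGrad {q a : ℝ} {C : ℝ≥0∞} (hq : 1 ≤ q) (ha : 0 ≤ a)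
    (hSP : ∀ {v : Spc n → Vec N} (x₀ : Spc n) {r : ℝ}, 0 < r → ContDiff ℝ 1 v →
      ∫⁻ x in Metric.ball x₀ r, ∫⁻ y in Metric.ball x₀ r, ‖v x - v y‖ₑ ^ 2
        ≤ C * ENNReal.ofReal r ^ a * (∫⁻ x in Metric.ball x₀ r, ‖fderiv ℝ v x‖ₑ ^ q) ^ (2 / q))
    {x₀ : Spc n} {ρ : ℝ} (hρ : 0 < ρ) {f : Spc n → Vec N} {G : Spc n → Mat N n}
    (hfm : Measurable f) (hGm : Measurable G)
    (hf : IntegrableOn f (Metric.ball x₀ ρ)) (hG : IntegrableOn G (Metric.ball x₀ ρ))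
    {D : Set (Spc n)} (hD : Dense D)
    (h : ∀ k, ∀ x ∈ D, x ∈ Metric.ball x₀ (ρ - (mollBump (E := Spc n) hρ k).rOut) → ∀ i j,
      ∫ y in Metric.ball x₀ ρ, f y i * fderiv ℝ ((mollBump hρ k).normed volume) (x - y)
          (EuclideanSpace.single j 1)
        = ∫ y in Metric.ball x₀ ρ, G y (i, j) * (mollBump hρ k).normed volume (x - y)) :
    ∫⁻ x in Metric.ball x₀ ρ, ∫⁻ y in Metric.ball x₀ ρ, ‖f x - f y‖ₑ ^ 2
      ≤ C * ENNReal.ofReal ρ ^ a * (∫⁻ x in Metric.ball x₀ ρ, ‖G x‖ₑ ^ q) ^ (2 / q) := by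
  set B := Metric.ball x₀ ρ with hB
  have hBm : MeasurableSet B := measurableSet_ball
  set fB := B.indicator f with hfB
  set GB := B.indicator G with hGB
  have hfBi : LocallyIntegrable fB := ((integrable_indicator_iff hBm).2 hf).locallyIntegrable
  have hGBi : LocallyIntegrable GB := ((integrable_indicator_iff hBm).2 hG).locallyIntegrable
  have hfBm : Measurable fB := hfm.indicator hBm
  have hGBm : Measurable GB := hGm.indicator hBm
  let φ : ℕ → ContDiffBump (0 : Spc n) := mollBump hρ
  let r : ℕ → ℝ := fun k => ρ - (φ k).rOut
  let v : ℕ → Spc n → Vec N := fun k => MeasureTheory.convolution ((φ k).normed volume) fB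
    (ContinuousLinearMap.lsmul ℝ ℝ) volume
  have hr0 : ∀ k, 0 < r k := fun k => sub_pos.2 (rOut_mollBump_lt hρ k)
  have hrρ : ∀ k, r k ≤ ρ := fun k => by
    have := (φ k).rOut_pos
    simp only [r]
    linarith
  have hv1 : ∀ k, ContDiff ℝ 1 (v k) := fun k =>
    (φ k).hasCompactSupport_normed.contDiff_convolution_left _ (φ k).contDiff_normed hfBi
  have hbound : ∀ k, ∫⁻ x in Metric.ball x₀ (r k), ∫⁻ y in Metric.ball x₀ (r k),
      ‖v k x - v k y‖ₑ ^ 2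
      ≤ C * ENNReal.ofReal ρ ^ a * (∫⁻ x in B, ‖G x‖ₑ ^ q) ^ (2 / q) := by
    intro k
    refine (hSP x₀ (hr0 k) (hv1 k)).trans ?_
    refine mul_le_mul' (mul_le_mul_right (ENNReal.rpow_le_rpow
      (ENNReal.ofReal_le_ofReal (hrρ k)) ha) _) (ENNReal.rpow_le_rpow ?_ (by positivity))
    calc ∫⁻ x in Metric.ball x₀ (r k), ‖fderiv ℝ (v k) x‖ₑ ^ q
        ≤ ∫⁻ x in Metric.ball x₀ (r k), ‖(MeasureTheory.convolution ((φ k).normed volume) GB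
            (ContinuousLinearMap.lsmul ℝ ℝ) volume) x‖ₑ ^ q := by
          refine setLIntegral_mono' measurableSet_ball fun x hx => ?_
          refine ENNReal.rpow_le_rpow ?_ (by linarith)
          refine enorm_le_iff_norm_le.2 ?_
          refine norm_fderiv_convolution_le hfBi hGBi Metric.isOpen_ball hD ?_ hx
          intro x hxD hxU i j
          have h1 := h k x hxD hxU i j
          rw [← integral_indicator hBm, ← integral_indicator hBm] at h1
          refine (integral_congr_ae (ae_of_all _ fun y => ?_)).trans
            (h1.trans (integral_congr_ae (ae_of_all _ fun y => ?_)))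
          · by_cases hy : y ∈ B <;> simp [hfB, hy, φ]
          · by_cases hy : y ∈ B <;> simp [hGB, hy, φ]
      _ ≤ ∫⁻ x, ‖(MeasureTheory.convolution ((φ k).normed volume) GB
            (ContinuousLinearMap.lsmul ℝ ℝ) volume) x‖ₑ ^ q := setLIntegral_le_lintegral _ _
      _ ≤ ∫⁻ x, ‖GB x‖ₑ ^ q := lintegral_enorm_convolution_rpow_le _ hGBm hq
      _ = ∫⁻ x in B, ‖G x‖ₑ ^ q := by
          rw [← lintegral_indicator hBm]
          refine lintegral_congr fun x => ?_
          have hq0 : 0 < q := by linarith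
          by_cases hx : x ∈ B <;> simp [hGB, hx, hq0]
  have hconv : ∀ᵐ x, Tendsto (fun k => v k x) atTop (𝓝 (fB x)) :=
    ContDiffBump.ae_convolution_tendsto_right_of_locallyIntegrable (K := 2)
      (tendsto_rOut_mollBump hρ) (Eventually.of_forall fun k => rOut_mollBump_le hρ k) hfBi
  let R : ℕ → Set (Spc n × Spc n) := fun k => Metric.ball x₀ (r k) ×ˢ Metric.ball x₀ (r k)
  have hRm : ∀ k, MeasurableSet (R k) := fun k => measurableSet_ball.prod measurableSet_ball
  let H : ℕ → Spc n × Spc n → ℝ≥0∞ := fun k => (R k).indicator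
    fun z => ‖v k z.1 - v k z.2‖ₑ ^ 2
  have hHm : ∀ k, Measurable (H k) := fun k => by
    have := (hv1 k).continuous.measurable
    exact Measurable.indicator (by fun_prop) (hRm k)
  have hHint : ∀ k, ∫⁻ z, H k z
      ≤ C * ENNReal.ofReal ρ ^ a * (∫⁻ x in B, ‖G x‖ₑ ^ q) ^ (2 / q) := by
    intro k
    refine le_trans (le_of_eq ?_) (hbound k)
    rw [lintegral_indicator (hRm k), Measure.volume_eq_prod, ← Measure.prod_restrict,
      lintegral_prod]
    have := (hv1 k).continuous.measurable
    exact Measurable.aemeasurable (by fun_prop)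
  have hlim : ∀ᵐ z : Spc n × Spc n, (B ×ˢ B).indicator (fun z => ‖f z.1 - f z.2‖ₑ ^ 2) z
      ≤ liminf (fun k => H k z) atTop := by
    have h1 := Measure.quasiMeasurePreserving_fst (μ := (volume : Measure (Spc n)))
      (ν := (volume : Measure (Spc n))) |>.ae hconv
    have h2 := Measure.quasiMeasurePreserving_snd (μ := (volume : Measure (Spc n)))
      (ν := (volume : Measure (Spc n))) |>.ae hconv
    rw [Measure.volume_eq_prod]
    filter_upwards [h1, h2] with z hz1 hz2
    by_cases hz : z ∈ B ×ˢ B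
    · rw [indicator_of_mem hz]
      refine le_of_eq (Tendsto.liminf_eq ?_).symm
      have ht : Tendsto (fun k => ‖v k z.1 - v k z.2‖ₑ ^ 2) atTop (𝓝 (‖f z.1 - f z.2‖ₑ ^ 2)) := by
        have e1 : fB z.1 = f z.1 := indicator_of_mem hz.1 _
        have e2 : fB z.2 = f z.2 := indicator_of_mem hz.2 _
        rw [← e1, ← e2]
        exact ((ENNReal.continuous_pow 2).tendsto _).comp (hz1.sub hz2).enorm
      refine ht.congr' ?_
      have hr : Tendsto r atTop (𝓝 ρ) := by
        have := (tendsto_const_nhds (x := ρ)).sub (tendsto_rOut_mollBump (E := Spc n) hρ)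
        simpa using this
      have hb1 : dist z.1 x₀ < ρ := hz.1
      have hb2 : dist z.2 x₀ < ρ := hz.2
      filter_upwards [hr.eventually (lt_mem_nhds hb1), hr.eventually (lt_mem_nhds hb2)]
        with k hk1 hk2
      have hzR : z ∈ R k := ⟨hk1, hk2⟩
      simp only [H, indicator_of_mem hzR]
    · rw [indicator_of_notMem hz]
      exact zero_le
  calc ∫⁻ x in B, ∫⁻ y in B, ‖f x - f y‖ₑ ^ 2
      = ∫⁻ z, (B ×ˢ B).indicator (fun z => ‖f z.1 - f z.2‖ₑ ^ 2) z := by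
        rw [lintegral_indicator (hBm.prod hBm), Measure.volume_eq_prod, ← Measure.prod_restrict,
          lintegral_prod]
        exact Measurable.aemeasurable (by fun_prop)
    _ ≤ ∫⁻ z, liminf (fun k => H k z) atTop := lintegral_mono_ae hlim
    _ ≤ liminf (fun k => ∫⁻ z, H k z) atTop := lintegral_liminf_le hHm
    _ ≤ _ := by
        refine (liminf_le_liminf (Eventually.of_forall hHint)).trans ?_
        simp

/-- A space-time function annihilated by all tensor test functions in time has vanishing
spatial integrals. -/
theorem ae_integral_slice_eq_zero {W : Spc n × ℝ → ℝ} {B : Set (Spc n)} {I : Set ℝ}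
    (hI : IsOpen I) (hW : IntegrableOn W (B ×ˢ I))
    (h : ∀ χ : ℝ → ℝ, ContDiff ℝ (⊤ : ℕ∞) χ → HasCompactSupport χ → tsupport χ ⊆ I →
      ∫ z in B ×ˢ I, χ z.2 * W z = 0) :
    ∀ᵐ t ∂(volume.restrict I), ∫ x in B, W (x, t) = 0 := by
  have hW' : Integrable W ((volume.restrict B).prod (volume.restrict I)) := by
    rwa [Measure.prod_restrict, ← Measure.volume_eq_prod]
  have hg : Integrable (fun t => ∫ x in B, W (x, t)) (volume.restrict I) :=
    hW'.integral_prod_right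
  rw [ae_restrict_iff' hI.measurableSet]
  refine hI.ae_eq_zero_of_integral_contDiff_smul_eq_zero
    (IntegrableOn.locallyIntegrableOn hg) fun χ hχ hχc hχI => ?_
  have h1 := h χ hχ hχc hχI
  obtain ⟨M, hM⟩ := hχc.exists_bound_of_continuous hχ.continuous
  have h_int : Integrable (fun z : Spc n × ℝ => χ z.2 * W z)
      ((volume.restrict B).prod (volume.restrict I)) :=
    hW'.bdd_mul (hχ.continuous.comp continuous_snd).aestronglyMeasurable
      (ae_of_all _ fun z => hM z.2)
  rw [Measure.volume_eq_prod, ← Measure.prod_restrict, integral_prod_symm _ h_int] at h1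
  simp only [integral_const_mul] at h1
  rw [← h1, setIntegral_eq_integral_of_forall_compl_eq_zero]
  · simp only [smul_eq_mul]
  · intro t ht
    have : χ t = 0 := image_eq_zero_of_notMem_tsupport fun h => ht (hχI h)
    simp [this]

theorem pderivS_mul_right {η : Spc n → ℝ} (hη : ContDiff ℝ (⊤ : ℕ∞) η) (χ : ℝ → ℝ) (j : Fin n)
    (z : Spc n × ℝ) :
    pderivS j (fun w => η w.1 * χ w.2) z
      = χ z.2 * fderiv ℝ η z.1 (EuclideanSpace.single j 1) := by
  have hd : DifferentiableAt ℝ η z.1 := (hη.differentiable (by simp)).differentiableAt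
  simp only [pderivS]
  rw [fderiv_mul_const hd]
  simp

theorem hasCompactSupport_mul_prod {η : Spc n → ℝ} {χ : ℝ → ℝ} (hη : HasCompactSupport η)
    (hχ : HasCompactSupport χ) {B : Set (Spc n)} {I : Set ℝ} (hB : tsupport η ⊆ B)
    (hI : tsupport χ ⊆ I) :
    HasCompactSupport (fun w : Spc n × ℝ => η w.1 * χ w.2) ∧
      tsupport (fun w : Spc n × ℝ => η w.1 * χ w.2) ⊆ B ×ˢ I := by
  have hs : Function.support (fun w : Spc n × ℝ => η w.1 * χ w.2) ⊆ tsupport η ×ˢ tsupport χ := by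
    intro z hz
    have hz' : η z.1 * χ z.2 ≠ 0 := hz
    exact ⟨subset_tsupport _ (left_ne_zero_of_mul hz'),
      subset_tsupport _ (right_ne_zero_of_mul hz')⟩
  have hK : IsCompact (tsupport η ×ˢ tsupport χ) := IsCompact.prod hη hχ
  exact ⟨HasCompactSupport.of_support_subset_isCompact hK hs,
    (closure_minimal hs hK.isClosed).trans (prod_mono hB hI)⟩

namespace WeakSolution

variable {p ν L T : ℝ} {Ω : Set (Spc n)} {A : Spc n × ℝ → Vec N → Mat N n → Mat N n}
  {F : Spc n × ℝ → Mat N n} {u : Spc n × ℝ → Vec N} {Du : Spc n × ℝ → Mat N n}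

theorem isFiniteMeasure (h : WeakSolution p ν L T Ω A F u Du) :
    IsFiniteMeasure (volume.restrict (Ω ×ˢ Ioo 0 T)) :=
  isFiniteMeasure_restrict.2 (h.bddΩ.prod (Metric.isBounded_Ioo 0 T)).measure_lt_top.ne

/-- Slicewise integration by parts for the weak gradient. -/
theorem ae_weakGrad_slice (h : WeakSolution p ν L T Ω A F u Du) (hp : 1 ≤ p)
    {B : Set (Spc n)} {I : Set ℝ}
    (hI : IsOpen I) (hBΩ : B ×ˢ I ⊆ Ω ×ˢ Ioo 0 T)
    {η : Spc n → ℝ} (hη : ContDiff ℝ (⊤ : ℕ∞) η) (hηc : HasCompactSupport η)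
    (hηB : tsupport η ⊆ B) (i : Fin N) (j : Fin n) :
    ∀ᵐ t ∂(volume.restrict I),
      ∫ x in B, (u (x, t) i * fderiv ℝ η x (EuclideanSpace.single j 1)
        + Du (x, t) (i, j) * η x) = 0 := by
  have := h.isFiniteMeasure
  have hp' : (1 : ℝ≥0∞) ≤ ENNReal.ofReal p := by simpa using hp
  have hui : IntegrableOn (fun z => u z i) (Ω ×ˢ Ioo 0 T) :=
    (EuclideanSpace.proj i : Vec N →L[ℝ] ℝ).integrable_comp (h.memLp_u.integrable hp')
  have hdi : IntegrableOn (fun z => Du z (i, j)) (Ω ×ˢ Ioo 0 T) :=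
    (EuclideanSpace.proj (i, j) : Mat N n →L[ℝ] ℝ).integrable_comp (h.memLp_Du.integrable hp')
  have hη' : Continuous fun x => fderiv ℝ η x (EuclideanSpace.single j 1) := by
    have := hη.continuous_fderiv (by simp)
    fun_prop
  have hη'c : HasCompactSupport fun x => fderiv ℝ η x (EuclideanSpace.single j 1) :=
    hηc.fderiv_apply ℝ _
  obtain ⟨M, hM⟩ := hηc.exists_bound_of_continuous hη.continuous
  obtain ⟨M', hM'⟩ := hη'c.exists_bound_of_continuous hη'
  have h1 : IntegrableOn (fun z => u z i * fderiv ℝ η z.1 (EuclideanSpace.single j 1))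
      (Ω ×ˢ Ioo 0 T) := hui.mul_bdd (hη'.comp continuous_fst).aestronglyMeasurable
        (ae_of_all _ fun z => hM' z.1)
  have h2 : IntegrableOn (fun z => Du z (i, j) * η z.1) (Ω ×ˢ Ioo 0 T) :=
    hdi.mul_bdd (hη.continuous.comp continuous_fst).aestronglyMeasurable
        (ae_of_all _ fun z => hM z.1)
  refine ae_integral_slice_eq_zero (W := fun z => u z i * fderiv ℝ η z.1
    (EuclideanSpace.single j 1) + Du z (i, j) * η z.1) hI ((h1.add h2).mono_set hBΩ)
    fun χ hχ hχc hχI => ?_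
  obtain ⟨hc, hs⟩ := hasCompactSupport_mul_prod hηc hχc hηB hχI
  have hψ : ContDiff ℝ (⊤ : ℕ∞) fun w : Spc n × ℝ => η w.1 * χ w.2 := by fun_prop
  have hw := h.weakGrad _ hψ hc (hs.trans hBΩ) i j
  simp only [pderivS_mul_right hη] at hw
  obtain ⟨M₂, hM₂⟩ := hχc.exists_bound_of_continuous hχ.continuous
  have hχm : AEStronglyMeasurable (fun z : Spc n × ℝ => χ z.2)
      (volume.restrict (Ω ×ˢ Ioo 0 T)) := (hχ.continuous.comp continuous_snd).aestronglyMeasurable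
  have k1 := Integrable.bdd_mul h1 hχm (ae_of_all _ fun z => hM₂ z.2)
  have k2 := Integrable.bdd_mul h2 hχm (ae_of_all _ fun z => hM₂ z.2)
  have hz0 : ∀ z ∈ (Ω ×ˢ Ioo 0 T) \ (B ×ˢ I), χ z.2 * (u z i * fderiv ℝ η z.1
      (EuclideanSpace.single j 1) + Du z (i, j) * η z.1) = 0 := by
    intro z hz
    by_cases hz1 : z.1 ∈ B
    · have hz2 : z.2 ∉ I := fun h2 => hz.2 ⟨hz1, h2⟩
      rw [image_eq_zero_of_notMem_tsupport fun h => hz2 (hχI h), zero_mul]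
    · have e1 : η z.1 = 0 := image_eq_zero_of_notMem_tsupport fun h => hz1 (hηB h)
      have e2 : fderiv ℝ η z.1 = 0 := by
        have := image_eq_zero_of_notMem_tsupport (f := fderiv ℝ η) (x := z.1)
          fun h => hz1 (hηB (tsupport_fderiv_subset ℝ h))
        exact this
      rw [e1, e2]
      simp
  rw [← setIntegral_eq_of_subset_of_forall_sdiff_eq_zero
    (h.openΩ.measurableSet.prod measurableSet_Ioo) hBΩ hz0]
  calc ∫ z in Ω ×ˢ Ioo 0 T, χ z.2 * (u z i * fderiv ℝ η z.1 (EuclideanSpace.single j 1)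
        + Du z (i, j) * η z.1)
      = ∫ z in Ω ×ˢ Ioo 0 T, (χ z.2 * (u z i * fderiv ℝ η z.1 (EuclideanSpace.single j 1))
        + χ z.2 * (Du z (i, j) * η z.1)) := by simp only [mul_add]
    _ = 0 := by
        rw [integral_add k1 k2]
        have e1 : ∀ z : Spc n × ℝ, χ z.2 * (u z i * fderiv ℝ η z.1 (EuclideanSpace.single j 1))
          = u z i * (χ z.2 * fderiv ℝ η z.1 (EuclideanSpace.single j 1)) := fun z => by ring
        have e2 : ∀ z : Spc n × ℝ, χ z.2 * (Du z (i, j) * η z.1)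
          = Du z (i, j) * (η z.1 * χ z.2) := fun z => by ring
        simp only [e1, e2, hw]
        ring

/-- Sobolev–Poincaré inequality on almost every time slice. -/
theorem ae_lintegral_sub_sq_le (h : WeakSolution p ν L T Ω A F u Du) (hp : 1 ≤ p)
    {q a : ℝ} {C : ℝ≥0∞} (hq : 1 ≤ q) (ha : 0 ≤ a)
    (hSP : ∀ {v : Spc n → Vec N} (x₀ : Spc n) {r : ℝ}, 0 < r → ContDiff ℝ 1 v →
      ∫⁻ x in Metric.ball x₀ r, ∫⁻ y in Metric.ball x₀ r, ‖v x - v y‖ₑ ^ 2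
        ≤ C * ENNReal.ofReal r ^ a * (∫⁻ x in Metric.ball x₀ r, ‖fderiv ℝ v x‖ₑ ^ q) ^ (2 / q))
    {x₀ : Spc n} {ρ : ℝ} (hρ : 0 < ρ) {I : Set ℝ} (hI : IsOpen I)
    (hBΩ : Metric.ball x₀ ρ ×ˢ I ⊆ Ω ×ˢ Ioo 0 T) :
    ∀ᵐ t ∂(volume.restrict I),
      ∫⁻ x in Metric.ball x₀ ρ, ∫⁻ y in Metric.ball x₀ ρ, ‖u (x, t) - u (y, t)‖ₑ ^ 2
        ≤ C * ENNReal.ofReal ρ ^ a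
          * (∫⁻ x in Metric.ball x₀ ρ, ‖Du (x, t)‖ₑ ^ q) ^ (2 / q) := by
  have := h.isFiniteMeasure
  have hp' : (1 : ℝ≥0∞) ≤ ENNReal.ofReal p := by simpa using hp
  set B := Metric.ball x₀ ρ with hB
  have hui : Integrable u ((volume.restrict B).prod (volume.restrict I)) := by
    rw [Measure.prod_restrict, ← Measure.volume_eq_prod]
    exact IntegrableOn.mono_set (h.memLp_u.integrable hp') hBΩ
  have hdi : Integrable Du ((volume.restrict B).prod (volume.restrict I)) := by
    rw [Measure.prod_restrict, ← Measure.volume_eq_prod]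
    exact IntegrableOn.mono_set (h.memLp_Du.integrable hp') hBΩ
  obtain ⟨D, hDc, hDd⟩ := TopologicalSpace.exists_countable_dense (Spc n)
  have := hDc.to_subtype
  have hweak : ∀ᵐ t ∂(volume.restrict I), ∀ (k : ℕ) (x : D) (i : Fin N) (j : Fin n),
      (x : Spc n) ∈ Metric.ball x₀ (ρ - (mollBump (E := Spc n) hρ k).rOut) →
      ∫ y in B, (u (y, t) i * fderiv ℝ (fun y => (mollBump hρ k).normed volume ((x : Spc n) - y)) y
        (EuclideanSpace.single j 1) + Du (y, t) (i, j)
          * (mollBump hρ k).normed volume ((x : Spc n) - y)) = 0 := by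
    simp only [ae_all_iff]
    intro k x i j hx
    set φ : ContDiffBump (0 : Spc n) := mollBump hρ k with hφ
    have hηs : Function.support (fun y => φ.normed volume ((x : Spc n) - y))
        ⊆ Metric.closedBall (x : Spc n) φ.rOut := by
      intro y hy
      have : (x : Spc n) - y ∈ Function.support (φ.normed volume) := hy
      rw [φ.support_normed_eq, mem_ball_zero_iff] at this
      rw [mem_closedBall_iff_norm']
      exact this.le
    refine h.ae_weakGrad_slice hp hI hBΩ (η := fun y =>
      φ.normed volume ((x : Spc n) - y)) ?_ ?_ ?_ i j
    · have := φ.contDiff_normed (μ := volume) (n := (⊤ : ℕ∞))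
      fun_prop
    · exact HasCompactSupport.of_support_subset_isCompact (isCompact_closedBall _ _) hηs
    · refine (closure_minimal hηs Metric.isClosed_closedBall).trans ?_
      refine Metric.closedBall_subset_ball' ?_
      have : dist (x : Spc n) x₀ < ρ - φ.rOut := hx
      linarith
  filter_upwards [hweak, hui.prod_left_ae, hdi.prod_left_ae] with t ht htu htd
  refine lintegral_sub_sq_le_of_weakGrad hq ha hSP hρ (h.measu.comp measurable_prodMk_right)
    (h.measDu.comp measurable_prodMk_right) htu htd hDd fun k x hxD hx i j => ?_
  have h1 := ht k ⟨x, hxD⟩ i j hx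
  set φ : ContDiffBump (0 : Spc n) := mollBump hρ k with hφ
  have hφ1 := φ.contDiff_normed (μ := volume) (n := (⊤ : ℕ∞))
  have hfd : ∀ y, fderiv ℝ (fun y => φ.normed volume (x - y)) y (EuclideanSpace.single j 1)
      = - fderiv ℝ (φ.normed volume) (x - y) (EuclideanSpace.single j 1) := by
    intro y
    have hd : DifferentiableAt ℝ (φ.normed volume) (x - y) :=
      (hφ1.differentiable (by simp)).differentiableAt
    have h2 : HasFDerivAt (fun y : Spc n => x - y) (-ContinuousLinearMap.id ℝ (Spc n)) y :=
      (hasFDerivAt_id y).const_sub x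
    have h3 := (hd.hasFDerivAt.comp y h2).fderiv
    simp only [Function.comp_def] at h3
    rw [h3]
    simp
  have hc1 : Continuous fun y => fderiv ℝ (φ.normed volume) (x - y)
      (EuclideanSpace.single j 1) := by
    have := hφ1.continuous_fderiv (by simp)
    fun_prop
  have hc2 : Continuous fun y => φ.normed volume (x - y) := by
    have := hφ1.continuous
    fun_prop
  obtain ⟨M, hM⟩ := φ.hasCompactSupport_normed.exists_bound_of_continuous hφ1.continuous
  obtain ⟨M', hM'⟩ := (φ.hasCompactSupport_normed.fderiv_apply ℝ
    (EuclideanSpace.single j 1)).exists_bound_of_continuous (f := fun y =>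
      fderiv ℝ (φ.normed volume) y (EuclideanSpace.single j 1)) (by
        have := hφ1.continuous_fderiv (by simp)
        fun_prop)
  have i1 : Integrable (fun y => u (y, t) i * fderiv ℝ (φ.normed volume) (x - y)
      (EuclideanSpace.single j 1)) (volume.restrict B) :=
    ((EuclideanSpace.proj i : Vec N →L[ℝ] ℝ).integrable_comp htu).mul_bdd
      hc1.aestronglyMeasurable (ae_of_all _ fun y => hM' (x - y))
  have i2 : Integrable (fun y => Du (y, t) (i, j) * φ.normed volume (x - y))
      (volume.restrict B) :=
    ((EuclideanSpace.proj (i, j) : Mat N n →L[ℝ] ℝ).integrable_comp htd).mul_bdd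
      hc2.aestronglyMeasurable (ae_of_all _ fun y => hM (x - y))
  simp only [hfd, mul_neg, neg_add_eq_sub] at h1
  rw [integral_sub i2 i1] at h1
  linarith

end WeakSolution

theorem integrable_norm_rpow_of_memLp {X E : Type*} [MeasurableSpace X] [NormedAddCommGroup E]
    {P : Measure X} [IsFiniteMeasure P] {f : X → E} {p r : ℝ} (hp : 0 < p) (hr : 0 ≤ r)
    (hrp : r ≤ p) (hf : MemLp f (ENNReal.ofReal p) P) : Integrable (fun x => ‖f x‖ ^ r) P := by
  have h1 : Integrable (fun x => ‖f x‖ ^ p) P := by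
    have := hf.integrable_norm_rpow (by simpa using hp) ENNReal.ofReal_ne_top
    rwa [ENNReal.toReal_ofReal hp.le] at this
  refine ((integrable_const (1 : ℝ)).add h1).mono'
    ((hf.1.norm.aemeasurable.pow_const r).aestronglyMeasurable) (ae_of_all _ fun x => ?_)
  have hx := norm_nonneg (f x)
  rw [Real.norm_of_nonneg (by positivity)]
  rcases le_total ‖f x‖ 1 with h | h
  · have h2 := Real.rpow_le_one hx h hr
    have h3 : 0 ≤ ‖f x‖ ^ p := by positivity
    show _ ≤ 1 + ‖f x‖ ^ p
    linarith
  · have h2 := Real.rpow_le_rpow_of_exponent_le h hrp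
    show _ ≤ 1 + ‖f x‖ ^ p
    linarith

/-- A smooth cutoff in time whose derivative is a difference of two translated mollifiers. -/
theorem exists_cutoff_deriv_eq (φ : ContDiffBump (0 : ℝ)) {a b s t : ℝ}
    (hs : a < s - φ.rOut) (hs' : s + φ.rOut < b) (ht : a < t - φ.rOut) (ht' : t + φ.rOut < b) :
    ∃ χ : ℝ → ℝ, ContDiff ℝ (⊤ : ℕ∞) χ ∧ HasCompactSupport χ ∧ tsupport χ ⊆ Ioo a b ∧
      (∀ τ, |χ τ| ≤ 1) ∧
      deriv χ = fun σ => φ.normed volume (s - σ) - φ.normed volume (t - σ) := by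
  have hr := φ.rOut_pos
  have hφ := φ.contDiff_normed (μ := (volume : Measure ℝ)) (n := (⊤ : ℕ∞))
  have hsm : ∀ s : ℝ, Continuous fun σ => φ.normed volume (s - σ) := fun s => by
    have := hφ.continuous
    fun_prop
  have hsupp : ∀ s σ : ℝ, φ.normed volume (s - σ) ≠ 0 → s - φ.rOut < σ ∧ σ < s + φ.rOut := by
    intro s σ h
    have : s - σ ∈ Function.support (φ.normed volume) := h
    rw [φ.support_normed_eq, mem_ball_zero_iff, Real.norm_eq_abs, abs_lt] at this
    constructor <;> linarith [this.1, this.2]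
  have h_int : ∀ s : ℝ, Integrable fun σ => φ.normed volume (s - σ) := fun s =>
    (φ.integrable_normed (μ := volume)).comp_sub_left s
  have hint1 : ∀ s : ℝ, ∫ σ, φ.normed volume (s - σ) = 1 := fun s => by
    rw [integral_sub_left_eq_self (fun x => φ.normed volume x)]
    exact φ.integral_normed
  set P : ℝ → ℝ → ℝ := fun s τ => ∫ σ in a..τ, φ.normed volume (s - σ) with hP
  have hPle : ∀ s τ, a ≤ τ → 0 ≤ P s τ ∧ P s τ ≤ 1 := by
    intro s τ hτ
    simp only [hP]
    rw [intervalIntegral.integral_of_le hτ]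
    refine ⟨setIntegral_nonneg measurableSet_Ioc fun σ _ => φ.nonneg_normed _, ?_⟩
    rw [← hint1 s]
    exact setIntegral_le_integral (h_int s) (ae_of_all _ fun σ => φ.nonneg_normed _)
  have hP0 : ∀ s τ, a < s - φ.rOut → τ ≤ s - φ.rOut → P s τ = 0 := by
    intro s τ has hτ
    simp only [hP]
    refine (intervalIntegral.integral_congr (g := fun _ => (0 : ℝ)) fun σ hσ => ?_).trans
      (by simp)
    by_contra hne
    have h1 := (hsupp s σ hne).1
    have h2 : σ ≤ max a τ := hσ.2
    have h3 : max a τ ≤ s - φ.rOut := max_le has.le hτ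
    linarith
  have hP1 : ∀ s τ, a < s - φ.rOut → s + φ.rOut ≤ τ → P s τ = 1 := by
    intro s τ has hτ
    simp only [hP]
    rw [intervalIntegral.integral_eq_integral_of_support_subset, hint1]
    intro σ hσ
    have h1 := hsupp s σ hσ
    exact ⟨by linarith [h1.1], by linarith [h1.2]⟩
  have hder : ∀ s τ, HasDerivAt (P s) (φ.normed volume (s - τ)) τ := fun s τ =>
    intervalIntegral.integral_hasDerivAt_right ((hsm s).intervalIntegrable _ _)
      ((hsm s).stronglyMeasurableAtFilter _ _) (hsm s).continuousAt
  have hderiv : deriv (fun τ => P s τ - P t τ)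
      = fun σ => φ.normed volume (s - σ) - φ.normed volume (t - σ) := by
    ext τ
    exact ((hder s τ).sub (hder t τ)).deriv
  have hsub : Function.support (fun τ => P s τ - P t τ)
      ⊆ Icc (min s t - φ.rOut) (max s t + φ.rOut) := by
    intro τ hτ
    by_contra hn
    apply hτ
    rw [mem_Icc, not_and_or, not_le, not_le] at hn
    have m1 := min_le_left s t
    have m2 := min_le_right s t
    have m3 := le_max_left s t
    have m4 := le_max_right s t
    rcases hn with hn | hn
    · simp only [hP0 s τ hs (by linarith), hP0 t τ ht (by linarith), sub_self]
    · simp only [hP1 s τ hs (by linarith), hP1 t τ ht (by linarith), sub_self]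
  refine ⟨fun τ => P s τ - P t τ, ?_, ?_, ?_, ?_, hderiv⟩
  · rw [contDiff_infty_iff_deriv, hderiv]
    exact ⟨fun τ => ((hder s τ).sub (hder t τ)).differentiableAt, by fun_prop⟩
  · exact HasCompactSupport.of_support_subset_isCompact isCompact_Icc hsub
  · refine (closure_minimal hsub isClosed_Icc).trans fun τ hτ => ⟨?_, ?_⟩
    · refine lt_of_lt_of_le ?_ hτ.1
      rcases min_choice s t with h | h <;> rw [h] <;> assumption
    · refine lt_of_le_of_lt hτ.2 ?_
      rcases max_choice s t with h | h <;> rw [h] <;> assumption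
  · intro τ
    rcases le_total a τ with h | h
    · have h1 := hPle s τ h
      have h2 := hPle t τ h
      exact abs_le.2 ⟨by linarith [h1.1, h2.2], by linarith [h1.2, h2.1]⟩
    · simp only [hP0 s τ hs (by linarith), hP0 t τ ht (by linarith), sub_self, abs_zero,
        zero_le_one]

theorem abs_sum_mul_le {M : Mat N n} {w : Vec N} {g : Fin n → ℝ} {c : ℝ} (hc : 0 ≤ c)
    (hg : ∀ j, |g j| ≤ c) :
    |∑ i, ∑ j, M (i, j) * (w i * g j)| ≤ ‖M‖ * (‖w‖ * (n * c)) := by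
  have hsq : (∑ i, ∑ j, M (i, j) * (w i * g j)) ^ 2 ≤ ‖M‖ ^ 2 * (‖w‖ * (n * c)) ^ 2 := by
    have h1 := Finset.sum_mul_sq_le_sq_mul_sq Finset.univ (fun k : Fin N × Fin n => M k)
      (fun k => w k.1 * g k.2)
    rw [Fintype.sum_prod_type] at h1
    refine h1.trans ?_
    rw [EuclideanSpace.norm_sq_eq M]
    simp only [Real.norm_eq_abs, sq_abs]
    refine mul_le_mul_of_nonneg_left ?_ (Finset.sum_nonneg fun _ _ => sq_nonneg _)
    rw [Fintype.sum_prod_type, mul_pow, EuclideanSpace.norm_sq_eq w, Finset.sum_mul]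
    refine Finset.sum_le_sum fun i _ => ?_
    simp only [Real.norm_eq_abs, sq_abs, mul_pow]
    rw [← Finset.mul_sum]
    refine mul_le_mul_of_nonneg_left ?_ (sq_nonneg _)
    calc ∑ j, g j ^ 2 ≤ ∑ _j : Fin n, c ^ 2 :=
          Finset.sum_le_sum fun j _ => by
            rw [← sq_abs]
            exact pow_le_pow_left₀ (abs_nonneg _) (hg j) 2
      _ = n * c ^ 2 := by simp
      _ ≤ (n : ℝ) ^ 2 * c ^ 2 := by
          refine mul_le_mul_of_nonneg_right ?_ (sq_nonneg _)
          have : (n : ℝ) ≤ (n ^ 2 : ℕ) := by exact_mod_cast Nat.le_self_pow two_ne_zero n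
          exact_mod_cast this
  rw [← mul_pow] at hsq
  exact abs_le_of_sq_le_sq hsq (by positivity)

namespace WeakSolution

variable {p ν L T : ℝ} {Ω : Set (Spc n)} {A : Spc n × ℝ → Vec N → Mat N n → Mat N n}
  {F : Spc n × ℝ → Mat N n} {u : Spc n × ℝ → Vec N} {Du : Spc n × ℝ → Mat N n}

/-- A Carathéodory field composed with measurable maps is measurable. -/
theorem aestronglyMeasurable_field (h : WeakSolution p ν L T Ω A F u Du) :
    AEStronglyMeasurable (fun z => A z (u z) (Du z)) (volume.restrict (Ω ×ˢ Ioo 0 T)) := by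
  set P : Measure (Spc n × ℝ) := volume.restrict (Ω ×ˢ Ioo 0 T) with hP
  set S : Set (Spc n × ℝ) := (toMeasurable P {z | ¬ Continuous fun q : Vec N × Mat N n =>
    A z q.1 q.2})ᶜ with hS
  have hSm : MeasurableSet S := (measurableSet_toMeasurable _ _).compl
  have hSae : ∀ᵐ z ∂P, z ∈ S := by
    rw [ae_iff]
    simp only [hS, mem_compl_iff, not_not]
    have := h.contA
    rw [ae_iff] at this
    simpa [measure_toMeasurable] using this
  have hSc : ∀ z ∈ S, Continuous fun q : Vec N × Mat N n => A z q.1 q.2 := by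
    intro z hz
    by_contra hn
    exact hz (subset_toMeasurable _ _ hn)
  let A' : Vec N × Mat N n → Spc n × ℝ → Mat N n := fun q => S.indicator fun z => A z q.1 q.2
  have hm : Measurable (Function.uncurry A') := by
    refine measurable_uncurry_of_continuous_of_measurable (fun z => ?_) fun q =>
      (h.measA q.1 q.2).indicator hSm
    by_cases hz : z ∈ S
    · simpa [A', indicator_of_mem hz] using hSc z hz
    · simpa [A', indicator_of_notMem hz] using continuous_const
  have hm' : Measurable fun z => A' (u z, Du z) z :=
    hm.comp ((h.measu.prodMk h.measDu).prodMk measurable_id)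
  refine hm'.aestronglyMeasurable.congr ?_
  filter_upwards [hSae] with z hz
  simp [A', indicator_of_mem hz]

theorem tderiv_mul_smul {η : Spc n → ℝ} {χ : ℝ → ℝ} (hχ : ContDiff ℝ (⊤ : ℕ∞) χ) (w : Vec N)
    (z : Spc n × ℝ) :
    tderiv (fun z : Spc n × ℝ => (η z.1 * χ z.2) • w) z = (η z.1 * deriv χ z.2) • w := by
  have hd : HasDerivAt χ (deriv χ z.2) z.2 :=
    (hχ.differentiable (by simp)).differentiableAt.hasDerivAt
  exact ((hd.const_mul (η z.1)).smul_const w).deriv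

theorem gradPair_mul_smul {η : Spc n → ℝ} (hη : ContDiff ℝ (⊤ : ℕ∞) η) (χ : ℝ → ℝ) (w : Vec N)
    (M : Spc n × ℝ → Mat N n) (z : Spc n × ℝ) :
    gradPair M (fun z : Spc n × ℝ => (η z.1 * χ z.2) • w) z
      = χ z.2 * ∑ i, ∑ j, M z (i, j) * (w i * fderiv ℝ η z.1 (EuclideanSpace.single j 1)) := by
  simp only [gradPair, Finset.mul_sum]
  refine Finset.sum_congr rfl fun i _ => Finset.sum_congr rfl fun j _ => ?_
  have : (fun y : Spc n × ℝ => ((η y.1 * χ y.2) • w) i)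
      = fun y : Spc n × ℝ => (fun x => w i * η x) y.1 * χ y.2 := by
    ext y
    simp
    ring
  rw [this, pderivS_mul_right (contDiff_const.mul hη),
    fderiv_const_mul (hη.differentiable (by simp)).differentiableAt]
  simp
  ring

/-- Bound for the distributional time derivative of weighted means of `|u|^{p-2}u`. -/
theorem abs_integral_deriv_mul_inner_le (h : WeakSolution p ν L T Ω A F u Du) (hp : 1 < p)
    {B : Set (Spc n)} {I : Set ℝ} (hBΩ : B ×ˢ I ⊆ Ω ×ˢ Ioo 0 T)
    {η : Spc n → ℝ} (hη : ContDiff ℝ (⊤ : ℕ∞) η) (hηc : HasCompactSupport η)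
    (hηB : tsupport η ⊆ B) {M : ℝ} (hM0 : 0 ≤ M) (hM : ∀ x, ‖fderiv ℝ η x‖ ≤ M)
    {χ : ℝ → ℝ} (hχ : ContDiff ℝ (⊤ : ℕ∞) χ) (hχc : HasCompactSupport χ) (hχI : tsupport χ ⊆ I)
    (hχ1 : ∀ τ, |χ τ| ≤ 1) (w : Vec N) :
    |∫ z in B ×ˢ I, deriv χ z.2 * (η z.1 * (inner ℝ w (pw (p - 1) (u z)) : ℝ))|
      ≤ ‖w‖ * (n * M) * ∫ z in B ×ˢ I, (L * ‖Du z‖ ^ (p - 1) + ‖F z‖ ^ (p - 1)) := by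
  have := h.isFiniteMeasure
  set Q : Set (Spc n × ℝ) := Ω ×ˢ Ioo 0 T with hQ
  have hQm : MeasurableSet Q := h.openΩ.measurableSet.prod measurableSet_Ioo
  obtain ⟨hc, hs⟩ := hasCompactSupport_mul_prod hηc hχc hηB hχI
  have hψ : ContDiff ℝ (⊤ : ℕ∞) fun z : Spc n × ℝ => (η z.1 * χ z.2) • w := by fun_prop
  have hψs : tsupport (fun z : Spc n × ℝ => (η z.1 * χ z.2) • w)
      ⊆ tsupport fun z : Spc n × ℝ => η z.1 * χ z.2 :=
    closure_mono fun z hz h0 => hz (by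
      have h1 : η z.1 * χ z.2 = 0 := h0
      simp only [h1, zero_smul])
  have hw := h.weakForm _ hψ hc.smul_right (hψs.trans (hs.trans hBΩ))
  have hχ' : Continuous (deriv χ) := hχ.continuous_deriv (by simp)
  obtain ⟨M₁, hM₁⟩ := hχc.deriv.exists_bound_of_continuous hχ'
  obtain ⟨M₂, hM₂⟩ := hηc.exists_bound_of_continuous hη.continuous
  have hη' : Continuous (fderiv ℝ η) := hη.continuous_fderiv (by simp)
  have hDup : IntegrableOn (fun z => ‖Du z‖ ^ (p - 1)) Q :=
    integrable_norm_rpow_of_memLp (by linarith) (by linarith) (by linarith) h.memLp_Du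
  have hFp : IntegrableOn (fun z => ‖F z‖ ^ (p - 1)) Q :=
    integrable_norm_rpow_of_memLp (by linarith) (by linarith) (by linarith) h.memLp_F
  have hup : IntegrableOn (fun z => ‖u z‖ ^ (p - 1)) Q :=
    integrable_norm_rpow_of_memLp (by linarith) (by linarith) (by linarith) h.memLp_u
  have hgj : ∀ (x : Spc n) (j : Fin n), |fderiv ℝ η x (EuclideanSpace.single j 1)| ≤ M := by
    intro x j
    have := (fderiv ℝ η x).le_opNorm (EuclideanSpace.single j (1 : ℝ))
    rw [PiLp.norm_single, norm_one, mul_one] at this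
    exact this.trans (hM x)
  have hpair : ∀ (R : Mat N n) (z : Spc n × ℝ), |χ z.2 * ∑ i, ∑ j, R (i, j)
      * (w i * fderiv ℝ η z.1 (EuclideanSpace.single j 1))| ≤ ‖w‖ * (n * M) * ‖R‖ := by
    intro R z
    rw [abs_mul]
    refine (mul_le_mul (hχ1 _) (abs_sum_mul_le hM0 (hgj z.1)) (abs_nonneg _)
      zero_le_one).trans (le_of_eq ?_)
    ring
  have hpairm : ∀ R : Spc n × ℝ → Mat N n, AEStronglyMeasurable R (volume.restrict Q) →
      AEStronglyMeasurable (fun z => χ z.2 * ∑ i, ∑ j, R z (i, j)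
        * (w i * fderiv ℝ η z.1 (EuclideanSpace.single j 1))) (volume.restrict Q) := by
    intro R hR
    refine AEStronglyMeasurable.mul (hχ.continuous.comp continuous_snd).aestronglyMeasurable ?_
    refine Finset.aestronglyMeasurable_fun_sum _ fun i _ =>
      Finset.aestronglyMeasurable_fun_sum _ fun j _ => AEStronglyMeasurable.mul ?_ ?_
    · exact (EuclideanSpace.proj (i, j) : Mat N n →L[ℝ] ℝ).continuous.comp_aestronglyMeasurable hR
    · exact Continuous.aestronglyMeasurable (by fun_prop)
  have hYb : ∀ᵐ z ∂(volume.restrict Q), ‖χ z.2 * ∑ i, ∑ j, A z (u z) (Du z) (i, j)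
      * (w i * fderiv ℝ η z.1 (EuclideanSpace.single j 1))‖
      ≤ ‖w‖ * (n * M) * (L * ‖Du z‖ ^ (p - 1)) := by
    filter_upwards [h.growth] with z hz
    exact (hpair _ z).trans (mul_le_mul_of_nonneg_left (hz _ _) (by positivity))
  have hY : IntegrableOn (fun z => χ z.2 * ∑ i, ∑ j, A z (u z) (Du z) (i, j)
      * (w i * fderiv ℝ η z.1 (EuclideanSpace.single j 1))) Q :=
    ((hDup.const_mul L).const_mul _).mono' (hpairm _ h.aestronglyMeasurable_field) hYb
  have hFn : ∀ z, ‖‖F z‖ ^ (p - 2) • F z‖ = ‖F z‖ ^ (p - 1) := by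
    intro z
    rw [norm_smul, Real.norm_of_nonneg (by positivity)]
    rcases eq_or_ne (F z) 0 with h0 | h0
    · rw [h0, norm_zero, mul_zero, Real.zero_rpow (by linarith)]
    · rw [← Real.rpow_add_one (norm_ne_zero_iff.2 h0)]
      ring_nf
  have hZb : ∀ z, ‖χ z.2 * ∑ i, ∑ j, (‖F z‖ ^ (p - 2) • F z) (i, j)
      * (w i * fderiv ℝ η z.1 (EuclideanSpace.single j 1))‖
      ≤ ‖w‖ * (n * M) * ‖F z‖ ^ (p - 1) := fun z => by
    rw [← hFn z]
    exact hpair _ z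
  have hZ : IntegrableOn (fun z => χ z.2 * ∑ i, ∑ j, (‖F z‖ ^ (p - 2) • F z) (i, j)
      * (w i * fderiv ℝ η z.1 (EuclideanSpace.single j 1))) Q :=
    (hFp.const_mul _).mono' (hpairm _ (((h.measF.norm.pow_const _).smul h.measF)
      |>.aestronglyMeasurable)) (ae_of_all _ hZb)
  have hX : IntegrableOn (fun z => deriv χ z.2
      * (η z.1 * (inner ℝ w (pw (p - 1) (u z)) : ℝ))) Q := by
    refine (hup.const_mul (M₁ * (M₂ * ‖w‖))).mono' ?_ (ae_of_all _ fun z => ?_)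
    · have h1 : Measurable fun z => pw (p - 1) (u z) := (measurable_pw _).comp h.measu
      have h2 := hχ'.measurable
      have h3 := hη.continuous.measurable
      exact Measurable.aestronglyMeasurable (by fun_prop)
    · rw [norm_mul, norm_mul, mul_assoc, mul_assoc]
      have h1 := norm_inner_le_norm (𝕜 := ℝ) w (pw (p - 1) (u z))
      rw [norm_pw (by linarith)] at h1
      have h4 : 0 ≤ M₂ := (norm_nonneg _).trans (hM₂ z.1)
      exact mul_le_mul (hM₁ _) (mul_le_mul (hM₂ _) h1 (norm_nonneg _) h4) (by positivity)
        ((norm_nonneg _).trans (hM₁ z.2))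
  have hXeq : ∀ z, ‖u z‖ ^ (p - 2) * (inner ℝ (u z) ((η z.1 * deriv χ z.2) • w) : ℝ)
      = deriv χ z.2 * (η z.1 * (inner ℝ w (pw (p - 1) (u z)) : ℝ)) := by
    intro z
    rw [pw, inner_smul_right, inner_smul_right, real_inner_comm,
      show p - 1 - 1 = p - 2 by ring]
    ring
  simp only [tderiv_mul_smul hχ, gradPair_mul_smul hη, hXeq] at hw
  have hZeq : ∀ z, ‖F z‖ ^ (p - 2) * (χ z.2 * ∑ i, ∑ j, F z (i, j)
      * (w i * fderiv ℝ η z.1 (EuclideanSpace.single j 1)))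
      = χ z.2 * ∑ i, ∑ j, (‖F z‖ ^ (p - 2) • F z) (i, j)
      * (w i * fderiv ℝ η z.1 (EuclideanSpace.single j 1)) := by
    intro z
    simp only [PiLp.smul_apply, smul_eq_mul, Finset.mul_sum]
    refine Finset.sum_congr rfl fun i _ => Finset.sum_congr rfl fun j _ => ?_
    ring
  simp only [hZeq] at hw
  rw [integral_sub hX hY, sub_eq_iff_eq_add, ← integral_add hZ hY] at hw
  have hz0 : ∀ z ∈ Q \ (B ×ˢ I), deriv χ z.2 = 0 ∧ χ z.2 = 0 ∨
      η z.1 = 0 ∧ fderiv ℝ η z.1 = 0 := by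
    intro z hz
    by_cases hz1 : z.1 ∈ B
    · have hz2 : z.2 ∉ I := fun h2 => hz.2 ⟨hz1, h2⟩
      exact Or.inl ⟨image_eq_zero_of_notMem_tsupport
        fun h => hz2 (hχI (closure_minimal (support_deriv_subset) (isClosed_tsupport _) h)),
        image_eq_zero_of_notMem_tsupport fun h => hz2 (hχI h)⟩
    · exact Or.inr ⟨image_eq_zero_of_notMem_tsupport fun h => hz1 (hηB h),
        image_eq_zero_of_notMem_tsupport fun h => hz1 (hηB (tsupport_fderiv_subset ℝ h))⟩
  rw [setIntegral_eq_of_subset_of_forall_sdiff_eq_zero hQm hBΩ,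
    setIntegral_eq_of_subset_of_forall_sdiff_eq_zero hQm hBΩ] at hw
  · rw [hw, ← Real.norm_eq_abs, ← integral_const_mul]
    refine norm_integral_le_of_norm_le ?_ ?_
    · exact (IntegrableOn.mono_set ((hDup.const_mul L).add hFp) hBΩ).const_mul _
    · filter_upwards [ae_restrict_of_ae_restrict_of_subset hBΩ hYb] with z hz
      refine (norm_add_le _ _).trans ?_
      have := hZb z
      rw [mul_add]
      linarith
  · intro z hz
    rcases hz0 z hz with h1 | h1 <;> simp [h1.2]
  · intro z hz
    rcases hz0 z hz with h1 | h1 <;> simp [h1.1]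

end WeakSolution

namespace WeakSolution

variable {p ν L T : ℝ} {Ω : Set (Spc n)} {A : Spc n × ℝ → Vec N → Mat N n → Mat N n}
  {F : Spc n × ℝ → Mat N n} {u : Spc n × ℝ → Vec N} {Du : Spc n × ℝ → Mat N n}

/-- Gluing lemma: weighted spatial means of `|u|^{p-2}u` vary little in time. -/
theorem ae_norm_weighted_mean_sub_le (h : WeakSolution p ν L T Ω A F u Du) (hp : 1 < p)
    {B : Set (Spc n)} {a b : ℝ} (hBΩ : B ×ˢ Ioo a b ⊆ Ω ×ˢ Ioo 0 T)
    {η : Spc n → ℝ} (hη : ContDiff ℝ (⊤ : ℕ∞) η) (hηc : HasCompactSupport η)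
    (hηB : tsupport η ⊆ B) {M : ℝ} (hM0 : 0 ≤ M) (hM : ∀ x, ‖fderiv ℝ η x‖ ≤ M) :
    ∀ᵐ s ∂(volume.restrict (Ioo a b)), ∀ᵐ t ∂(volume.restrict (Ioo a b)),
      ‖(∫ x in B, η x • pw (p - 1) (u (x, t))) - ∫ x in B, η x • pw (p - 1) (u (x, s))‖
        ≤ n * M * ∫ z in B ×ˢ Ioo a b, (L * ‖Du z‖ ^ (p - 1) + ‖F z‖ ^ (p - 1)) := by
  have := h.isFiniteMeasure
  set I := Ioo a b with hI
  have hIm : MeasurableSet I := measurableSet_Ioo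
  obtain ⟨J, hJ⟩ : ∃ J, J = ∫ z in B ×ˢ I, (L * ‖Du z‖ ^ (p - 1) + ‖F z‖ ^ (p - 1)) := ⟨_, rfl⟩
  rw [← hJ]
  obtain ⟨m, hm⟩ : ∃ m : ℝ → Vec N, m = fun t => ∫ x in B, η x • pw (p - 1) (u (x, t)) :=
    ⟨_, rfl⟩
  have hmt : ∀ t, ∫ x in B, η x • pw (p - 1) (u (x, t)) = m t := fun t => by rw [hm]
  simp only [hmt]
  obtain ⟨M₂, hM₂⟩ := hηc.exists_bound_of_continuous hη.continuous
  have hup : IntegrableOn (fun z => ‖u z‖ ^ (p - 1)) (Ω ×ˢ Ioo 0 T) :=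
    integrable_norm_rpow_of_memLp (by linarith) (by linarith) (by linarith) h.memLp_u
  have hpwm : Measurable fun z => pw (p - 1) (u z) := (measurable_pw _).comp h.measu
  have hηm := hη.continuous.measurable
  have hU : Integrable (fun z : Spc n × ℝ => η z.1 • pw (p - 1) (u z))
      ((volume.restrict B).prod (volume.restrict I)) := by
    rw [Measure.prod_restrict, ← Measure.volume_eq_prod]
    refine IntegrableOn.mono_set (t := Ω ×ˢ Ioo 0 T) ?_ hBΩ
    refine (hup.const_mul M₂).mono' (Measurable.aestronglyMeasurable (by fun_prop))
      (ae_of_all _ fun z => ?_)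
    rw [norm_smul, norm_pw (by linarith)]
    exact mul_le_mul_of_nonneg_right (hM₂ _) (by positivity)
  have hmi : Integrable m (volume.restrict I) := by
    rw [hm]
    exact hU.integral_prod_right
  have hmIi : Integrable (I.indicator m) := (integrable_indicator_iff hIm).2 hmi
  have h1pos : (0 : ℝ) < 1 := one_pos
  let φ : ℕ → ContDiffBump (0 : ℝ) := mollBump h1pos
  have hconv : ∀ᵐ x, Tendsto (fun k => (MeasureTheory.convolution ((φ k).normed volume)
      (I.indicator m) (ContinuousLinearMap.lsmul ℝ ℝ) volume) x) atTop
        (𝓝 (I.indicator m x)) :=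
    ContDiffBump.ae_convolution_tendsto_right_of_locallyIntegrable (K := 2)
      (tendsto_rOut_mollBump h1pos) (Eventually.of_forall fun k => rOut_mollBump_le h1pos k)
      hmIi.locallyIntegrable
  have hconvI := ae_restrict_of_ae (s := I) hconv
  filter_upwards [hconvI, ae_restrict_mem hIm] with s hs hsI
  filter_upwards [hconvI, ae_restrict_mem hIm] with t ht htI
  rw [norm_sub_rev]
  obtain ⟨w, hw⟩ : ∃ w, w = m s - m t := ⟨_, rfl⟩
  have hlim : Tendsto (fun k => |(inner ℝ w
      ((MeasureTheory.convolution ((φ k).normed volume) (I.indicator m)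
        (ContinuousLinearMap.lsmul ℝ ℝ) volume) s - (MeasureTheory.convolution
          ((φ k).normed volume) (I.indicator m) (ContinuousLinearMap.lsmul ℝ ℝ) volume) t) : ℝ)|)
      atTop (𝓝 |(inner ℝ w (m s - m t) : ℝ)|) := by
    rw [indicator_of_mem hsI] at hs
    rw [indicator_of_mem htI] at ht
    exact (tendsto_const_nhds.inner (hs.sub ht)).abs
  have hpairing : ∀ k s, (inner ℝ w ((MeasureTheory.convolution ((φ k).normed volume)
      (I.indicator m) (ContinuousLinearMap.lsmul ℝ ℝ) volume) s) : ℝ)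
      = ∫ τ in I, (φ k).normed volume (s - τ) * (inner ℝ w (m τ) : ℝ) := by
    intro k s
    have hi := ((φ k).hasCompactSupport_normed (μ := volume)).convolutionExists_left
      (ContinuousLinearMap.lsmul ℝ ℝ) (φ k).continuous_normed hmIi.locallyIntegrable s
    rw [MeasureTheory.convolution_eq_swap, ← integral_inner hi.integrable_swap,
      ← integral_indicator hIm]
    refine integral_congr_ae (ae_of_all _ fun τ => ?_)
    by_cases hτ : τ ∈ I <;> simp [hτ, inner_smul_right]
  have hmw : Integrable (fun τ => (inner ℝ w (m τ) : ℝ)) (volume.restrict I) :=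
    hmi.const_inner w
  have hbound : ∀ᶠ k in atTop, |(inner ℝ w
      ((MeasureTheory.convolution ((φ k).normed volume) (I.indicator m)
        (ContinuousLinearMap.lsmul ℝ ℝ) volume) s - (MeasureTheory.convolution
          ((φ k).normed volume) (I.indicator m) (ContinuousLinearMap.lsmul ℝ ℝ) volume) t) : ℝ)|
      ≤ ‖w‖ * (n * M) * J := by
    have hr := tendsto_rOut_mollBump (E := ℝ) h1pos
    filter_upwards [hr.eventually (gt_mem_nhds (sub_pos.2 hsI.1)),
      hr.eventually (gt_mem_nhds (sub_pos.2 hsI.2)),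
      hr.eventually (gt_mem_nhds (sub_pos.2 htI.1)),
      hr.eventually (gt_mem_nhds (sub_pos.2 htI.2))] with k k1 k2 k3 k4
    obtain ⟨χ, hχ, hχc, hχI, hχ1, hχd⟩ := exists_cutoff_deriv_eq (φ k) (a := a) (b := b)
      (s := s) (t := t) (by simp only [φ]; linarith) (by simp only [φ]; linarith)
      (by simp only [φ]; linarith) (by simp only [φ]; linarith)
    have hmain := h.abs_integral_deriv_mul_inner_le hp hBΩ hη hηc hηB hM0 hM hχ hχc hχI hχ1 w
    rw [← hJ] at hmain
    refine le_trans (le_of_eq (congrArg _ ?_)) hmain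
    have hχ' : Continuous (deriv χ) := hχ.continuous_deriv (by simp)
    obtain ⟨M₁, hM₁⟩ := hχc.deriv.exists_bound_of_continuous hχ'
    have hUw : Integrable (fun z : Spc n × ℝ => deriv χ z.2
        * (η z.1 * (inner ℝ w (pw (p - 1) (u z)) : ℝ)))
        ((volume.restrict B).prod (volume.restrict I)) := by
      have h1 : Integrable (fun z : Spc n × ℝ => η z.1 * (inner ℝ w (pw (p - 1) (u z)) : ℝ))
        ((volume.restrict B).prod (volume.restrict I)) := by
        refine (hU.const_inner (𝕜 := ℝ) w).congr (ae_of_all _ fun z => ?_)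
        simp [inner_smul_right]
      exact h1.bdd_mul (hχ'.comp continuous_snd).aestronglyMeasurable
        (ae_of_all _ fun z => hM₁ z.2)
    rw [Measure.volume_eq_prod, ← Measure.prod_restrict, integral_prod_symm _ hUw,
      inner_sub_right, hpairing, hpairing]
    have hφb : ∀ s, Integrable (fun τ => (φ k).normed volume (s - τ) * (inner ℝ w (m τ) : ℝ))
        (volume.restrict I) := by
      intro s
      obtain ⟨M₃, hM₃⟩ := ((φ k).hasCompactSupport_normed (μ := volume)).exists_bound_of_continuous
        (φ k).continuous_normed
      have hc := (φ k).continuous_normed (μ := volume)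
      exact hmw.bdd_mul (Continuous.aestronglyMeasurable (by fun_prop))
        (ae_of_all _ fun τ => hM₃ (s - τ))
    rw [← integral_sub (hφb s) (hφb t)]
    refine integral_congr_ae ?_
    filter_upwards [hU.prod_left_ae] with τ hτ
    simp only [integral_const_mul]
    rw [hχd, hm]
    simp only
    rw [← integral_inner hτ, ← sub_mul]
    simp only [inner_smul_right]
  have hfin := le_of_tendsto hlim hbound
  rw [← hw, real_inner_self_eq_norm_sq, abs_of_nonneg (sq_nonneg _)] at hfin
  rw [← hw]
  rcases (norm_nonneg w).eq_or_lt with h0 | h0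
  · rw [← h0]
    have hJ0 : 0 ≤ J := by
      rw [hJ]
      have hL : 0 ≤ L := h.hν.le.trans h.hνL
      exact integral_nonneg fun z => by positivity
    positivity
  · have : ‖w‖ * ‖w‖ ≤ ‖w‖ * (n * M * J) := by nlinarith
    exact le_of_mul_le_mul_left this h0

end WeakSolution

/-- Normalized restriction of Lebesgue measure to a set; integrals against it are averages. -/
def avgMeasure {X : Type*} [MeasureSpace X] (s : Set X) : Measure X :=
  (volume s)⁻¹ • volume.restrict s

section avgMeasure

variable {X Y : Type*} [MeasureSpace X] [MeasureSpace Y] {s : Set X}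

theorem setAverage_eq_integral_avgMeasure {E : Type*} [NormedAddCommGroup E] [NormedSpace ℝ E]
    (f : X → E) : ⨍ x in s, f x = ∫ x, f x ∂(avgMeasure s) := by
  rw [avgMeasure, setAverage_eq']

theorem integral_avgMeasure {E : Type*} [NormedAddCommGroup E] [NormedSpace ℝ E] (f : X → E) :
    ∫ x, f x ∂(avgMeasure s) = (volume.real s)⁻¹ • ∫ x in s, f x := by
  rw [← setAverage_eq_integral_avgMeasure, setAverage_eq]

theorem isProbabilityMeasure_avgMeasure (h0 : volume s ≠ 0) (hs : volume s ≠ ∞) :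
    IsProbabilityMeasure (avgMeasure s) :=
  ⟨by simp [avgMeasure, ENNReal.inv_mul_cancel h0 hs]⟩

theorem avgMeasure_absolutelyContinuous : avgMeasure s ≪ volume.restrict s :=
  Measure.smul_absolutelyContinuous

theorem MeasureTheory.Integrable.avgMeasure {E : Type*} [NormedAddCommGroup E] {f : X → E}
    (hf : Integrable f (volume.restrict s)) (h0 : volume s ≠ 0) : Integrable f (avgMeasure s) :=
  hf.smul_measure (ENNReal.inv_ne_top.2 h0)

theorem avgMeasure_prod [SFinite (volume : Measure X)] [SFinite (volume : Measure Y)] {t : Set Y}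
    (h0 : volume s ≠ 0) (hs : volume s ≠ ∞) :
    avgMeasure (s ×ˢ t) = (avgMeasure s).prod (avgMeasure t) := by
  rw [avgMeasure, avgMeasure, avgMeasure, Measure.prod_smul_left, Measure.prod_smul_right,
    Measure.prod_restrict, smul_smul, ← Measure.volume_eq_prod, Measure.volume_eq_prod,
    Measure.prod_prod, ENNReal.mul_inv (Or.inl h0) (Or.inl hs)]

end avgMeasure

theorem volume_ball_ne_zero (x₀ : Spc n) {ρ : ℝ} (hρ : 0 < ρ) : volume (Metric.ball x₀ ρ) ≠ 0 :=
  (Metric.measure_ball_pos _ _ hρ).ne'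

theorem volume_ball_ne_top (x₀ : Spc n) (ρ : ℝ) : volume (Metric.ball x₀ ρ) ≠ ∞ :=
  measure_ball_lt_top.ne

theorem volume_ball_eq_mul (x₀ : Spc n) {ρ : ℝ} (hρ : 0 < ρ) :
    volume (Metric.ball x₀ ρ) = ENNReal.ofReal (ρ ^ n) * volume (Metric.ball (0 : Spc n) 1) := by
  rw [Measure.addHaar_ball_of_pos volume x₀ hρ, finrank_euclideanSpace_fin]

/-- Smooth weights concentrated in a ball, with uniform bounds. -/
theorem exists_weight_ball (n : ℕ) : ∃ C₀ M : ℝ, 0 ≤ M ∧ ∀ (x₀ : Spc n) {ρ : ℝ}, 0 < ρ →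
    ∃ η : Spc n → ℝ, ContDiff ℝ (⊤ : ℕ∞) η ∧ HasCompactSupport η ∧
      tsupport η ⊆ Metric.ball x₀ ρ ∧ (∀ x, ‖fderiv ℝ η x‖ ≤ M / ρ) ∧
      IsWeight (avgMeasure (Metric.ball x₀ ρ)) C₀ η := by
  obtain ⟨ψ, hψ⟩ : ∃ ψ : ContDiffBump (0 : Spc n), ψ.rOut = 1 / 2 :=
    ⟨⟨1 / 4, 1 / 2, by norm_num, by norm_num⟩, rfl⟩
  obtain ⟨ω, hω⟩ : ∃ ω, ω = volume.real (Metric.ball (0 : Spc n) 1) := ⟨_, rfl⟩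
  have hω0 : 0 < ω := hω ▸ ENNReal.toReal_pos (volume_ball_ne_zero 0 one_pos)
    (volume_ball_ne_top 0 1)
  obtain ⟨g, hg⟩ : ∃ g : Spc n → ℝ, g = fun x => ω * ψ.normed volume x := ⟨_, rfl⟩
  have hgc : ContDiff ℝ (⊤ : ℕ∞) g := by
    rw [hg]; exact contDiff_const.mul ψ.contDiff_normed
  have hgs : HasCompactSupport g := by rw [hg]; exact ψ.hasCompactSupport_normed.mul_left
  have hgt : tsupport g ⊆ Metric.closedBall 0 (1 / 2) := by
    rw [hg, ← hψ, ← ψ.tsupport_normed_eq (μ := volume)]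
    exact tsupport_mul_subset_right
  have hgi : ∫ x, g x = ω := by
    rw [hg, integral_const_mul, ψ.integral_normed, mul_one]
  obtain ⟨C₀, hC₀⟩ := hgc.continuous.bounded_above_of_compact_support hgs
  obtain ⟨M, hM⟩ := (hgc.continuous_fderiv (by simp)).bounded_above_of_compact_support
    (hgs.fderiv (𝕜 := ℝ))
  refine ⟨C₀, M, (norm_nonneg _).trans (hM 0), fun x₀ ρ hρ => ?_⟩
  obtain ⟨η, hη⟩ : ∃ η : Spc n → ℝ, η = fun x => g (ρ⁻¹ • (x - x₀)) := ⟨_, rfl⟩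
  have hρi : 0 < ρ⁻¹ := inv_pos.2 hρ
  have hηt : tsupport η ⊆ Metric.closedBall x₀ (ρ / 2) := by
    refine closure_minimal (fun x hx => ?_) Metric.isClosed_closedBall
    have h1 : ρ⁻¹ • (x - x₀) ∈ Metric.closedBall (0 : Spc n) (1 / 2) :=
      hgt (subset_closure (by rw [hη] at hx; exact hx))
    rw [mem_closedBall_zero_iff, norm_smul, Real.norm_of_nonneg hρi.le, inv_mul_le_iff₀ hρ] at h1
    rw [mem_closedBall_iff_norm]; linarith
  have hηB : tsupport η ⊆ Metric.ball x₀ ρ :=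
    hηt.trans (Metric.closedBall_subset_ball (by linarith))
  have hηc : ContDiff ℝ (⊤ : ℕ∞) η := by
    rw [hη]; exact hgc.comp ((contDiff_id.sub contDiff_const).const_smul _)
  refine ⟨η, hηc, (isCompact_closedBall x₀ (ρ / 2)).of_isClosed_subset (isClosed_tsupport _) hηt,
    hηB, fun x => ?_, hηc.continuous.measurable, fun x => ?_, fun x => ?_, ?_⟩
  · have h1 : HasFDerivAt (fun x : Spc n => ρ⁻¹ • (x - x₀))
        (ρ⁻¹ • ContinuousLinearMap.id ℝ (Spc n)) x :=
      ((hasFDerivAt_id x).sub_const x₀).const_smul ρ⁻¹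
    have h2 := ((hgc.differentiable (by simp)) (ρ⁻¹ • (x - x₀))).hasFDerivAt.comp x h1
    have h3 : fderiv ℝ η x = ρ⁻¹ • fderiv ℝ g (ρ⁻¹ • (x - x₀)) := by
      rw [hη]; refine h2.fderiv.trans ?_; ext y; simp
    rw [h3, norm_smul, Real.norm_of_nonneg hρi.le, div_eq_inv_mul]
    exact mul_le_mul_of_nonneg_left (hM _) hρi.le
  · rw [hη, hg]; exact mul_nonneg hω0.le (ψ.nonneg_normed _)
  · rw [hη]; exact (le_abs_self _).trans (hC₀ _)
  · rw [integral_avgMeasure, setIntegral_eq_integral_of_forall_compl_eq_zero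
      (fun x hx => image_eq_zero_of_notMem_tsupport (fun h => hx (hηB h)))]
    have h1 : ∫ x, η x = ρ ^ n * ω := by
      rw [hη, integral_sub_right_eq_self (fun x => g (ρ⁻¹ • x)) x₀,
        Measure.integral_comp_inv_smul_of_nonneg volume g hρ.le, hgi, finrank_euclideanSpace_fin,
        smul_eq_mul]
    have h2 : volume.real (Metric.ball x₀ ρ) = ρ ^ n * ω := by
      rw [measureReal_def, volume_ball_eq_mul x₀ hρ, ENNReal.toReal_mul,
        ENNReal.toReal_ofReal (by positivity), hω, measureReal_def]
    rw [h1, h2, smul_eq_mul, inv_mul_cancel₀ (by positivity)]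

theorem lintegral_avgMeasure {X : Type*} [MeasureSpace X] {s : Set X} (f : X → ℝ≥0∞) :
    ∫⁻ x, f x ∂(avgMeasure s) = (volume s)⁻¹ * ∫⁻ x in s, f x := by
  rw [avgMeasure, lintegral_smul_measure, smul_eq_mul]

/-- Sobolev–Poincaré bound for ball averages from the double integral form. -/
theorem exists_integrable_sub_sq_le {q : ℝ} (hq : 1 ≤ q) {C : ℝ≥0∞} (hC : C ≠ ∞) :
    ∃ C₁ : ℝ, 1 ≤ C₁ ∧ ∀ {N : ℕ} {E : Type} [NormedAddCommGroup E] {f : Spc n → Vec N}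
      {G : Spc n → E} {x₀ : Spc n} {ρ μ : ℝ}, Measurable f → 0 < ρ → 0 < μ →
      Integrable (fun x => ‖G x‖ ^ q) (avgMeasure (Metric.ball x₀ ρ)) →
      ∫⁻ x in Metric.ball x₀ ρ, ∫⁻ y in Metric.ball x₀ ρ, ‖f x - f y‖ₑ ^ 2
        ≤ C * ENNReal.ofReal ρ ^ (2 * (n : ℝ) + 2 - 2 * n / q)
          * (∫⁻ x in Metric.ball x₀ ρ, ‖G x‖ₑ ^ q) ^ (2 / q) →
      ∃ b : Vec N,
        Integrable (fun x => ‖(μ * ρ)⁻¹ • f x - b‖ ^ 2) (avgMeasure (Metric.ball x₀ ρ)) ∧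
        μ ^ 2 * ∫ x, ‖(μ * ρ)⁻¹ • f x - b‖ ^ 2 ∂(avgMeasure (Metric.ball x₀ ρ))
          ≤ C₁ * ((∫ x, ‖G x‖ ^ q ∂(avgMeasure (Metric.ball x₀ ρ))) ^ (1 / q)) ^ 2 := by
  have hq0 : 0 < q := by linarith
  obtain ⟨V, hV⟩ : ∃ V, V = volume (Metric.ball (0 : Spc n) 1) := ⟨_, rfl⟩
  have hV0 : V ≠ 0 := hV ▸ volume_ball_ne_zero 0 one_pos
  have hVt : V ≠ ∞ := hV ▸ volume_ball_ne_top 0 1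
  obtain ⟨D, hD⟩ : ∃ D, D = C * V ^ (2 / q - 2) := ⟨_, rfl⟩
  have hDt : D ≠ ∞ := hD ▸ ENNReal.mul_ne_top hC (ENNReal.rpow_ne_top_of_ne_zero hV0 hVt)
  refine ⟨max 1 D.toReal, le_max_left _ _, ?_⟩
  intro N E _ f G x₀ ρ μ hf hρ hμ hG hfG
  obtain ⟨B, hB⟩ : ∃ B, B = Metric.ball x₀ ρ := ⟨_, rfl⟩
  rw [← hB] at hG hfG ⊢
  have hB0 : volume B ≠ 0 := hB ▸ volume_ball_ne_zero x₀ hρ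
  have hBt : volume B ≠ ∞ := hB ▸ volume_ball_ne_top x₀ ρ
  have hP : IsProbabilityMeasure (avgMeasure B) := isProbabilityMeasure_avgMeasure hB0 hBt
  obtain ⟨j, hj⟩ : ∃ j, j = ∫ x, ‖G x‖ ^ q ∂(avgMeasure B) := ⟨_, rfl⟩
  have hj0 : 0 ≤ j := hj ▸ integral_nonneg fun x => Real.rpow_nonneg (norm_nonneg _) _
  have hjl : ∫⁻ x in B, ‖G x‖ₑ ^ q = volume B * ENNReal.ofReal j := by
    rw [hj, ofReal_integral_eq_lintegral_ofReal hG
      (Eventually.of_forall fun x => Real.rpow_nonneg (norm_nonneg _) _), lintegral_avgMeasure,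
      ← mul_assoc, ENNReal.mul_inv_cancel hB0 hBt, one_mul]
    refine lintegral_congr fun x => ?_
    rw [← ofReal_norm, ENNReal.ofReal_rpow_of_nonneg (norm_nonneg _) hq0.le]
  have hVB : volume B = ENNReal.ofReal ρ ^ (n : ℝ) * V := by
    rw [hB, volume_ball_eq_mul x₀ hρ, hV, ENNReal.rpow_natCast, ENNReal.ofReal_pow hρ.le]
  have hρ0 : ENNReal.ofReal ρ ≠ 0 := by simpa using hρ
  have hbd : ∫⁻ x, ∫⁻ y, ‖f x - f y‖ₑ ^ 2 ∂(avgMeasure B) ∂(avgMeasure B)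
      ≤ ENNReal.ofReal (D.toReal * ρ ^ 2 * j ^ (2 / q)) := by
    have h1 : (volume B)⁻¹ * ((volume B)⁻¹ * volume B ^ (2 / q)) = volume B ^ (2 / q - 2) := by
      rw [← ENNReal.rpow_neg_one, ← ENNReal.rpow_add _ _ hB0 hBt,
        ← ENNReal.rpow_add _ _ hB0 hBt]
      congr 1; ring
    have h2 : volume B ^ (2 / q - 2) * ENNReal.ofReal ρ ^ (2 * (n : ℝ) + 2 - 2 * n / q)
        = V ^ (2 / q - 2) * ENNReal.ofReal ρ ^ 2 := by
      rw [hVB, ENNReal.mul_rpow_of_ne_top (ENNReal.rpow_ne_top_of_nonneg (by positivity)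
        ENNReal.ofReal_ne_top) hVt, ← ENNReal.rpow_mul, mul_right_comm,
        ← ENNReal.rpow_add _ _ hρ0 ENNReal.ofReal_ne_top, mul_comm, ← ENNReal.rpow_natCast]
      congr 2; push_cast; field_simp; ring
    rw [lintegral_avgMeasure]
    simp_rw [lintegral_avgMeasure]
    rw [lintegral_const_mul' _ _ (ENNReal.inv_ne_top.2 hB0)]
    calc _ ≤ (volume B)⁻¹ * ((volume B)⁻¹ *
          (C * ENNReal.ofReal ρ ^ (2 * (n : ℝ) + 2 - 2 * n / q)
          * (volume B ^ (2 / q) * ENNReal.ofReal j ^ (2 / q)))) := by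
          rw [← ENNReal.mul_rpow_of_nonneg _ _ (by positivity : 0 ≤ 2 / q), ← hjl]
          gcongr
      _ = C * (((volume B)⁻¹ * ((volume B)⁻¹ * volume B ^ (2 / q)))
          * ENNReal.ofReal ρ ^ (2 * (n : ℝ) + 2 - 2 * n / q)) * ENNReal.ofReal j ^ (2 / q) := by
          ring
      _ = D * ENNReal.ofReal ρ ^ 2 * ENNReal.ofReal j ^ (2 / q) := by rw [h1, h2, hD]; ring
      _ = _ := by
          rw [ENNReal.ofReal_mul (by positivity), ENNReal.ofReal_mul ENNReal.toReal_nonneg,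
            ENNReal.ofReal_toReal hDt, ENNReal.ofReal_pow hρ.le,
            ENNReal.ofReal_rpow_of_nonneg hj0 (by positivity)]
  have hmeas : Measurable fun x => ∫⁻ y, ‖f x - f y‖ₑ ^ 2 ∂(avgMeasure B) := by
    apply Measurable.lintegral_prod_right (f := fun x y : Spc n => ‖f x - f y‖ₑ ^ 2)
    exact ((hf.comp measurable_fst).sub (hf.comp measurable_snd)).enorm.pow_const 2
  obtain ⟨x₁, hx₁⟩ := exists_le_lintegral (μ := avgMeasure B) hmeas.aemeasurable
  have hx₂ := hx₁.trans hbd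
  have hm2 : Measurable fun y => ‖f y - f x₁‖ ^ 2 := (hf.sub_const _).norm.pow_const 2
  have hl : ∫⁻ y, ENNReal.ofReal (‖f y - f x₁‖ ^ 2) ∂(avgMeasure B)
      ≤ ENNReal.ofReal (D.toReal * ρ ^ 2 * j ^ (2 / q)) := by
    refine le_trans (le_of_eq (lintegral_congr fun y => ?_)) hx₂
    rw [ENNReal.ofReal_pow (norm_nonneg _), ofReal_norm, enorm_sub_rev]
  have h_int : Integrable (fun y => ‖f y - f x₁‖ ^ 2) (avgMeasure B) := by
    refine ⟨hm2.aestronglyMeasurable, ?_⟩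
    rw [hasFiniteIntegral_iff_ofReal (Eventually.of_forall fun y => sq_nonneg _)]
    exact hl.trans_lt ENNReal.ofReal_lt_top
  have hR : ∫ y, ‖f y - f x₁‖ ^ 2 ∂(avgMeasure B) ≤ D.toReal * ρ ^ 2 * j ^ (2 / q) := by
    rw [← ENNReal.ofReal_le_ofReal_iff (by positivity), ofReal_integral_eq_lintegral_ofReal h_int
      (Eventually.of_forall fun y => sq_nonneg _)]
    exact hl
  have hsc : ∀ y, ‖(μ * ρ)⁻¹ • f y - (μ * ρ)⁻¹ • f x₁‖ ^ 2
      = ((μ * ρ)⁻¹) ^ 2 * ‖f y - f x₁‖ ^ 2 := fun y => by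
    rw [← smul_sub, norm_smul, mul_pow, Real.norm_of_nonneg (by positivity)]
  refine ⟨(μ * ρ)⁻¹ • f x₁, ?_, ?_⟩
  · simp_rw [hsc]; exact h_int.const_mul _
  · simp_rw [hsc]
    rw [integral_const_mul, ← hj, ← Real.rpow_natCast (j ^ (1 / q)), ← Real.rpow_mul hj0]
    have he : 1 / q * ((2 : ℕ) : ℝ) = 2 / q := by push_cast; ring
    rw [he]
    have hjq : 0 ≤ j ^ (2 / q) := Real.rpow_nonneg hj0 _
    calc _ ≤ μ ^ 2 * ((μ * ρ)⁻¹ ^ 2 * (D.toReal * ρ ^ 2 * j ^ (2 / q))) := by gcongr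
      _ = D.toReal * j ^ (2 / q) := by field_simp
      _ ≤ _ := mul_le_mul_of_nonneg_right (le_max_right _ _) hjq

theorem wmean_const_smul {B : Set (Spc n)} {η : Spc n → ℝ} {p r : ℝ} (hr : 0 < r)
    (f : Spc n → Vec N) : wmean (avgMeasure B) η p (fun x => r • f x)
      = (r ^ (p - 1) * (volume.real B)⁻¹) • ∫ x in B, η x • pw (p - 1) (f x) := by
  rw [wmean, integral_avgMeasure, mul_comm, mul_smul]
  congr 1
  rw [← integral_smul]
  congr 1
  funext x
  rw [pw_smul hr, smul_comm]

namespace WeakSolution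

variable {p ν L T : ℝ} {Ω : Set (Spc n)} {A : Spc n × ℝ → Vec N → Mat N n → Mat N n}
  {F : Spc n × ℝ → Mat N n} {u : Spc n × ℝ → Vec N} {Du : Spc n × ℝ → Mat N n}

/-- Gluing lemma on a cylinder, in scale-invariant form. -/
theorem ae_norm_wmean_sub_le (h : WeakSolution p ν L T Ω A F u Du) (hp : 1 < p)
    {x₀ : Spc n} {t₀ ρ μ τ : ℝ} (hρ : 0 < ρ) (hμ : 0 < μ) (hτ : τ = μ ^ (p - 2) * ρ ^ p)
    (hBΩ : Metric.ball x₀ ρ ×ˢ Ioo (t₀ - τ) (t₀ + τ) ⊆ Ω ×ˢ Ioo 0 T)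
    {η : Spc n → ℝ} (hη : ContDiff ℝ (⊤ : ℕ∞) η) (hηc : HasCompactSupport η)
    (hηB : tsupport η ⊆ Metric.ball x₀ ρ) {M : ℝ} (hM0 : 0 ≤ M)
    (hM : ∀ x, ‖fderiv ℝ η x‖ ≤ M / ρ) :
    ∀ᵐ s ∂(avgMeasure (Ioo (t₀ - τ) (t₀ + τ))), ∀ᵐ t ∂(avgMeasure (Ioo (t₀ - τ) (t₀ + τ))),
      μ * ‖wmean (avgMeasure (Metric.ball x₀ ρ)) η p (fun x => (μ * ρ)⁻¹ • u (x, t))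
          - wmean (avgMeasure (Metric.ball x₀ ρ)) η p (fun x => (μ * ρ)⁻¹ • u (x, s))‖
        ≤ 2 * n * M * max L 1 * ∫ z, (‖Du z‖ ^ (p - 1) + ‖F z‖ ^ (p - 1))
          ∂(avgMeasure (Metric.ball x₀ ρ ×ˢ Ioo (t₀ - τ) (t₀ + τ))) := by
  have hfin := h.isFiniteMeasure
  have hp0 : 0 < p := by linarith
  have hτ0 : 0 < τ := hτ ▸ by positivity
  have hglue := h.ae_norm_weighted_mean_sub_le hp hBΩ hη hηc hηB (by positivity : 0 ≤ M / ρ) hM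
  filter_upwards [avgMeasure_absolutelyContinuous.ae_le hglue] with s hs
  filter_upwards [avgMeasure_absolutelyContinuous.ae_le hs] with t ht
  rw [wmean_const_smul (by positivity), wmean_const_smul (by positivity), ← smul_sub, norm_smul]
  obtain ⟨B, hB⟩ : ∃ B, B = Metric.ball x₀ ρ := ⟨_, rfl⟩
  obtain ⟨I, hI⟩ : ∃ I, I = Ioo (t₀ - τ) (t₀ + τ) := ⟨_, rfl⟩
  have hV : 0 < volume.real B := hB ▸ ENNReal.toReal_pos (volume_ball_ne_zero x₀ hρ)
    (volume_ball_ne_top x₀ ρ)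
  have hQ : volume.real (B ×ˢ I) = volume.real B * (2 * τ) := by
    rw [measureReal_def, Measure.volume_eq_prod, Measure.prod_prod, ENNReal.toReal_mul, hI,
      Real.volume_Ioo, ENNReal.toReal_ofReal (by linarith), measureReal_def]
    ring
  rw [integral_avgMeasure, smul_eq_mul]
  rw [← hB, ← hI] at ht hBΩ ⊢
  rw [hQ]
  have hDi : Integrable (fun z => ‖Du z‖ ^ (p - 1)) (volume.restrict (B ×ˢ I)) :=
    IntegrableOn.mono_set (integrable_norm_rpow_of_memLp hp0 (by linarith) (by linarith)
      h.memLp_Du) hBΩ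
  have hFi : Integrable (fun z => ‖F z‖ ^ (p - 1)) (volume.restrict (B ×ˢ I)) :=
    IntegrableOn.mono_set (integrable_norm_rpow_of_memLp hp0 (by linarith) (by linarith)
      h.memLp_F) hBΩ
  have hle : ∫ z in B ×ˢ I, (L * ‖Du z‖ ^ (p - 1) + ‖F z‖ ^ (p - 1))
      ≤ max L 1 * ∫ z in B ×ˢ I, (‖Du z‖ ^ (p - 1) + ‖F z‖ ^ (p - 1)) := by
    rw [← integral_const_mul]
    refine integral_mono ((hDi.const_mul L).add hFi) ((hDi.add hFi).const_mul _) fun z => ?_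
    have h1 : 0 ≤ ‖Du z‖ ^ (p - 1) := Real.rpow_nonneg (norm_nonneg _) _
    have h2 : 0 ≤ ‖F z‖ ^ (p - 1) := Real.rpow_nonneg (norm_nonneg _) _
    have h3 := mul_le_mul_of_nonneg_right (le_max_left L 1) h1
    have h4 := mul_le_mul_of_nonneg_right (le_max_right L 1) h2
    linarith
  obtain ⟨J, hJ⟩ : ∃ J, J = ∫ z in B ×ˢ I, (‖Du z‖ ^ (p - 1) + ‖F z‖ ^ (p - 1)) := ⟨_, rfl⟩
  rw [← hJ] at hle ⊢
  obtain ⟨V, hV'⟩ : ∃ V, V = volume.real B := ⟨_, rfl⟩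
  rw [← hV'] at hV ⊢
  obtain ⟨r, hr⟩ : ∃ r : ℝ, r = (μ * ρ)⁻¹ ^ (p - 1) := ⟨_, rfl⟩
  have hr0 : 0 < r := hr ▸ by positivity
  have hrel : μ * r * τ = ρ := by
    have h1 : μ ^ (p - 2) = μ ^ (p - 1) / μ := by
      rw [← Real.rpow_sub_one hμ.ne']; congr 1; ring
    have h2 : ρ ^ p = ρ ^ (p - 1) * ρ := by
      rw [← Real.rpow_add_one hρ.ne']; congr 1; ring
    rw [hr, hτ, Real.inv_rpow (by positivity), Real.mul_rpow hμ.le hρ.le, h1, h2]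
    field_simp
  rw [← hr, Real.norm_of_nonneg (by positivity)]
  have hnM : 0 ≤ (n : ℝ) * (M / ρ) := by positivity
  calc _ ≤ μ * (r * V⁻¹ * (n * (M / ρ) * (max L 1 * J))) :=
        mul_le_mul_of_nonneg_left (mul_le_mul_of_nonneg_left
          (ht.trans (mul_le_mul_of_nonneg_left hle hnM)) (by positivity)) hμ.le
    _ = (μ * r * τ) / ρ * (n * M * (max L 1 * J)) * (V * τ)⁻¹ := by field_simp
    _ = _ := by rw [hrel]; field_simp

/-- The spatial `L^p` norms of a weak solution are bounded uniformly in time. -/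
theorem exists_integral_slice_le (h : WeakSolution p ν L T Ω A F u Du) (hp : 1 ≤ p) :
    ∃ R, ∀ t ∈ Icc (0 : ℝ) T, ∫ x in Ω, ‖u (x, t)‖ ^ p ≤ R := by
  have hp0 : 0 < p := by linarith
  have hfin : IsFiniteMeasure (volume.restrict Ω) :=
    isFiniteMeasure_restrict.2 h.bddΩ.measure_lt_top.ne
  refine isCompact_Icc.induction_on
    (p := fun s : Set ℝ => ∃ R, ∀ t ∈ s, t ∈ Icc (0 : ℝ) T → ∫ x in Ω, ‖u (x, t)‖ ^ p ≤ R)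
    ⟨0, by simp⟩ ?_ ?_ ?_ |>.imp fun R hR t ht => hR t ht ht
  · rintro s t hst ⟨R, hR⟩
    exact ⟨R, fun x hx => hR x (hst hx)⟩
  · rintro s t ⟨R, hR⟩ ⟨R', hR'⟩
    refine ⟨max R R', fun x hx hx' => ?_⟩
    rcases hx with hx | hx
    · exact (hR x hx hx').trans (le_max_left _ _)
    · exact (hR' x hx hx').trans (le_max_right _ _)
  · intro t₀ ht₀
    refine ⟨_, ((h.timeCont t₀ ht₀).eventually (Iio_mem_nhds one_pos)),
      2 ^ p * (1 + ∫ x in Ω, ‖u (x, t₀)‖ ^ p), fun t ht htT => ?_⟩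
    have hd := integrable_norm_rpow_of_memLp hp0 hp0.le le_rfl
      ((h.sliceLp t htT).sub (h.sliceLp t₀ ht₀))
    have h0 := integrable_norm_rpow_of_memLp hp0 hp0.le le_rfl (h.sliceLp t₀ ht₀)
    have h1 := integrable_norm_rpow_of_memLp hp0 hp0.le le_rfl (h.sliceLp t htT)
    have ht' : ∫ x in Ω, ‖u (x, t) - u (x, t₀)‖ ^ p < 1 := ht
    calc _ ≤ ∫ x in Ω, 2 ^ p * (‖u (x, t) - u (x, t₀)‖ ^ p + ‖u (x, t₀)‖ ^ p) := by
          refine integral_mono h1 ((hd.add h0).const_mul _) fun x => ?_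
          refine le_trans ?_ (add_rpow_le_two_rpow_mul (norm_nonneg _) (norm_nonneg _) hp0.le)
          refine Real.rpow_le_rpow (norm_nonneg _) ?_ hp0.le
          simpa using norm_add_le (u (x, t) - u (x, t₀)) (u (x, t₀))
      _ = 2 ^ p * ((∫ x in Ω, ‖u (x, t) - u (x, t₀)‖ ^ p) + ∫ x in Ω, ‖u (x, t₀)‖ ^ p) := by
          rw [integral_const_mul]; congr 1; exact integral_add hd h0
      _ ≤ _ := by
          have : (0 : ℝ) ≤ 2 ^ p := by positivity
          exact mul_le_mul_of_nonneg_left (by linarith) this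

/-- The slicewise oscillation is dominated by its supremum over time. -/
theorem average_slice_le_iSup (h : WeakSolution p ν L T Ω A F u Du) (hp : 1 ≤ p)
    {x₀ : Spc n} {ρ : ℝ} (hρ : 0 < ρ) {I : Set ℝ} (hBΩ : Metric.ball x₀ ρ ⊆ Ω)
    (hI : I ⊆ Ioo 0 T) (b : Vec N) {κ : ℝ} (hκ : 0 < κ) {t : ℝ} (ht : t ∈ I) :
    ⨍ x in Metric.ball x₀ ρ, ‖pw (p / 2) (u (x, t)) - pw (p / 2) b‖ ^ 2 / κ
      ≤ ⨆ s ∈ I, ⨍ x in Metric.ball x₀ ρ, ‖pw (p / 2) (u (x, s)) - pw (p / 2) b‖ ^ 2 / κ := by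
  have hp0 : 0 < p := by linarith
  obtain ⟨R, hR⟩ := h.exists_integral_slice_le hp
  have hfin : IsFiniteMeasure (volume.restrict Ω) :=
    isFiniteMeasure_restrict.2 h.bddΩ.measure_lt_top.ne
  have hV : 0 < volume.real (Metric.ball x₀ ρ) :=
    ENNReal.toReal_pos (volume_ball_ne_zero x₀ hρ) (volume_ball_ne_top x₀ ρ)
  have hbd : ∀ s ∈ I, ⨍ x in Metric.ball x₀ ρ, ‖pw (p / 2) (u (x, s)) - pw (p / 2) b‖ ^ 2 / κ
      ≤ (volume.real (Metric.ball x₀ ρ))⁻¹ *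
        ((2 * R + ∫ _ in Metric.ball x₀ ρ, 2 * ‖b‖ ^ p) / κ) := by
    intro s hs
    have hsT : s ∈ Icc 0 T := Ioo_subset_Icc_self (hI hs)
    have hi := integrable_norm_rpow_of_memLp hp0 hp0.le le_rfl (h.sliceLp s hsT)
    have hiB : Integrable (fun x => ‖u (x, s)‖ ^ p) (volume.restrict (Metric.ball x₀ ρ)) :=
      IntegrableOn.mono_set hi hBΩ
    have hfB : IsFiniteMeasure (volume.restrict (Metric.ball x₀ ρ)) :=
      isFiniteMeasure_restrict.2 (volume_ball_ne_top x₀ ρ)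
    have hum : AEStronglyMeasurable (fun x => u (x, s)) (volume.restrict (Metric.ball x₀ ρ)) :=
      (h.measu.comp measurable_prodMk_right).aestronglyMeasurable
    rw [setAverage_eq, smul_eq_mul, integral_div]
    refine mul_le_mul_of_nonneg_left (div_le_div_of_nonneg_right ?_ hκ.le) (inv_nonneg.2 hV.le)
    calc _ ≤ ∫ x in Metric.ball x₀ ρ, (2 * ‖u (x, s)‖ ^ p + 2 * ‖b‖ ^ p) :=
          integral_mono (integrable_pw_half_sub_sq hp0 hum hiB b)
            ((hiB.const_mul 2).add (integrable_const _))
            fun x => norm_pw_half_sub_sq_le_add hp0 _ _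
      _ = 2 * (∫ x in Metric.ball x₀ ρ, ‖u (x, s)‖ ^ p)
          + ∫ _ in Metric.ball x₀ ρ, 2 * ‖b‖ ^ p := by
          rw [integral_add (hiB.const_mul 2) (integrable_const _), integral_const_mul]
      _ ≤ _ := by
          have h1 := setIntegral_mono_set hi
            (ae_of_all _ fun x => Real.rpow_nonneg (norm_nonneg _) _) hBΩ.eventuallyLE
          have h2 := hR s hsT
          linarith
  obtain ⟨R', hR'⟩ : ∃ R', R' = (volume.real (Metric.ball x₀ ρ))⁻¹ *
    ((2 * R + ∫ _ in Metric.ball x₀ ρ, 2 * ‖b‖ ^ p) / κ) := ⟨_, rfl⟩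
  rw [← hR'] at hbd
  refine le_ciSup_of_le ⟨max R' 0, ?_⟩ t (by rw [ciSup_pos ht])
  rintro _ ⟨s, rfl⟩
  by_cases hs : s ∈ I
  · simp only [ciSup_pos hs]
    exact (hbd s hs).trans (le_max_left _ _)
  · simp [hs]

end WeakSolution

theorem parCyl_of_le_two {p μ ρ : ℝ} (hp2 : p ≤ 2) (z₀ : Spc n × ℝ) :
    parCyl p μ ρ z₀ = Metric.ball z₀.1 ρ ×ˢ
      Ioo (z₀.2 - μ ^ (p - 2) * ρ ^ p) (z₀.2 + μ ^ (p - 2) * ρ ^ p) := by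
  rw [parCyl]
  split_ifs with h
  · rfl
  · obtain rfl : p = 2 := by linarith
    simp

/-- Scaling of the oscillation under the intrinsic normalization of `u`. -/
theorem sq_mul_norm_pw_half_smul_sub_sq {p μ ρ : ℝ} (hμ : 0 < μ) (hρ : 0 < ρ) (a b : Vec N) :
    μ ^ 2 * ‖pw (p / 2) ((μ * ρ)⁻¹ • a) - pw (p / 2) ((μ * ρ)⁻¹ • b)‖ ^ 2
      = ‖pw (p / 2) a - pw (p / 2) b‖ ^ 2 / (μ ^ (p - 2) * ρ ^ p) := by
  have hr : 0 < (μ * ρ)⁻¹ := by positivity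
  have h1 : μ ^ (p - 2) = μ ^ p / μ ^ 2 := by
    rw [Real.rpow_sub hμ, Real.rpow_two]
  have h2 : (((μ * ρ)⁻¹) ^ (p / 2)) ^ 2 = (μ ^ p * ρ ^ p)⁻¹ := by
    rw [← Real.rpow_natCast, ← Real.rpow_mul hr.le, Real.inv_rpow (by positivity),
      Real.mul_rpow hμ.le hρ.le]
    norm_num
  rw [pw_smul hr, pw_smul hr, ← smul_sub, norm_smul, mul_pow, Real.norm_of_nonneg (by positivity),
    h2, h1]
  field_simp

set_option maxHeartbeats 1600000 in
/-- Sobolev–Poincaré inequality, subquadratic case: let `max{2n/(n+2), 1} < p ≤ 2` and `u` a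
weak solution. On any cylinder `Q_ρ^{(μ)}(z₀) ⊆ Ω_T` which is both `μ`-sub-intrinsic and
`μ`-super-intrinsic with constant `K`, for any `ε ∈ (0, 1]`, with `q = max{2n/(n+2), 1}` and
`c = c(n, p, L, K)`:
`⨍⨍ |u^⟨p/2⟩ − ((u))^⟨p/2⟩|²/(μ^{p−2}ρ^p)
  ≤ ε [sup_t ⨍_{B_ρ} |u^⟨p/2⟩(t) − ((u))^⟨p/2⟩|²/(μ^{p−2}ρ^p) + ⨍⨍ |Du|^p]
    + (c/ε^{(2−q(p−1))/(q(p−1))}) [(⨍⨍ |Du|^q)^{p/q} + ⨍⨍ |F|^p]`. -/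
theorem sobolev_poincare_subquadratic (n : ℕ) (p L K : ℝ)
    (hp : max (2 * (n : ℝ) / ((n : ℝ) + 2)) 1 < p) (hp2 : p ≤ 2) (hK : 1 ≤ K) :
    ∃ c > 0, ∀ (N : ℕ) (ν T : ℝ) (Ω : Set (Spc n))
      (A : Spc n × ℝ → Vec N → Mat N n → Mat N n) (F : Spc n × ℝ → Mat N n)
      (u : Spc n × ℝ → Vec N) (Du : Spc n × ℝ → Mat N n),
      WeakSolution p ν L T Ω A F u Du →
      ∀ (z₀ : Spc n × ℝ) (ρ μ : ℝ), 0 < ρ → 0 < μ →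
        parCyl p μ ρ z₀ ⊆ Ω ×ˢ Ioo 0 T →
        SubIntrinsic p K μ ρ z₀ u Du F →
        SuperIntrinsic p K μ ρ z₀ u Du F →
        ∀ ε ∈ Ioc (0 : ℝ) 1,
          ⨍ z in parCyl p μ ρ z₀,
              ‖pw (p / 2) (u z) - pw (p / 2) (⨍ w in parCyl p μ ρ z₀, u w)‖ ^ 2
                / (μ ^ (p - 2) * ρ ^ p)
            ≤ ε * ((⨆ t ∈ Ioo (z₀.2 - μ ^ (p - 2) * ρ ^ p) (z₀.2 + μ ^ (p - 2) * ρ ^ p),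
                    ⨍ x in Metric.ball z₀.1 ρ,
                      ‖pw (p / 2) (u (x, t)) - pw (p / 2) (⨍ w in parCyl p μ ρ z₀, u w)‖ ^ 2
                        / (μ ^ (p - 2) * ρ ^ p))
                  + ⨍ z in parCyl p μ ρ z₀, ‖Du z‖ ^ p)
              + c / ε ^ ((2 - max (2 * (n : ℝ) / ((n : ℝ) + 2)) 1 * (p - 1))
                    / (max (2 * (n : ℝ) / ((n : ℝ) + 2)) 1 * (p - 1)))
                * ((⨍ z in parCyl p μ ρ z₀, ‖Du z‖ ^ (max (2 * (n : ℝ) / ((n : ℝ) + 2)) 1))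
                      ^ (p / max (2 * (n : ℝ) / ((n : ℝ) + 2)) 1)
                    + ⨍ z in parCyl p μ ρ z₀, ‖F z‖ ^ p) := by
  obtain ⟨q, hq⟩ : ∃ q, q = max (2 * (n : ℝ) / ((n : ℝ) + 2)) 1 := ⟨_, rfl⟩
  rw [← hq] at hp ⊢
  have hq1 : 1 ≤ q := hq ▸ le_max_right _ _
  have hp1 : 1 < p := by linarith
  have hp0 : 0 < p := by linarith
  rcases Nat.lt_or_ge n 1 with hn | hn
  · exact ⟨1, one_pos, fun N ν T Ω A F u Du h => absurd h.hn (by omega)⟩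
  obtain ⟨C, hC, hSP⟩ := exists_sobolev_poincare_ball hn hq
  obtain ⟨C₁, hC₁, hslice⟩ := exists_integrable_sub_sq_le (n := n) hq1 hC
  obtain ⟨C₀, M, hM0, hweight⟩ := exists_weight_ball n
  have hC₂ : 0 ≤ 2 * n * M * max L 1 := by
    have : 0 ≤ max L 1 := zero_le_one.trans (le_max_right _ _)
    positivity
  obtain ⟨c, hc, hest⟩ := exists_normalized_estimate (C₀ := C₀) hp1 hp2 hq1 hp.le hK hC₁ hC₂
  refine ⟨c, by linarith, ?_⟩
  intro N ν T Ω A F u Du h z₀ ρ μ hρ hμ hsub hSub hSup ε hε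
  have hfin := h.isFiniteMeasure
  obtain ⟨κ, hκ⟩ : ∃ κ, κ = μ ^ (p - 2) * ρ ^ p := ⟨_, rfl⟩
  have hκ0 : 0 < κ := hκ ▸ by positivity
  rw [SubIntrinsic] at hSub
  rw [SuperIntrinsic] at hSup
  rw [parCyl_of_le_two hp2, ← hκ] at hsub hSub hSup ⊢
  obtain ⟨B, hB⟩ : ∃ B, B = Metric.ball z₀.1 ρ := ⟨_, rfl⟩
  obtain ⟨I, hI⟩ : ∃ I, I = Ioo (z₀.2 - κ) (z₀.2 + κ) := ⟨_, rfl⟩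
  have hB0 : volume B ≠ 0 := hB ▸ volume_ball_ne_zero _ hρ
  have hBt : volume B ≠ ∞ := hB ▸ volume_ball_ne_top _ ρ
  have hI0 : volume I ≠ 0 := by
    rw [hI, Real.volume_Ioo]; simp only [ne_eq, ENNReal.ofReal_eq_zero]; linarith
  have hIt : volume I ≠ ∞ := by rw [hI, Real.volume_Ioo]; exact ENNReal.ofReal_ne_top
  obtain ⟨hBΩ, hIT⟩ : B ⊆ Ω ∧ I ⊆ Ioo 0 T := by
    rcases prod_subset_prod_iff.1 hsub with h1 | h1 | h1
    · rwa [hB, hI]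
    · exact absurd (hB ▸ h1 ▸ measure_empty) hB0
    · exact absurd (hI ▸ h1 ▸ measure_empty) hI0
  have hPB := isProbabilityMeasure_avgMeasure hB0 hBt
  have hPI := isProbabilityMeasure_avgMeasure hI0 hIt
  have hPQ : avgMeasure (B ×ˢ I) = (avgMeasure B).prod (avgMeasure I) := avgMeasure_prod hB0 hBt
  have hQ0 : volume (B ×ˢ I) ≠ 0 := by
    rw [Measure.volume_eq_prod, Measure.prod_prod]; exact mul_ne_zero hB0 hI0
  obtain ⟨η, hηc, hηs, hηB, hηM, hη⟩ := hweight z₀.1 hρ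
  have hglue := h.ae_norm_wmean_sub_le hp1 hρ hμ hκ hsub hηc hηs hηB hM0 hηM
  have hSPs := h.ae_lintegral_sub_sq_le hp1.le hq1 (a := 2 * (n : ℝ) + 2 - 2 * n / q)
    (by
      have : 2 * (n : ℝ) / q ≤ 2 * n := div_le_self (by positivity) hq1
      linarith) hSP hρ isOpen_Ioo hsub
  have hsupt : ∀ t ∈ I, _ := fun t ht => h.average_slice_le_iSup hp1.le hρ (hB ▸ hBΩ) hIT
    (⨍ w in B ×ˢ I, u w) hκ0 ht
  rw [← hB, ← hI] at hsub hSub hSup hglue hSPs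
  rw [← hB] at hsupt hη
  rw [← hB, ← hI]
  simp only [setAverage_eq_integral_avgMeasure] at hSub hSup hsupt ⊢
  rw [hPQ] at hSub hSup hsupt hglue ⊢
  have h_int : ∀ {E : Type} [NormedAddCommGroup E] {g : Spc n × ℝ → E} {r : ℝ}, 0 ≤ r →
      r ≤ p → MemLp g (ENNReal.ofReal p) (volume.restrict (Ω ×ˢ Ioo 0 T)) →
      Integrable (fun z => ‖g z‖ ^ r) ((avgMeasure B).prod (avgMeasure I)) := by
    intro E _ g r hr hrp hg
    rw [← hPQ]
    exact Integrable.avgMeasure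
      (IntegrableOn.mono_set (integrable_norm_rpow_of_memLp hp0 hr hrp hg) hsub) hQ0
  obtain ⟨P, hP⟩ : ∃ P, P = (avgMeasure B).prod (avgMeasure I) := ⟨_, rfl⟩
  obtain ⟨a, ha⟩ : ∃ a, a = ∫ z, u z ∂P := ⟨_, rfl⟩
  obtain ⟨S, hS⟩ : ∃ S, S = ⨆ t ∈ I, ∫ x, ‖pw (p / 2) (u (x, t)) - pw (p / 2) a‖ ^ 2 / κ
    ∂(avgMeasure B) := ⟨_, rfl⟩
  have hS0 : 0 ≤ S := hS ▸ Real.iSup_nonneg fun t => Real.iSup_nonneg fun _ =>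
    integral_nonneg fun x => by positivity
  have hum : Measurable fun z => (μ * ρ)⁻¹ • u z := h.measu.const_smul (μ * ρ)⁻¹
  have hui := h_int hp0.le le_rfl h.memLp_u
  have hDi := h_int hp0.le le_rfl h.memLp_Du
  have hFi := h_int hp0.le le_rfl h.memLp_F
  have hDq := h_int (by linarith) hp.le h.memLp_Du
  rw [← hP] at hSub hSup hsupt hglue hui hDi hFi ⊢
  rw [← ha] at hsupt ⊢
  rw [← hS] at hsupt ⊢
  have hmean : ∫ z, (μ * ρ)⁻¹ • u z ∂P = (μ * ρ)⁻¹ • a := by rw [integral_smul, ha]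
  have hnorm : ∀ z, ‖(μ * ρ)⁻¹ • u z‖ ^ p = (μ ^ p * ρ ^ p)⁻¹ * ‖u z‖ ^ p := fun z => by
    rw [norm_smul, Real.norm_of_nonneg (by positivity), Real.mul_rpow (by positivity)
      (norm_nonneg _), Real.inv_rpow (by positivity), Real.mul_rpow hμ.le hρ.le]
  have hnint : ∫ z, ‖(μ * ρ)⁻¹ • u z‖ ^ p ∂P = (μ ^ p * ρ ^ p)⁻¹ * ∫ z, ‖u z‖ ^ p ∂P := by
    simp_rw [hnorm]; rw [integral_const_mul]
  have hexp : μ ^ (2 - max p 2) * ρ ^ p = ρ ^ p := by rw [max_eq_right hp2]; simp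
  rw [hexp, integral_div] at hSub hSup
  have hμp : 0 < μ ^ p := by positivity
  have hρp : 0 < ρ ^ p := by positivity
  have hmain := hest (u := fun z => (μ * ρ)⁻¹ • u z) (d := fun z => ‖Du z‖)
    (f := fun z => ‖F z‖) (μ := μ) (S := S) (ε := ε) hη hum h.measDu.norm h.measF.norm
    (fun z => norm_nonneg _) (fun z => norm_nonneg _)
    (by rw [← hP]; simp_rw [hnorm]; exact hui.const_mul _) (by rw [← hP]; exact hDi)
    (by rw [← hP]; exact hFi) hμ hS0 hε.1 hε.2
    (by
      filter_upwards [avgMeasure_absolutelyContinuous.ae_le hSPs, hDq.prod_left_ae] with t ht ht'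
      rw [hB] at ht ht' ⊢
      exact hslice (h.measu.comp measurable_prodMk_right) hρ hμ ht' ht)
    (by rw [← hP]; exact hglue)
    (by
      rw [← hP, hnint]
      calc _ = (∫ z, ‖u z‖ ^ p ∂P) / ρ ^ p / μ ^ p := by field_simp
        _ ≤ (K * μ ^ p * ∫ z, (‖Du z‖ ^ p + ‖F z‖ ^ p) ∂P) / μ ^ p :=
          div_le_div_of_nonneg_right hSub hμp.le
        _ = _ := by field_simp)
    (by
      rw [← hP, hnint]
      refine hSup.imp_left fun h1 => ?_
      calc _ = (μ ^ p * ∫ z, (‖Du z‖ ^ p + ‖F z‖ ^ p) ∂P) / μ ^ p := by field_simp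
        _ ≤ (K * ((∫ z, ‖u z‖ ^ p ∂P) / ρ ^ p)) / μ ^ p :=
          div_le_div_of_nonneg_right h1 hμp.le
        _ = _ := by field_simp)
    (by
      rw [← hP, hmean]
      filter_upwards [avgMeasure_absolutelyContinuous.ae_le
        (ae_restrict_mem (hI ▸ measurableSet_Ioo))] with t ht
      rw [← integral_const_mul]
      simp_rw [sq_mul_norm_pw_half_smul_sub_sq hμ hρ, ← hκ]
      exact hsupt t ht)
  rw [← hP, hmean, ← integral_const_mul] at hmain
  simp_rw [sq_mul_norm_pw_half_smul_sub_sq hμ hρ, ← hκ] at hmain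
  rwa [Real.rpow_neg hε.1.le, ← div_eq_mul_inv] at hmain
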